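/- arXiv:math/0509036 — 4 statements merged into one kernel-verified Lean document; each statement's English description precedes it below -/
import Mathlib

section
/- Let G be a finitely presented group and let p be a prime. Suppose that G has an infinite strictly nested sequence H₁ > H₂ > ⋯ of subnormal subgroups, each with index a power of p in G, and with linear growth of mod p homology. Then G has an infinite strictly nested sequence of subnormal subgroups, each with index a power of p, which has linear growth of mod p homology and with respect to which G moreover has Property (τ). -/
open scoped TensorProduct

/-- mod p homology dimension -/
noncomputable def dp (p : ℕ) (G : Type*) [Group G] : ℕ :=
  Module.finrank (ZMod p) (ZMod p ⊗[ℤ] Additive (Abelianization G))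

def IsSubnormal {G : Type*} [Group G] (H : Subgroup G) : Prop :=
  ∃ (n : ℕ) (c : ℕ → Subgroup G), c 0 = H ∧ c n = ⊤ ∧
    ∀ i < n, c i ≤ c (i + 1) ∧ ∀ g ∈ c (i + 1), ∀ x ∈ c i, g * x * g⁻¹ ∈ c i

def IsFinitelyPresented (G : Type*) [Group G] : Prop :=
  ∃ (n : ℕ) (R : Finset (FreeGroup (Fin n))) (f : FreeGroup (Fin n) →* G),
    Function.Surjective f ∧ f.ker = Subgroup.normalClosure (R : Set (FreeGroup (Fin n)))

def IsLarge (G : Type*) [Group G] : Prop :=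
  ∃ H : Subgroup G, H.FiniteIndex ∧ ∃ f : H →* FreeGroup (Fin 2), Function.Surjective f

def schreierBoundary (G : Type*) [Group G] (S : Set G) (H : Subgroup G)
    (A : Set (G ⧸ H)) : Set (G × (G ⧸ H)) :=
  {e | e.1 ∈ S ∧ ((e.2 ∈ A) ≠ (e.1 • e.2 ∈ A))}

noncomputable def cheeger (G : Type*) [Group G] (S : Set G) (H : Subgroup G) : ℝ :=
  sInf {r : ℝ | ∃ A : Set (G ⧸ H), A.Nonempty ∧
    2 * (Nat.card A : ℝ) ≤ (Nat.card (G ⧸ H) : ℝ) ∧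
    r = (Nat.card (schreierBoundary G S H A) : ℝ) / (Nat.card A : ℝ)}

def PropertyTau (G : Type*) [Group G] {ι : Type*} (Gs : ι → Subgroup G) : Prop :=
  ∃ S : Finset G, Subgroup.closure (S : Set G) = ⊤ ∧
    ∃ ε : ℝ, 0 < ε ∧ ∀ i, ε ≤ cheeger G (S : Set G) (Gs i)

def LinearGrowthModP (p : ℕ) {G : Type*} [Group G] (Gs : ℕ → Subgroup G) : Prop :=
  ∃ c : ℝ, 0 < c ∧ ∀ i, c ≤ (dp p ↥(Gs i) : ℝ) / ((Gs i).index : ℝ)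

namespace Lack

/-- cocycles for a group `F` acting on `V` through `f : F →* G`. -/
def IsCoc {F G V Γ : Type*} [Group F] [Group G] [MulAction G V] [Group Γ]
    (f : F →* G) (c : F → V → Γ) : Prop :=
  ∀ w w' v, c (w * w') v = c w (f w' • v) * c w' v

section
variable {F G V Γ Γ' : Type*} [Group F] [Group G] [MulAction G V] [Group Γ] [Group Γ']
variable {f : F →* G} {c : F → V → Γ}

theorem IsCoc.one (hc : IsCoc f c) (v : V) : c 1 v = 1 := by
  have := hc 1 1 v
  simp at this
  exact this

theorem IsCoc.inv (hc : IsCoc f c) (w : F) (v : V) : c w⁻¹ v = (c w ((f w)⁻¹ • v))⁻¹ := by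
  have := hc w w⁻¹ v
  rw [mul_inv_cancel, hc.one, map_inv] at this
  exact (inv_eq_of_mul_eq_one_right this.symm).symm

theorem IsCoc.map (hc : IsCoc f c) (ν : Γ →* Γ') : IsCoc f (fun w v => ν (c w v)) := by
  intro w w' v
  simp [hc w w' v]

theorem IsCoc.mul {A : Type*} [CommGroup A] {c d : F → V → A} (hc : IsCoc f c) (hd : IsCoc f d) :
    IsCoc f (fun w v => c w v * d w v) := by
  intro w w' v
  simp only [hc w w' v, hd w w' v]
  exact mul_mul_mul_comm _ _ _ _

theorem IsCoc.comp {E : Type*} [Group E] (hc : IsCoc f c) (e : E →* F) :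
    IsCoc (f.comp e) (fun w v => c (e w) v) := by
  intro w w' v
  simp [hc (e w) (e w') v]

end

section
variable {α G V Γ Γ' : Type*} [Group G] [MulAction G V] [Group Γ] [Group Γ']
variable (f : FreeGroup α →* G)

theorem IsCoc.ext_free {c d : FreeGroup α → V → Γ} {f : FreeGroup α →* G}
    (hc : IsCoc f c) (hd : IsCoc f d)
    (h : ∀ a v, c (FreeGroup.of a) v = d (FreeGroup.of a) v) (w : FreeGroup α) :
    ∀ v, c w v = d w v := by
  induction w using FreeGroup.induction_on with
  | C1 => intro v; rw [hc.one, hd.one]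
  | of a => exact h a
  | inv_of a ih => intro v; rw [hc.inv, hd.inv, h]
  | mul x y hx hy => intro v; rw [hc, hd, hx, hy]

/-- generator permutation -/
def genPerm (lam : α → V → Γ) (a : α) : Equiv.Perm (V × Γ) where
  toFun x := (f (FreeGroup.of a) • x.1, lam a x.1 * x.2)
  invFun x := ((f (FreeGroup.of a))⁻¹ • x.1, (lam a ((f (FreeGroup.of a))⁻¹ • x.1))⁻¹ * x.2)
  left_inv x := by simp
  right_inv x := by simp

/-- the cocycle with given labels -/
def coc (lam : α → V → Γ) (w : FreeGroup α) (v : V) : Γ :=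
  (FreeGroup.lift (genPerm f lam) w (v, 1)).2

theorem coc_perm (lam : α → V → Γ) (w : FreeGroup α) : ∀ (v : V) (x : Γ),
    FreeGroup.lift (genPerm f lam) w (v, x) = (f w • v, coc f lam w v * x) := by
  unfold coc
  induction w using FreeGroup.induction_on with
  | C1 => intro v x; simp
  | of a => intro v x; simp [genPerm]
  | inv_of a ih => intro v x; simp [genPerm, Equiv.Perm.inv_def, Equiv.symm]
  | mul a b ha hb =>
    intro v x
    rw [map_mul, Equiv.Perm.mul_apply, Equiv.Perm.mul_apply, hb v x, ha _ (_ * x), hb v 1,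
      ha _ (_ * 1)]
    simp [mul_smul, mul_assoc]

theorem coc_isCoc (lam : α → V → Γ) : IsCoc f (coc f lam) := by
  intro w w' v
  have h : FreeGroup.lift (genPerm f lam) (w * w') (v, 1) =
    FreeGroup.lift (genPerm f lam) w (FreeGroup.lift (genPerm f lam) w' (v, 1)) := by
    rw [map_mul]; rfl
  rw [coc_perm, coc_perm, coc_perm] at h
  simpa using congrArg Prod.snd h

@[simp] theorem coc_of (lam : α → V → Γ) (a : α) (v : V) :
    coc f lam (FreeGroup.of a) v = lam a v := by
  simp [coc, genPerm]

theorem coc_eq {f : FreeGroup α →* G} {c : FreeGroup α → V → Γ} (hc : IsCoc f c)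
    (lam : α → V → Γ)
    (h : ∀ a v, c (FreeGroup.of a) v = lam a v) (w : FreeGroup α) (v : V) :
    coc f lam w v = c w v :=
  (coc_isCoc f lam).ext_free hc (by simp [h]) w v

theorem coc_desc (hf : Function.Surjective f) (R : Set (FreeGroup α))
    (hker : f.ker = Subgroup.normalClosure R) {c : FreeGroup α → V → Γ} (hc : IsCoc f c)
    (hR : ∀ r ∈ R, ∀ v, c r v = 1) :
    ∃ c' : G → V → Γ, IsCoc (MonoidHom.id G) c' ∧ ∀ w v, c' (f w) v = c w v := by
  let K : Subgroup (FreeGroup α) :=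
    { carrier := {w | (∀ v : V, f w • v = v) ∧ ∀ v, c w v = 1}
      one_mem' := ⟨by simp, hc.one⟩
      mul_mem' := by
        rintro a b ⟨ha, ha'⟩ ⟨hb, hb'⟩
        refine ⟨fun v => by rw [map_mul, mul_smul, hb, ha], fun v => by rw [hc, hb', ha', mul_one]⟩
      inv_mem' := by
        rintro a ⟨ha, ha'⟩
        refine ⟨fun v => by rw [map_inv, inv_smul_eq_iff, ha], fun v => by rw [hc.inv, ha', inv_one]⟩ }
  have hK : K.Normal := ⟨by
    rintro a ⟨ha, ha'⟩ g
    refine ⟨fun v => by simp [mul_smul, ha], fun v => ?_⟩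
    rw [hc, hc, ha', mul_one, hc.inv, map_inv, ha]
    exact mul_inv_cancel _⟩
  have hle : f.ker ≤ K := by
    rw [hker]
    apply Subgroup.normalClosure_le_normal
    intro r hr
    have : r ∈ f.ker := by rw [hker]; exact Subgroup.subset_normalClosure hr
    exact ⟨fun v => by rw [MonoidHom.mem_ker.mp this, one_smul], hR r hr⟩
  have key : ∀ w w', f w = f w' → ∀ v, c w v = c w' v := by
    intro w w' h v
    have : w'⁻¹ * w ∈ K := hle (by simp [MonoidHom.mem_ker, h])
    have e : w = w' * (w'⁻¹ * w) := by group
    rw [e, hc, this.1, this.2, mul_one]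
  refine ⟨fun g v => c (Function.surjInv hf g) v, ?_, ?_⟩
  · intro g g' v
    show c _ v = c _ (g' • v) * c _ v
    rw [key (Function.surjInv hf (g * g')) (Function.surjInv hf g * Function.surjInv hf g')
      (by simp [Function.surjInv_eq hf]), hc, Function.surjInv_eq hf]
  · intro w v
    exact key _ _ (Function.surjInv_eq hf _) v

end

end Lack

namespace Lack
open scoped TensorProduct

section
variable {α G V : Type*} [Group G] [MulAction G V] {p : ℕ}
variable (f : FreeGroup α →* G)

/-- additive version of `coc` -/
def acoc (φ : α × V → ZMod p) (w : FreeGroup α) (v : V) : ZMod p :=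
  Multiplicative.toAdd (coc f (fun a v => Multiplicative.ofAdd (φ (a, v))) w v)

@[simp] theorem acoc_of (φ : α × V → ZMod p) (a : α) (v : V) :
    acoc f φ (FreeGroup.of a) v = φ (a, v) := by simp [acoc]

theorem acoc_mul (φ : α × V → ZMod p) (w w' : FreeGroup α) (v : V) :
    acoc f φ (w * w') v = acoc f φ w (f w' • v) + acoc f φ w' v := by
  simp [acoc, coc_isCoc f _ w w' v]

theorem acoc_one (φ : α × V → ZMod p) (v : V) : acoc f φ 1 v = 0 := by
  simp [acoc, (coc_isCoc f _).one v]

/-- additive uniqueness -/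
theorem acoc_eq {f : FreeGroup α →* G} (φ : α × V → ZMod p) (d : FreeGroup α → V → ZMod p)
    (hd : ∀ w w' v, d (w * w') v = d w (f w' • v) + d w' v)
    (h : ∀ a v, d (FreeGroup.of a) v = φ (a, v)) (w : FreeGroup α) (v : V) :
    acoc f φ w v = d w v := by
  have hc : IsCoc f (fun w v => Multiplicative.ofAdd (d w v)) := by
    intro w w' v
    simp [hd]
  unfold acoc
  rw [coc_eq hc]
  · rfl
  · intro a v; simp [h]

/-- linear version -/
def acocL (w : FreeGroup α) (v : V) : (α × V → ZMod p) →ₗ[ZMod p] ZMod p where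
  toFun φ := acoc f φ w v
  map_add' φ ψ := by
    refine acoc_eq (φ + ψ) (fun w v => acoc f φ w v + acoc f ψ w v) ?_ ?_ w v
    · intro w w' v; simp only [acoc_mul]; ring
    · intro a v; simp
  map_smul' k φ := by
    refine acoc_eq (k • φ) (fun w v => k * acoc f φ w v) ?_ ?_ w v
    · intro w w' v; simp only [acoc_mul]; ring
    · intro a v; simp

@[simp] theorem acocL_apply (φ : α × V → ZMod p) (w : FreeGroup α) (v : V) :
  acocL f w v φ = acoc f φ w v := rfl

/-- cocycles of the presentation complex -/
def Z1 (R : Set (FreeGroup α)) : Submodule (ZMod p) (α × V → ZMod p) :=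
  ⨅ r : R, ⨅ v : V, LinearMap.ker (acocL f (r : FreeGroup α) v)

theorem mem_Z1 {R : Set (FreeGroup α)} {φ : α × V → ZMod p} :
    φ ∈ Z1 f R ↔ ∀ r ∈ R, ∀ v, acoc f φ r v = 0 := by
  simp [Z1, Submodule.mem_iInf]

end

/-- homs to `ZMod p`, as a vector space -/
abbrev HomP (p : ℕ) (K : Type*) [Group K] := Additive (Abelianization K) →ₗ[ℤ] ZMod p

theorem abOf_surjective (K : Type*) [Group K] :
    Function.Surjective (Abelianization.of : K →* Abelianization K) :=
  fun x => QuotientGroup.mk_surjective x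

theorem finite_E (p : ℕ) (K : Type*) [Group K] [Group.FG K] :
    Module.Finite (ZMod p) (ZMod p ⊗[ℤ] Additive (Abelianization K)) := by
  have : Group.FG (Abelianization K) :=
    Group.fg_of_surjective (f := Abelianization.of) (abOf_surjective K)
  have : AddGroup.FG (Additive (Abelianization K)) := inferInstance
  have : Module.Finite ℤ (Additive (Abelianization K)) := Module.Finite.iff_addGroup_fg.mpr this
  infer_instance

theorem dp_eq (p : ℕ) [Fact p.Prime] (K : Type*) [Group K] :
    dp p K = Module.finrank (ZMod p) (HomP p K) := by
  rw [dp, ← Subspace.dual_finrank_eq]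
  exact (LinearEquiv.finrank_eq (LinearMap.liftBaseChangeEquiv (R := ℤ) (M := Additive (Abelianization K)) (N := ZMod p) (ZMod p))).symm

theorem finite_HomP (p : ℕ) [Fact p.Prime] (K : Type*) [Group K] [Group.FG K] :
    Module.Finite (ZMod p) (HomP p K) := by
  have := finite_E p K
  exact Module.Finite.equiv (LinearMap.liftBaseChangeEquiv (R := ℤ) (M := Additive (Abelianization K)) (N := ZMod p) (ZMod p)).symm

/-- evaluate -/
def psi {p : ℕ} {K : Type*} [Group K] (l : HomP p K) (k : K) : ZMod p :=
  l (Additive.ofMul (Abelianization.of k))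

theorem psi_mul {p : ℕ} {K : Type*} [Group K] (l : HomP p K) (a b : K) :
    psi l (a * b) = psi l a + psi l b := by simp [psi]

theorem psi_ext {p : ℕ} {K : Type*} [Group K] {l l' : HomP p K} (h : ∀ k, psi l k = psi l' k) :
    l = l' := by
  ext x
  obtain ⟨y, hy⟩ := abOf_surjective K (Additive.toMul x)
  have := h y
  simp only [psi, hy] at this
  simpa using this

/-- build -/
def mkHomP {p : ℕ} {K : Type*} [Group K] (χ : K → ZMod p) (h : ∀ a b, χ (a * b) = χ a + χ b) :
    HomP p K :=
  AddMonoidHom.toIntLinearMap (MonoidHom.toAdditiveLeft (Abelianization.lift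
    (MonoidHom.mk' (fun k => Multiplicative.ofAdd (χ k)) (by intro a b; simp [h]))))

theorem psi_mkHomP {p : ℕ} {K : Type*} [Group K] (χ : K → ZMod p)
    (h : ∀ a b, χ (a * b) = χ a + χ b) (k : K) : psi (mkHomP χ h) k = χ k := by
  simp [psi, mkHomP]


/-- Lower bound for the dimension of the space of cocycles. -/
theorem dim_Z1 {n : ℕ} {G : Type*} [Group G] (p : ℕ) [Fact p.Prime]
    (f : FreeGroup (Fin n) →* G) (hf : Function.Surjective f) (R : Set (FreeGroup (Fin n)))
    (hR : ∀ r ∈ R, f r = 1) (H : Subgroup G) [H.FiniteIndex] [Fintype (G ⧸ H)] :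
    dp p H + Fintype.card (G ⧸ H) ≤
      Module.finrank (ZMod p) (Z1 (p := p) (V := G ⧸ H) f R) + 1 := by
  classical
  have hG : Group.FG G := Group.fg_of_surjective hf
  have := finite_HomP p H
  rw [dp_eq]
  let σ : G ⧸ H → G := Quotient.out
  have hσ : ∀ v, (σ v : G ⧸ H) = v := fun v => Quotient.out_eq v
  have hmem : ∀ (g : G) (v : G ⧸ H), (σ (g • v))⁻¹ * g * σ v ∈ H := by
    intro g v
    rw [mul_assoc, ← QuotientGroup.eq]
    rw [hσ]
    conv_lhs => rw [← hσ v]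
    rfl
  let τ : G → G ⧸ H → H := fun g v => ⟨_, hmem g v⟩
  have hτ : ∀ g g' v, τ (g * g') v = τ g (g' • v) * τ g' v := by
    intro g g' v
    ext
    simp [τ, mul_smul, mul_assoc]
  let C : HomP p H × (G ⧸ H → ZMod p) → G → G ⧸ H → ZMod p := fun x g v =>
    psi x.1 (τ g v) + (x.2 (g • v) - x.2 v)
  have hC : ∀ x g g' v, C x (g * g') v = C x g (g' • v) + C x g' v := by
    intro x g g' v
    simp only [C, hτ, psi_mul, mul_smul]
    ring
  let Φ : HomP p H × (G ⧸ H → ZMod p) →ₗ[ZMod p] (Fin n × (G ⧸ H) → ZMod p) :=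
    { toFun := fun x e => C x (f (FreeGroup.of e.1)) e.2
      map_add' := by
        intro x y
        ext e
        simp only [C, psi, Prod.fst_add, Prod.snd_add, LinearMap.add_apply, Pi.add_apply]
        ring
      map_smul' := by
        intro k x
        ext e
        simp only [C, psi, Prod.smul_fst, Prod.smul_snd, LinearMap.smul_apply, Pi.smul_apply,
          smul_eq_mul, RingHom.id_apply]
        ring }
  have hacoc : ∀ x w v, acoc f (Φ x) w v = C x (f w) v := by
    intro x w v
    refine acoc_eq (Φ x) (fun w v => C x (f w) v) ?_ ?_ w v
    · intro w w' v
      simp [hC]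
    · intro a v
      rfl
  have hC1 : ∀ x v, C x 1 v = 0 := by
    intro x v
    have := hC x 1 1 v
    simpa using this
  have hrange : LinearMap.range Φ ≤ Z1 f R := by
    rintro _ ⟨x, rfl⟩
    rw [mem_Z1]
    intro r hr v
    rw [hacoc, hR r hr, hC1]
  let v0 : G ⧸ H := ((1 : G) : G ⧸ H)
  have hker : ∀ x ∈ LinearMap.ker Φ, x.1 = 0 ∧ ∀ v, x.2 v = x.2 v0 := by
    intro x hx
    have h0 : ∀ g v, C x g v = 0 := by
      intro g v
      obtain ⟨w, rfl⟩ := hf g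
      rw [← hacoc, LinearMap.mem_ker.mp hx]
      exact map_zero (acocL f w v)
    have h1 : x.1 = 0 := by
      apply psi_ext
      intro h
      have hh := h0 (h : G) v0
      have hv : (h : G) • v0 = v0 := by
        show (((h : G) * 1 : G) : G ⧸ H) = ((1 : G) : G ⧸ H)
        rw [QuotientGroup.eq]; simp
      have hs : σ v0 ∈ H := by
        have := hσ v0
        rw [show v0 = ((1 : G) : G ⧸ H) from rfl, eq_comm, QuotientGroup.eq] at this
        simpa using this
      have : τ (h : G) v0 = (⟨_, hs⟩ : H)⁻¹ * h * ⟨_, hs⟩ := by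
        ext
        simp [τ, hv]
      simp only [C, hv, sub_self, add_zero, this, psi_mul] at hh
      have hi : psi x.1 (⟨_, hs⟩ : H)⁻¹ + psi x.1 ⟨_, hs⟩ = 0 := by
        rw [← psi_mul, inv_mul_cancel]; simp [psi]
      have : psi x.1 h = 0 := by linear_combination hh - hi
      rw [this]; rfl
    refine ⟨h1, fun v => ?_⟩
    obtain ⟨g, rfl⟩ := QuotientGroup.mk_surjective v
    have hh := h0 g v0
    have : g • v0 = (g : G ⧸ H) := by
      show ((g * 1 : G) : G ⧸ H) = _
      rw [mul_one]
    simp only [C, h1, this] at hh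
    have z : psi (0 : HomP p H) (τ g v0) = 0 := rfl
    rw [z, zero_add, sub_eq_zero] at hh
    exact hh
  have hkd : Module.finrank (ZMod p) (LinearMap.ker Φ) ≤ 1 := by
    let ev : LinearMap.ker Φ →ₗ[ZMod p] ZMod p :=
      (LinearMap.proj v0) ∘ₗ (LinearMap.snd _ _ _) ∘ₗ (LinearMap.ker Φ).subtype
    have hinj : Function.Injective ev := by
      rw [← LinearMap.ker_eq_bot, LinearMap.ker_eq_bot']
      intro x hx
      have hx' : x.1.2 v0 = 0 := hx
      obtain ⟨h1, h2⟩ := hker x.1 x.2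
      ext1
      refine Prod.ext h1 ?_
      funext v
      rw [h2, hx']; rfl
    simpa using LinearMap.finrank_le_finrank_of_injective hinj
  have h1 := LinearMap.finrank_range_add_finrank_ker Φ
  have h2 := Submodule.finrank_mono hrange
  rw [Module.finrank_prod, Module.finrank_fintype_fun_eq_card] at h1
  omega

/-- Lower bound for the homology of a group mapping onto a stabilizer in a free group. -/
theorem dp_lower {r : ℕ} {P Ω K : Type*} [Group P] [MulAction P Ω] [Group K] [Group.FG K]
    [Fintype Ω] (p : ℕ) [Fact p.Prime]
    (t : FreeGroup (Fin r) →* P) (ω : Ω) (hω : ∀ x : Ω, ∃ w, t w • ω = x)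
    (k : K →* FreeGroup (Fin r)) (hk : ∀ w, t w • ω = ω ↔ ∃ x, k x = w) :
    r * Fintype.card Ω ≤ dp p K + Fintype.card Ω := by
  classical
  have := finite_HomP p K
  rw [dp_eq]
  have hfix : ∀ x, t (k x) • ω = ω := fun x => (hk _).2 ⟨x, rfl⟩
  let Φ : (Fin r × Ω → ZMod p) →ₗ[ZMod p] HomP p K :=
    { toFun := fun φ => mkHomP (fun x => acoc t φ (k x) ω) (by
        intro a b
        simp only [map_mul, acoc_mul, hfix])
      map_add' := by
        intro φ ψ
        apply psi_ext
        intro x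
        have : ∀ l l' : HomP p K, psi (l + l') x = psi l x + psi l' x := fun _ _ => rfl
        rw [this]
        simp only [psi_mkHomP]
        exact map_add (acocL t (k x) ω) φ ψ
      map_smul' := by
        intro c φ
        apply psi_ext
        intro x
        have : ∀ l : HomP p K, psi (c • l) x = c * psi l x := fun _ => rfl
        simp only [RingHom.id_apply]
        rw [this]
        simp only [psi_mkHomP]
        exact map_smul (acocL t (k x) ω) c φ }
  let D : (Ω → ZMod p) →ₗ[ZMod p] (Fin r × Ω → ZMod p) :=
    { toFun := fun g e => g (t (FreeGroup.of e.1) • e.2) - g e.2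
      map_add' := by intro a b; ext e; simp; ring
      map_smul' := by intro a b; ext e; simp; ring }
  have hker : LinearMap.ker Φ ≤ LinearMap.range D := by
    intro φ hφ
    have h0 : ∀ x, acoc t φ (k x) ω = 0 := by
      intro x
      have : psi (Φ φ) x = 0 := by rw [LinearMap.mem_ker.mp hφ]; rfl
      rwa [show psi (Φ φ) x = acoc t φ (k x) ω from
        psi_mkHomP (fun x => acoc t φ (k x) ω) (by
          intro a b
          simp only [map_mul, acoc_mul, hfix]) x] at this
    choose s hs using hω
    have key : ∀ w w', t w • ω = t w' • ω → acoc t φ w ω = acoc t φ w' ω := by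
      intro w w' h
      have : t (w'⁻¹ * w) • ω = ω := by
        rw [map_mul, mul_smul, h, map_inv, inv_smul_smul]
      obtain ⟨x, hx⟩ := (hk _).1 this
      have e : w = w' * (w'⁻¹ * w) := by group
      rw [e, acoc_mul, this, ← hx, h0, add_zero]
    refine ⟨fun x => acoc t φ (s x) ω, ?_⟩
    ext ⟨a, x⟩
    show acoc t φ (s (t (FreeGroup.of a) • x)) ω - acoc t φ (s x) ω = φ (a, x)
    rw [key (s (t (FreeGroup.of a) • x)) (FreeGroup.of a * s x) (by rw [hs, map_mul, mul_smul, hs]),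
      acoc_mul, hs, acoc_of]
    ring
  have h1 := LinearMap.finrank_range_add_finrank_ker Φ
  have h2 := Submodule.finrank_mono hker
  have h3 := LinearMap.finrank_range_le D
  have h4 := Submodule.finrank_le (LinearMap.range Φ)
  rw [Module.finrank_fintype_fun_eq_card] at h1 h3
  rw [Fintype.card_prod, Fintype.card_fin] at h1
  omega

end Lack

namespace Lack

section
variable {α : Type*}

/-- edge templates of a word -/
def tmpl : List (α × Bool) → List (α × FreeGroup α)
  | [] => []
  | (s, true) :: L => (s, FreeGroup.mk L) :: tmpl L
  | (s, false) :: L => (s, (FreeGroup.of s)⁻¹ * FreeGroup.mk L) :: tmpl L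

theorem mk_cons_true (s : α) (L : List (α × Bool)) :
    FreeGroup.mk ((s, true) :: L) = FreeGroup.of s * FreeGroup.mk L := by
  simp [FreeGroup.of, FreeGroup.mul_mk]

theorem mk_cons_false (s : α) (L : List (α × Bool)) :
    FreeGroup.mk ((s, false) :: L) = (FreeGroup.of s)⁻¹ * FreeGroup.mk L := by
  simp [FreeGroup.of, FreeGroup.mul_mk, FreeGroup.inv_mk, FreeGroup.invRev]

variable {G V Γ ι : Type*} [Group G] [MulAction G V] [Group Γ] (f : FreeGroup α →* G)

/-- non-monochromatic edges -/
def bdry (κ : V → ι) : Set (α × V) := {e | κ (f (FreeGroup.of e.1) • e.2) ≠ κ e.2}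

/-- bad edges -/
def badE (κ : V → ι) (T : Set (α × FreeGroup α)) : Set (α × V) :=
  bdry f κ ∪ {e | ∃ t ∈ T, ∃ t' ∈ T, ∃ v, (t'.1, f t'.2 • v) ∈ bdry f κ ∧ e = (t.1, f t.2 • v)}

variable {p : ℕ}

/-- labels -/
def labl (κ : V → ι) (ν : ι → Multiplicative (ZMod p) →* Γ) (φ : ι → α × V → ZMod p) :
    α → V → Γ := fun a v => ν (κ v) (Multiplicative.ofAdd (φ (κ v) (a, v)))

theorem path_mono (κ : V → ι) (ν : ι → Multiplicative (ZMod p) →* Γ) (φ : ι → α × V → ZMod p)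
    (v : V) : ∀ (L : List (α × Bool)), (∀ t ∈ tmpl L, (t.1, f t.2 • v) ∉ bdry f κ) →
    κ (f (FreeGroup.mk L) • v) = κ v ∧ coc f (labl κ ν φ) (FreeGroup.mk L) v =
      ν (κ v) (Multiplicative.ofAdd (acoc f (φ (κ v)) (FreeGroup.mk L) v)) := by
  intro L
  induction L with
  | nil =>
    intro _
    rw [← FreeGroup.one_eq_mk, (coc_isCoc f _).one, acoc_one]
    simp
  | cons x L ih =>
    obtain ⟨s, b⟩ := x
    cases b
    · intro h
      rw [tmpl] at h
      obtain ⟨h1, h2⟩ := ih (fun t ht => h t (List.mem_cons_of_mem _ ht))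
      have h3 := h _ List.mem_cons_self
      simp only [bdry, Set.mem_setOf_eq, not_not, map_mul, map_inv, mul_smul, smul_inv_smul,
        h1] at h3
      have h4 : ∀ (w : FreeGroup α) u, acoc f (φ (κ v)) w⁻¹ u = - acoc f (φ (κ v)) w ((f w)⁻¹ • u) := by
        intro w u
        have := acoc_mul f (φ (κ v)) w w⁻¹ u
        rw [mul_inv_cancel, acoc_one, map_inv] at this
        linear_combination - this
      rw [mk_cons_false, map_mul, mul_smul, map_inv, ← h3, coc_isCoc f, h2, acoc_mul,
        (coc_isCoc f _).inv, coc_of, h4, acoc_of]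
      simp only [labl, ← h3, true_and]
      simp [h3]
    · intro h
      rw [tmpl] at h
      obtain ⟨h1, h2⟩ := ih (fun t ht => h t (List.mem_cons_of_mem _ ht))
      have h3 := h _ List.mem_cons_self
      simp only [bdry, Set.mem_setOf_eq, not_not, h1] at h3
      rw [mk_cons_true, map_mul, mul_smul, h3, coc_isCoc f, h2, acoc_mul, coc_of, acoc_of]
      simp [labl, h1]

theorem path_zero (κ : V → ι) (ν : ι → Multiplicative (ZMod p) →* Γ) (φ : ι → α × V → ZMod p)
    (v : V) : ∀ (L : List (α × Bool)), (∀ t ∈ tmpl L, ∀ k, φ k (t.1, f t.2 • v) = 0) →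
    coc f (labl κ ν φ) (FreeGroup.mk L) v = 1 := by
  intro L
  induction L with
  | nil =>
    intro _
    rw [← FreeGroup.one_eq_mk, (coc_isCoc f _).one]
  | cons x L ih =>
    obtain ⟨s, b⟩ := x
    cases b
    · intro h
      rw [tmpl] at h
      have h2 := ih (fun t ht => h t (List.mem_cons_of_mem _ ht))
      have h3 := h _ List.mem_cons_self
      rw [mk_cons_false, coc_isCoc f, h2, (coc_isCoc f _).inv, coc_of]
      simp only [map_mul, map_inv, mul_smul] at h3
      simp [labl, h3]
    · intro h
      rw [tmpl] at h
      have h2 := ih (fun t ht => h t (List.mem_cons_of_mem _ ht))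
      have h3 := h _ List.mem_cons_self
      rw [mk_cons_true, coc_isCoc f, h2, coc_of]
      simp [labl, h3]

/-- labels kill relators -/
theorem labl_rel (κ : V → ι) (ν : ι → Multiplicative (ZMod p) →* Γ) (φ : ι → α × V → ZMod p)
    (T : Set (α × FreeGroup α)) (hφ : ∀ k, ∀ e ∈ badE f κ T, φ k e = 0)
    (L : List (α × Bool)) (hL : ∀ t ∈ tmpl L, t ∈ T)
    (v : V) (h0 : ∀ k, acoc f (φ k) (FreeGroup.mk L) v = 0) :
    coc f (labl κ ν φ) (FreeGroup.mk L) v = 1 := by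
  by_cases h : ∀ t ∈ tmpl L, (t.1, f t.2 • v) ∉ bdry f κ
  · rw [(path_mono f κ ν φ v L h).2, h0]
    simp
  · push Not at h
    obtain ⟨t', ht', hb⟩ := h
    apply path_zero
    intro t ht k
    apply hφ
    exact Or.inr ⟨t, hL t ht, t', hL t' ht', v, hb, rfl⟩

end

section
variable {α G Γ ι : Type*} [Group G] [Group Γ] (f : FreeGroup α →* G)

theorem regions_hom [DecidableEq α] (hf : Function.Surjective f) (R : Set (FreeGroup α))
    (hker : f.ker = Subgroup.normalClosure R) (H : Subgroup G) (p : ℕ) [Fact p.Prime]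
    (κ : G ⧸ H → ι)
    (hconn : ∀ v w, κ v = κ w → Relation.EqvGen
      (fun a b => κ a = κ b ∧ ∃ s, b = f (FreeGroup.of s) • a) v w)
    (T : Set (α × FreeGroup α)) (hT : ∀ r ∈ R, ∀ t ∈ tmpl r.toWord, t ∈ T)
    (φ : ι → α × (G ⧸ H) → ZMod p) (hφ : ∀ k, ∀ e ∈ badE f κ T, φ k e = 0)
    (hφZ : ∀ k, φ k ∈ Z1 f R)
    (J : Set ι)
    (hJ : ∀ k ∈ J, ¬ ∃ g : G ⧸ H → ZMod p, ∀ s v, κ v = k → κ (f (FreeGroup.of s) • v) = k →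
      φ k (s, v) = g (f (FreeGroup.of s) • v) - g v)
    (ν : ι → Multiplicative (ZMod p) →* Γ) (hν : ∀ k, k ∉ J → ν k = 1)
    (hgen : ⨆ k, (ν k).range = ⊤) :
    ∃ θ : H →* Γ, Function.Surjective θ := by
  classical
  set lam := labl κ ν φ with hlam
  obtain ⟨c, hc, hcf⟩ := coc_desc f hf R hker (coc_isCoc f lam) (by
    intro r hr v
    have h := labl_rel f κ ν φ T hφ r.toWord (hT r hr) v (by
      intro k
      rw [FreeGroup.mk_toWord]
      exact (mem_Z1 f).1 (hφZ k) r hr v)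
    rwa [FreeGroup.mk_toWord] at h)
  have hcs : ∀ s v, c (f (FreeGroup.of s)) v = lam s v := by
    intro s v; rw [hcf, coc_of]
  let v0 : G ⧸ H := ((1 : G) : G ⧸ H)
  have hfix : ∀ h : H, (h : G) • v0 = v0 := by
    intro h
    show (((h : G) * 1 : G) : G ⧸ H) = ((1 : G) : G ⧸ H)
    rw [QuotientGroup.eq]; simp
  have hfix' : ∀ g : G, g • v0 = v0 → g ∈ H := by
    intro g hg
    have : ((g * 1 : G) : G ⧸ H) = ((1 : G) : G ⧸ H) := hg
    rw [eq_comm, QuotientGroup.eq] at this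
    simpa using this
  let θ : H →* Γ := MonoidHom.mk' (fun h => c h v0) (by
    intro a b
    have := hc (a : G) (b : G) v0
    simp only [MonoidHom.id_apply, hfix] at this
    exact this)
  refine ⟨θ, ?_⟩
  let O : G ⧸ H → Set Γ := fun v => {x | ∃ g : G, g • v0 = v ∧ c g v0 = x}
  have hO : ∀ s v x, x ∈ O v ↔ lam s v * x ∈ O (f (FreeGroup.of s) • v) := by
    intro s v x
    constructor
    · rintro ⟨g, hg, rfl⟩
      refine ⟨f (FreeGroup.of s) * g, by rw [mul_smul, hg], ?_⟩
      rw [hc, MonoidHom.id_apply, hg, hcs]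
    · rintro ⟨g, hg, hx⟩
      have hg' : (f (FreeGroup.of s))⁻¹ • g • v0 = v := by rw [hg, inv_smul_smul]
      refine ⟨(f (FreeGroup.of s))⁻¹ * g, by rw [mul_smul, hg'], ?_⟩
      have := hc (f (FreeGroup.of s)) ((f (FreeGroup.of s))⁻¹ * g) v0
      rw [mul_inv_cancel_left, MonoidHom.id_apply, mul_smul, hg', hcs, hx] at this
      exact (mul_left_cancel this).symm
  -- stability
  have hA : ∀ u, κ u ∈ J → ∀ t x, x ∈ O u ↔ ν (κ u) t * x ∈ O u := by
    intro u hu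
    set k := κ u with hk
    have hreach : ∀ v, κ v = k → ∃ t, ∀ x, x ∈ O u ↔ ν k t * x ∈ O v := by
      have aux : ∀ a b, Relation.EqvGen
          (fun a b => κ a = κ b ∧ ∃ s, b = f (FreeGroup.of s) • a) a b → (κ a = κ b) ∧ 
          (κ a = k → ∃ t, ∀ x, x ∈ O a ↔ ν k t * x ∈ O b) := by
        intro a b h
        induction h with
        | rel a b h =>
          obtain ⟨h1, s, rfl⟩ := h
          refine ⟨h1, fun ha => ⟨Multiplicative.ofAdd (φ k (s, a)), fun x => ?_⟩⟩
          rw [hO s a x]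
          simp [hlam, labl, ha]
        | refl a => exact ⟨rfl, fun _ => ⟨1, by simp⟩⟩
        | symm a b _ ih =>
          refine ⟨ih.1.symm, fun hb => ?_⟩
          obtain ⟨t, ht⟩ := ih.2 (ih.1.trans hb)
          exact ⟨t⁻¹, fun x => by rw [ht]; simp⟩
        | trans a b d _ _ ih1 ih2 =>
          refine ⟨ih1.1.trans ih2.1, fun ha => ?_⟩
          obtain ⟨t, ht⟩ := ih1.2 ha
          obtain ⟨t', ht'⟩ := ih2.2 (ih1.1.symm.trans ha)
          exact ⟨t' * t, fun x => by rw [ht, ht', map_mul, mul_assoc]⟩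
      intro v hv
      exact (aux u v (hconn u v (by rw [hv]))).2 hk.symm
    by_cases hst : ∃ t : Multiplicative (ZMod p), t ≠ 1 ∧ ∀ x, x ∈ O u ↔ ν k t * x ∈ O u
    · obtain ⟨t, ht1, ht⟩ := hst
      intro t'
      have hpow : ∀ m : ℕ, ∀ x, x ∈ O u ↔ ν k (t ^ m) * x ∈ O u := by
        intro m
        induction m with
        | zero => simp
        | succ m ih => intro x; rw [ih x, ht, pow_succ', map_mul, mul_assoc]
      have : ∃ m : ℕ, t ^ m = t' := by
        have h0 : Multiplicative.toAdd t ≠ 0 := by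
          intro h
          apply ht1
          exact Multiplicative.toAdd.injective h
        refine ⟨(Multiplicative.toAdd t' / Multiplicative.toAdd t).val, ?_⟩
        apply Multiplicative.toAdd.injective
        rw [toAdd_pow, nsmul_eq_mul, ZMod.natCast_val, ZMod.cast_id]
        field_simp
      obtain ⟨m, rfl⟩ := this
      exact hpow m
    · exfalso
      push Not at hst
      apply hJ k hu
      have huniq : ∀ v t t', (∀ x, x ∈ O u ↔ ν k t * x ∈ O v) →
          (∀ x, x ∈ O u ↔ ν k t' * x ∈ O v) → t = t' := by
        intro v t t' h h'
        by_contra hne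
        obtain ⟨x, hx⟩ := hst (t'⁻¹ * t) (by
          intro h
          exact hne (inv_mul_eq_one.mp h).symm)
        have : x ∈ O u ↔ ν k (t'⁻¹ * t) * x ∈ O u := by
          rw [h x, h' (ν k (t'⁻¹ * t) * x), ← mul_assoc, ← map_mul, mul_inv_cancel_left]
        tauto
      choose! τ hτ using hreach
      refine ⟨fun v => Multiplicative.toAdd (τ v), ?_⟩
      intro s v hv hsv
      have := huniq _ _ (Multiplicative.ofAdd (φ k (s, v)) * τ v) (hτ _ hsv) (by
        intro x
        rw [hτ v hv, hO s v]
        simp only [hlam, labl, hv, map_mul, mul_assoc])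
      show φ k (s, v) = Multiplicative.toAdd (τ (f (FreeGroup.of s) • v)) -
        Multiplicative.toAdd (τ v)
      rw [this]
      simp
  have hB : ∀ s v x, x ∈ O v ↔ x ∈ O (f (FreeGroup.of s) • v) := by
    intro s v x
    by_cases hs : (s, v) ∈ bdry f κ
    · have := hO s v x
      rw [this]
      simp [hlam, labl, hφ _ (s, v) (Or.inl hs)]
    · simp only [bdry, Set.mem_setOf_eq, not_not] at hs
      by_cases hk : κ v ∈ J
      · rw [hO s v x]
        have := hA (f (FreeGroup.of s) • v) (by rw [hs]; exact hk)
          (Multiplicative.ofAdd (φ (κ v) (s, v))) x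
        rw [this, hs]
        rfl
      · rw [hO s v x]
        simp [hlam, labl, hν _ hk]
  have hB' : ∀ (w : FreeGroup α) v x, x ∈ O v ↔ x ∈ O (f w • v) := by
    intro w
    induction w using FreeGroup.induction_on with
    | C1 => simp
    | of a => exact hB a
    | inv_of a ih =>
      intro v x
      rw [ih ((f (FreeGroup.of a)⁻¹) • v) x]; simp
    | mul a b ha hb => intro v x; rw [hb, ha, map_mul, mul_smul]
  have hB2 : ∀ v x, x ∈ O v ↔ x ∈ O v0 := by
    intro v x
    obtain ⟨g, rfl⟩ := QuotientGroup.mk_surjective v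
    obtain ⟨w, rfl⟩ := hf g
    rw [hB' w v0]
    have : f w • v0 = ((f w : G) : G ⧸ H) := by
      show ((f w * 1 : G) : G ⧸ H) = _
      rw [mul_one]
    rw [this]
  have hrange : ∀ x, x ∈ O v0 ↔ x ∈ θ.range := by
    intro x
    constructor
    · rintro ⟨g, hg, rfl⟩
      exact ⟨⟨g, hfix' g hg⟩, rfl⟩
    · rintro ⟨h, rfl⟩
      exact ⟨h, hfix h, rfl⟩
  have hle : ⨆ k, (ν k).range ≤ θ.range := by
    apply iSup_le
    rintro k _ ⟨t, rfl⟩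
    by_cases hk : k ∈ J
    · have : ∃ u, κ u = k := by
        by_contra hne
        push Not at hne
        exact hJ k hk ⟨0, fun s v hv => absurd hv (hne v)⟩
      obtain ⟨u, rfl⟩ := this
      rw [← hrange, ← hB2 u]
      have h1 : (1 : Γ) ∈ O u := by
        rw [hB2, hrange]; exact one_mem _
      simpa using (hA u hk t 1).1 h1
    · rw [hν k hk]; exact one_mem _
  rw [hgen] at hle
  exact MonoidHom.range_eq_top.mp (top_le_iff.mp hle)

end
end Lack

namespace Lack

theorem finrank_le_restrict {F E U : Type*} [Field F] [Finite E] [AddCommGroup U] [Module F U]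
    [FiniteDimensional F U]
    (Z : Submodule F (E → F)) (S : Set E) (D : U →ₗ[F] (E → F))
    (h : ∀ φ ∈ Z, (∀ e ∈ S, φ e = 0) → φ ∈ LinearMap.range D) :
    Module.finrank F Z ≤ S.ncard + Module.finrank F U := by
  classical
  have : Fintype E := Fintype.ofFinite E
  have : Fintype S := Fintype.ofFinite S
  let ρ : Z →ₗ[F] (S → F) :=
    (LinearMap.funLeft F F (Subtype.val : S → E)).comp Z.subtype
  have h1 := LinearMap.finrank_range_add_finrank_ker ρ
  have h2 : Module.finrank F (LinearMap.range ρ) ≤ S.ncard := by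
    refine (Submodule.finrank_le _).trans ?_
    rw [Module.finrank_fintype_fun_eq_card, ← Nat.card_eq_fintype_card, Nat.card_coe_set_eq]
  have h3 : Module.finrank F (LinearMap.ker ρ) ≤ Module.finrank F U := by
    refine le_trans ?_ (LinearMap.finrank_range_le D)
    have hle : (LinearMap.ker ρ).map Z.subtype ≤ LinearMap.range D := by
      rintro _ ⟨φ, hφ, rfl⟩
      apply h _ φ.2
      intro e he
      exact congrFun (LinearMap.mem_ker.1 hφ) ⟨e, he⟩
    have := Submodule.finrank_mono hle
    rwa [Submodule.finrank_map_subtype_eq] at this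
  omega

theorem badE_card {α G V ι : Type*} [Group G] [MulAction G V] [Finite α] [Finite V]
    (f : FreeGroup α →* G) (κ : V → ι) (T : Finset (α × FreeGroup α)) :
    (badE f κ T).ncard ≤ (1 + T.card ^ 2) * (bdry f κ).ncard := by
  classical
  have hsub : badE f κ T ⊆ bdry f κ ∪ ⋃ x ∈ T ×ˢ T,
      (fun e : α × V => (x.1.1, f x.1.2 • (f x.2.2)⁻¹ • e.2)) '' bdry f κ := by
    rintro e (he | ⟨t, ht, t', ht', v, hv, rfl⟩)
    · exact Or.inl he
    · right
      simp only [Set.mem_iUnion]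
      refine ⟨(t, t'), Finset.mem_product.2 ⟨ht, ht'⟩, _, hv, ?_⟩
      simp
  refine (Set.ncard_le_ncard hsub (Set.toFinite _)).trans ?_
  refine (Set.ncard_union_le _ _).trans ?_
  have : (⋃ x ∈ T ×ˢ T,
      (fun e : α × V => (x.1.1, f x.1.2 • (f x.2.2)⁻¹ • e.2)) '' bdry f κ).ncard ≤
      ∑ x ∈ T ×ˢ T, (bdry f κ).ncard := by
    refine (Finset.set_ncard_biUnion_le _ _).trans ?_
    apply Finset.sum_le_sum
    intro x _
    exact Set.ncard_image_le (Set.toFinite _)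
  rw [Finset.sum_const, Finset.card_product, smul_eq_mul] at this
  nlinarith

theorem regions_count {n : ℕ} {G Γ ι0 : Type*} [Group G] [Group Γ]
    (f : FreeGroup (Fin n) →* G) (hf : Function.Surjective f) (R : Set (FreeGroup (Fin n)))
    (hker : f.ker = Subgroup.normalClosure R) (H : Subgroup G) [H.FiniteIndex]
    (p : ℕ) [Fact p.Prime] (κ0 : G ⧸ H → ι0)
    (T : Finset (Fin n × FreeGroup (Fin n))) (hT : ∀ r ∈ R, ∀ t ∈ tmpl r.toWord, t ∈ T)
    (B q m : ℕ) (hB : (bdry f κ0).ncard ≤ B) (hq : ∀ k, n * {v | κ0 v = k}.ncard ≤ q)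
    (hdp : 2 + (1 + T.card ^ 2) * B + m * q ≤ dp p H)
    (ν : Fin m → Multiplicative (ZMod p) →* Γ) (hgen : ⨆ k, (ν k).range = ⊤) :
    ∃ θ : H →* Γ, Function.Surjective θ := by
  classical
  have : Fintype (G ⧸ H) := Fintype.ofFinite _
  let r : G ⧸ H → G ⧸ H → Prop := fun a b => κ0 a = κ0 b ∧ ∃ s, b = f (FreeGroup.of s) • a
  let κ : G ⧸ H → Quot r := Quot.mk r
  have : Finite (Quot r) := Finite.of_surjective κ Quot.mk_surjective
  have : Fintype (Quot r) := Fintype.ofFinite _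
  have hκ0 : ∀ a b, κ a = κ b → κ0 a = κ0 b := by
    intro a b h
    have := congrArg (Quot.lift κ0 (fun a b h => h.1)) h
    exact this
  have hrκ : ∀ a b, r a b → κ a = κ b := fun a b h => Quot.sound h
  have hconn : ∀ v w, κ v = κ w → Relation.EqvGen
      (fun a b => κ a = κ b ∧ ∃ s, b = f (FreeGroup.of s) • a) v w := by
    intro v w h
    refine (Quot.eqvGen_exact h).mono ?_
    intro a b hab
    exact ⟨hrκ a b hab, hab.2⟩
  have hbd : bdry f κ ⊆ bdry f κ0 := by
    intro e he hne
    exact he (hrκ _ _ ⟨hne.symm, e.1, rfl⟩).symm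
  have hbad : (badE f κ T).ncard ≤ (1 + T.card ^ 2) * B :=
    (badE_card f κ T).trans (Nat.mul_le_mul le_rfl
      ((Set.ncard_le_ncard hbd (Set.toFinite _)).trans hB))
  let cobOn : (Fin n × (G ⧸ H) → ZMod p) → Quot r → Prop := fun φ k =>
    ∃ g : G ⧸ H → ZMod p, ∀ s v, κ v = k → κ (f (FreeGroup.of s) • v) = k →
      φ (s, v) = g (f (FreeGroup.of s) • v) - g v
  let good : (Fin n × (G ⧸ H) → ZMod p) → Prop := fun φ =>
    φ ∈ Z1 f R ∧ ∀ e ∈ badE f κ T, φ e = 0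
  let J : Finset (Quot r) := Finset.univ.filter (fun k => ∃ φ, good φ ∧ ¬ cobOn φ k)
  let EJ : Set (Fin n × (G ⧸ H)) := {e | κ e.2 ∈ J}
  let D : (G ⧸ H → ZMod p) →ₗ[ZMod p] (Fin n × (G ⧸ H) → ZMod p) :=
    { toFun := fun g e => if κ (f (FreeGroup.of e.1) • e.2) = κ e.2 then
        g (f (FreeGroup.of e.1) • e.2) - g e.2 else 0
      map_add' := by
        intro g g'; ext e
        simp only [Pi.add_apply]
        split_ifs <;> ring
      map_smul' := by
        intro a g; ext e
        simp only [Pi.smul_apply, RingHom.id_apply, smul_eq_mul]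
        split_ifs <;> ring }
  have hdim := finrank_le_restrict (Z1 (p := p) (V := G ⧸ H) f R) (badE f κ T ∪ EJ) D (by
    intro φ hφ h0
    have hgood : good φ := ⟨hφ, fun e he => h0 e (Or.inl he)⟩
    have hcob : ∀ k, cobOn φ k := by
      intro k
      by_cases hk : k ∈ J
      · refine ⟨0, fun s v hv _ => ?_⟩
        rw [h0 (s, v) (Or.inr (by show κ v ∈ J; rwa [hv]))]
        simp
      · by_contra hne
        exact hk (Finset.mem_filter.2 ⟨Finset.mem_univ _, φ, hgood, hne⟩)
    choose g hg using hcob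
    refine ⟨fun v => g (κ v) v, ?_⟩
    ext ⟨s, v⟩
    show (if κ (f (FreeGroup.of s) • v) = κ v then
        g (κ (f (FreeGroup.of s) • v)) (f (FreeGroup.of s) • v) - g (κ v) v else 0) = φ (s, v)
    split_ifs with h
    · rw [hg (κ v) s v rfl h, h]
    · exact (h0 _ (Or.inl (Or.inl h))).symm)
  have hEJ : EJ.ncard ≤ J.card * q := by
    have hsub : EJ ⊆ ⋃ k ∈ J, (Set.univ : Set (Fin n)) ×ˢ {v | κ v = k} := by
      intro e he
      simp only [Set.mem_iUnion]
      exact ⟨κ e.2, he, trivial, rfl⟩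
    refine (Set.ncard_le_ncard hsub (Set.toFinite _)).trans ?_
    refine (Finset.set_ncard_biUnion_le _ _).trans ?_
    rw [← smul_eq_mul]
    apply Finset.sum_le_card_nsmul
    intro k _
    rw [Set.ncard_prod, Set.ncard_univ, Nat.card_fin]
    obtain ⟨u, rfl⟩ := Quot.exists_rep k
    refine le_trans ?_ (hq (κ0 u))
    apply Nat.mul_le_mul le_rfl
    exact Set.ncard_le_ncard (fun v hv => hκ0 _ _ hv) (Set.toFinite _)
  have hd := dim_Z1 p f hf R (by
    intro r hr
    have : r ∈ f.ker := by rw [hker]; exact Subgroup.subset_normalClosure hr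
    exact this) H
  have hun := Set.ncard_union_le (badE f κ T) EJ
  rw [Module.finrank_fintype_fun_eq_card] at hdim
  have hJm : m ≤ J.card := by
    by_contra hlt
    push Not at hlt
    have : J.card * q ≤ m * q := Nat.mul_le_mul hlt.le le_rfl
    omega
  have : Nonempty (Fin m ↪ J) := by
    apply Function.Embedding.nonempty_of_card_le
    simpa using hJm
  obtain ⟨ι⟩ := this
  have hsel : ∀ k, ∃ φ, good φ ∧ (k ∈ J → ¬ cobOn φ k) := by
    intro k
    by_cases hk : k ∈ J
    · obtain ⟨φ, h1, h2⟩ := (Finset.mem_filter.1 hk).2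
      exact ⟨φ, h1, fun _ => h2⟩
    · exact ⟨0, ⟨Submodule.zero_mem _, fun _ _ => rfl⟩, fun h => absurd h hk⟩
  choose φ hφg hφJ using hsel
  let e : Fin m → Quot r := fun i => (ι i).1
  have he : Function.Injective e := Subtype.val_injective.comp ι.injective
  let ν' : Quot r → Multiplicative (ZMod p) →* Γ := Function.extend e ν 1
  refine regions_hom f hf R hker H p κ hconn T hT φ (fun k => (hφg k).2) (fun k => (hφg k).1)
    (Set.range e) ?_ ν' ?_ ?_
  · rintro _ ⟨i, rfl⟩
    exact hφJ _ (ι i).2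
  · intro k hk
    exact Function.extend_apply' _ _ _ hk
  · rw [eq_top_iff, ← hgen]
    apply iSup_le
    intro i
    have : ν i = ν' (e i) := (he.extend_apply ν 1 i).symm
    rw [this]
    exact le_iSup (fun k => (ν' k).range) (e i)

end Lack

namespace Lack

theorem sd_left {N C : Type*} [Group N] [Group C] (φ : C →* MulAut N) (a b : N) (t u : C) :
    ((SemidirectProduct.inl a * SemidirectProduct.inr t * (SemidirectProduct.inl a)⁻¹) *
      (SemidirectProduct.inl b * SemidirectProduct.inr u * (SemidirectProduct.inl b)⁻¹) :
      N ⋊[φ] C).left = a * φ t a⁻¹ * φ t (b * φ u b⁻¹) := by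
  simp

theorem sd_right {N C : Type*} [Group N] [Group C] (φ : C →* MulAut N) (a b : N) (t u : C) :
    ((SemidirectProduct.inl a * SemidirectProduct.inr t * (SemidirectProduct.inl a)⁻¹) *
      (SemidirectProduct.inl b * SemidirectProduct.inr u * (SemidirectProduct.inl b)⁻¹) :
      N ⋊[φ] C).right = t * u := by
  simp

theorem exists_free_target (p : ℕ) [Fact p.Prime] :
    ∃ (Γ : Type) (_ : Group Γ) (ν : Fin 5 → Multiplicative (ZMod p) →* Γ)
      (σ : Γ →* Multiplicative (ZMod p)) (θ : σ.ker →* FreeGroup (Fin 4)),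
      (⨆ k, (ν k).range = ⊤) ∧ Function.Surjective σ ∧ Function.Surjective θ := by
  classical
  let C := Multiplicative (ZMod p)
  let F := FreeGroup (Fin 4)
  let W := (C → F) ⋊[mulAutArrow (G := C) (A := C) (M := F)] C
  let y : Fin 5 → F := fun i => if h : i = 0 then 1 else (FreeGroup.of (i.pred h))⁻¹
  let q : Fin 5 → C → F := fun i k => if k = 1 then y i else 1
  let ν0 : Fin 5 → C →* W := fun i =>
    (MulAut.conj (SemidirectProduct.inl (q i) : W)).toMonoidHom.comp SemidirectProduct.inr
  let Γ : Subgroup W := ⨆ k, (ν0 k).range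
  have hmem : ∀ i t, ν0 i t ∈ Γ := fun i t =>
    le_iSup (fun k => (ν0 k).range) i ⟨t, rfl⟩
  let ν : Fin 5 → C →* Γ := fun i => (ν0 i).codRestrict Γ (hmem i)
  let σ : Γ →* C := SemidirectProduct.rightHom.comp Γ.subtype
  let θ : σ.ker →* F := MonoidHom.mk' (fun x => x.1.1.left 1) (by
    rintro ⟨⟨x, hx⟩, hx'⟩ ⟨⟨y, hy⟩, hy'⟩
    have h1 : x.right = 1 := hx'
    show (x * y).left 1 = x.left 1 * y.left 1
    rw [SemidirectProduct.mul_left, h1, map_one]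
    rfl)
  refine ⟨Γ, inferInstance, ν, σ, θ, ?_, ?_, ?_⟩
  · apply Subgroup.map_injective Γ.subtype_injective
    rw [Subgroup.map_iSup, ← MonoidHom.range_eq_map, Γ.range_subtype]
    apply iSup_congr
    intro k
    rw [MonoidHom.map_range]
    rfl
  · intro t
    refine ⟨ν 0 t, ?_⟩
    show (ν0 0 t).right = t
    simp [ν0]
  · have hg : ∀ i : Fin 4, FreeGroup.of i ∈ θ.range := by
      intro i
      let t : C := Multiplicative.ofAdd 1
      have ht : t ≠ 1 := by
        intro h
        have : (1 : ZMod p) = 0 := congrArg Multiplicative.toAdd h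
        exact one_ne_zero this
      let x : Γ := ν 0 t⁻¹ * ν i.succ t
      have hx : x ∈ σ.ker := by
        show (ν0 0 t⁻¹ * ν0 i.succ t).right = 1
        exact (sd_right _ _ _ _ _).trans (inv_mul_cancel t)
      refine ⟨⟨x, hx⟩, ?_⟩
      show (ν0 0 t⁻¹ * ν0 i.succ t).left 1 = _
      have hq0 : q 0 = 1 := by
        ext k
        simp [q, y]
      have hqs : ∀ k, q i.succ k = if k = 1 then (FreeGroup.of i)⁻¹ else 1 := by
        intro k
        simp [q, y]
      refine (congrFun (sd_left _ _ _ _ _) 1).trans ?_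
      rw [hq0, inv_one, map_one, mul_one, one_mul]
      show q i.succ ((t⁻¹)⁻¹ * 1) * (q i.succ (t⁻¹ * ((t⁻¹)⁻¹ * 1)))⁻¹ = _
      have e1 : (t⁻¹)⁻¹ * 1 = t := by rw [mul_one]; exact inv_inv t
      have e2 : t⁻¹ * t = 1 := inv_mul_cancel t
      rw [e1, e2, hqs, hqs, if_neg ht, if_pos rfl, inv_inv, one_mul]
    rw [← MonoidHom.range_eq_top, eq_top_iff, ← FreeGroup.closure_range_of,
      Subgroup.closure_le]
    rintro _ ⟨i, rfl⟩
    exact hg i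

end Lack

namespace Lack

theorem ncard_preimage_const {X Y : Type*} [Finite X] [Finite Y] (ψ : X → Y) (d : ℕ)
    (hd : ∀ y, (ψ ⁻¹' {y}).ncard = d) (S : Set Y) : (ψ ⁻¹' S).ncard = d * S.ncard := by
  classical
  have : Fintype X := Fintype.ofFinite X
  have : Fintype Y := Fintype.ofFinite Y
  rw [Set.ncard_eq_toFinset_card' , Set.ncard_eq_toFinset_card',
    Finset.card_eq_sum_card_fiberwise (t := S.toFinset) (f := ψ)]
  · rw [Finset.sum_const_nat (m := d), mul_comm]
    intro y hy
    rw [← hd y, Set.ncard_eq_toFinset_card']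
    congr 1
    ext x
    simp only [Finset.mem_filter, Set.mem_toFinset, Set.mem_preimage, Set.mem_singleton_iff]
    constructor
    · exact fun h => h.2
    · intro h
      exact ⟨by rw [h]; simpa using hy, h⟩
  · intro x hx
    simpa using hx

section
variable {G X Y : Type*} [Group G] [MulAction G X] [MulAction G Y]

theorem fiber_const [Finite X] [MulAction.IsPretransitive G Y] (π : X → Y)
    (hπ : ∀ (g : G) x, π (g • x) = g • π x) (y y' : Y) :
    (π ⁻¹' {y}).ncard = (π ⁻¹' {y'}).ncard := by
  obtain ⟨g, rfl⟩ := MulAction.exists_smul_eq G y y'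
  symm
  refine Set.ncard_congr (fun x _ => g⁻¹ • x) ?_ ?_ ?_
  · intro x hx
    simp only [Set.mem_preimage, Set.mem_singleton_iff] at *
    rw [hπ, hx, inv_smul_smul]
  · intro a b _ _ h
    exact smul_left_cancel _ h
  · intro x hx
    simp only [Set.mem_preimage, Set.mem_singleton_iff] at *
    exact ⟨g • x, by rw [hπ, hx], by simp⟩

variable {n : ℕ} (f : FreeGroup (Fin n) →* G)

/-- boundary size of a set -/
noncomputable def bd (A : Set X) : ℕ := (bdry f (fun x => x ∈ A)).ncard

theorem bdry_comp {ι : Type*} (π : X → Y) (hπ : ∀ (g : G) x, π (g • x) = g • π x)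
    (κ : Y → ι) : bdry f (κ ∘ π) = (Prod.map id π) ⁻¹' bdry f κ := by
  ext e
  simp [bdry, hπ]

theorem bdry_comp_card {ι : Type*} [Finite X] [Finite Y] (π : X → Y)
    (hπ : ∀ (g : G) x, π (g • x) = g • π x) (d : ℕ)
    (hd : ∀ y, (π ⁻¹' {y}).ncard = d) (κ : Y → ι) :
    (bdry f (κ ∘ π)).ncard = d * (bdry f κ).ncard := by
  rw [bdry_comp f π hπ, ncard_preimage_const _ d]
  rintro ⟨i, y⟩
  rw [← hd y]
  refine Set.ncard_congr (fun e _ => e.2) ?_ ?_ ?_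
  · rintro ⟨a, b⟩ h
    simp only [Set.mem_preimage, Prod.map_apply, Set.mem_singleton_iff, Prod.mk.injEq] at *
    exact h.2
  · rintro ⟨a, b⟩ ⟨a', b'⟩ h h' h2
    simp only [Set.mem_preimage, Prod.map_apply, Set.mem_singleton_iff, Prod.mk.injEq, id] at *
    exact ⟨h.1.trans h'.1.symm, h2⟩
  · intro x hx
    exact ⟨(i, x), by simpa using hx, rfl⟩

theorem sum_lt_eq (N a : ℕ) (h : a ≤ N) : ∑ t ∈ Finset.range N, (if t < a then 1 else 0) = a := by
  rw [← Finset.card_filter]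
  have : (Finset.range N).filter (fun t => t < a) = Finset.range a := by
    ext t; simp; omega
  rw [this, Finset.card_range]

theorem sum_ne_le (N a b c : ℕ) (h : a ≤ b + c) (h' : b ≤ a + c) :
    ∑ t ∈ Finset.range N, (if (t < a) ≠ (t < b) then 1 else 0) ≤ c := by
  rw [← Finset.card_filter]
  have : (Finset.range N).filter (fun t => (t < a) ≠ (t < b)) ⊆ Finset.Ico (min a b) (max a b) := by
    intro t ht
    simp only [Finset.mem_filter, ne_eq, eq_iff_iff, Finset.mem_Ico] at *
    omega
  refine (Finset.card_le_card this).trans ?_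
  rw [Nat.card_Ico]
  omega

/-- coarea push forward -/
theorem pushdown [Finite X] [Finite Y] (π : X → Y) (hπ : ∀ (g : G) x, π (g • x) = g • π x)
    (A : Set X) (hA : A.Nonempty) (ε : ℝ) (hbd : (bd f A : ℝ) ≤ ε * A.ncard) :
    ∃ A' : Set Y, A'.Nonempty ∧ (bd f A' : ℝ) ≤ ε * A'.ncard ∧ A'.ncard ≤ A.ncard := by
  classical
  have : Fintype X := Fintype.ofFinite X
  have : Fintype Y := Fintype.ofFinite Y
  let g : Y → ℕ := fun y => (Finset.univ.filter (fun x => x ∈ A ∧ π x = y)).card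
  let N := A.ncard
  have hAN : N = (Finset.univ.filter (fun x => x ∈ A)).card := by
    show A.ncard = _
    rw [Set.ncard_eq_toFinset_card']
    congr 1; ext x; simp
  have hgN : ∀ y, g y ≤ N := by
    intro y
    rw [hAN]
    exact Finset.card_le_card (fun x hx => by simp at *; exact hx.1)
  let L : ℕ → Set Y := fun t => {y | t < g y}
  have hLA : ∀ t, (L t).ncard ≤ A.ncard := by
    intro t
    have : L t ⊆ π '' A := by
      intro y hy
      have hpos : 0 < g y := lt_of_le_of_lt (Nat.zero_le t) hy
      obtain ⟨x, hx⟩ := Finset.card_pos.1 hpos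
      simp at hx
      exact ⟨x, hx.1, hx.2⟩
    exact (Set.ncard_le_ncard this (Set.toFinite _)).trans (Set.ncard_image_le (Set.toFinite _))
  have hsum1 : ∑ t ∈ Finset.range N, (L t).ncard = N := by
    have h1 : ∀ t, (L t).ncard = ∑ y : Y, if t < g y then 1 else 0 := by
      intro t
      rw [← Finset.card_filter, Set.ncard_eq_toFinset_card']
      congr 1; ext y; simp [L]
    simp_rw [h1]
    rw [Finset.sum_comm]
    simp_rw [sum_lt_eq N _ (hgN _)]
    rw [hAN, Finset.card_eq_sum_card_fiberwise (t := Finset.univ) (f := π) (by simp)]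
    apply Finset.sum_congr rfl
    intro y _
    simp only [g, Finset.filter_filter]
  have hsum2 : ∑ t ∈ Finset.range N, bd f (L t) ≤ bd f A := by
    have h1 : ∀ t, bd f (L t) = ∑ e : Fin n × Y,
        if (t < g (f (FreeGroup.of e.1) • e.2)) ≠ (t < g e.2) then 1 else 0 := by
      intro t
      rw [← Finset.card_filter, bd, Set.ncard_eq_toFinset_card']
      congr 1; ext y; rw [Set.mem_toFinset, Finset.mem_filter]
      exact ⟨fun h => ⟨Finset.mem_univ _, h⟩, fun h => h.2⟩
    simp_rw [h1]
    rw [Finset.sum_comm]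
    have h2 : bd f A = ∑ e : Fin n × Y, (Finset.univ.filter (fun x : X =>
        ((f (FreeGroup.of e.1) • x ∈ A) ≠ (x ∈ A)) ∧ π x = e.2)).card := by
      have : bd f A = (Finset.univ.filter (fun e : Fin n × X =>
          ((f (FreeGroup.of e.1) • e.2 ∈ A) ≠ (e.2 ∈ A)))).card := by
        rw [bd, Set.ncard_eq_toFinset_card']
        congr 1; ext y; rw [Set.mem_toFinset, Finset.mem_filter]
        exact ⟨fun h => ⟨Finset.mem_univ _, h⟩, fun h => h.2⟩
      rw [this, Finset.card_eq_sum_card_fiberwise (t := Finset.univ) (f := Prod.map id π) (by simp)]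
      apply Finset.sum_congr rfl
      rintro ⟨i, y⟩ _
      refine Finset.card_bij (fun e _ => e.2) ?_ ?_ ?_
      · rintro ⟨a, b⟩ h
        simp only [Finset.mem_filter, Finset.mem_univ, true_and, Prod.map_apply, Prod.mk.injEq,
          id] at *
        obtain ⟨h1, rfl, h2⟩ := h
        exact ⟨h1, h2⟩
      · rintro ⟨a, b⟩ h ⟨a', b'⟩ h' h2
        simp only [Finset.mem_filter, Finset.mem_univ, true_and, Prod.map_apply, Prod.mk.injEq,
          id] at *
        exact ⟨h.2.1.trans h'.2.1.symm, h2⟩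
      · intro x hx
        simp only [Finset.mem_filter, Finset.mem_univ, true_and] at hx
        exact ⟨(i, x), by simpa using hx, rfl⟩
    rw [h2]
    apply Finset.sum_le_sum
    rintro ⟨i, y⟩ _
    set s := f (FreeGroup.of i) with hs
    have hsy : g (s • y) = (Finset.univ.filter (fun x => s • x ∈ A ∧ π x = y)).card := by
      refine Finset.card_bij (fun x _ => s⁻¹ • x) ?_ ?_ ?_
      · intro x hx
        simp only [Finset.mem_filter, Finset.mem_univ, true_and, smul_inv_smul, hπ] at *
        exact ⟨hx.1, by rw [hx.2, inv_smul_smul]⟩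
      · intro a _ b _ h
        exact smul_left_cancel _ h
      · intro x hx
        simp only [Finset.mem_filter, Finset.mem_univ, true_and] at *
        exact ⟨s • x, ⟨hx.1, by rw [hπ, hx.2]⟩, by simp⟩
    apply sum_ne_le
    · show g (s • y) ≤ _
      rw [hsy]
      refine (Finset.card_le_card ?_).trans (Finset.card_union_le _ _)
      intro x hx
      simp only [Finset.mem_union, Finset.mem_filter, Finset.mem_univ, true_and] at *
      by_cases h : x ∈ A <;> simp_all
    · show g y ≤ g (s • y) + _
      rw [hsy]
      refine (Finset.card_le_card ?_).trans (Finset.card_union_le _ _)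
      intro x hx
      simp only [Finset.mem_union, Finset.mem_filter, Finset.mem_univ, true_and] at *
      by_cases h : s • x ∈ A <;> simp_all
  by_contra hne
  push Not at hne
  have hlt : ∀ t ∈ Finset.range N, ε * (L t).ncard ≤ (bd f (L t) : ℝ) := by
    intro t _
    by_cases h : (L t).Nonempty
    · by_contra hlt
      push Not at hlt
      have := hne (L t) h hlt.le
      exact absurd (hLA t) (by omega)
    · rw [Set.not_nonempty_iff_eq_empty] at h
      rw [h]; simp
  have hNpos : 0 < N := (Set.ncard_pos (Set.toFinite _)).2 hA
  have h0 : (L 0).Nonempty := by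
    obtain ⟨x, hx⟩ := hA
    refine ⟨π x, ?_⟩
    apply Finset.card_pos.2
    exact ⟨x, by simp [hx]⟩
  have hlt0 : ε * (L 0).ncard < (bd f (L 0) : ℝ) := by
    by_contra hlt
    push Not at hlt
    have := hne (L 0) h0 hlt
    exact absurd (hLA 0) (by omega)
  have hS := Finset.sum_lt_sum hlt ⟨0, Finset.mem_range.2 hNpos, hlt0⟩
  rw [← Finset.mul_sum] at hS
  have e1 : (∑ t ∈ Finset.range N, ((L t).ncard : ℝ)) = N := by exact_mod_cast hsum1
  have e2 : (∑ t ∈ Finset.range N, (bd f (L t) : ℝ)) ≤ bd f A := by exact_mod_cast hsum2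
  rw [e1] at hS
  have : (N : ℝ) = A.ncard := rfl
  linarith

/-- slow variation constant -/
theorem slow_word (w : FreeGroup (Fin n)) : ∃ N : ℕ, ∀ (a : Y → ℝ) (δ : ℝ),
    (∀ i y, |a (f (FreeGroup.of i) • y) - a y| ≤ δ) → ∀ y, |a (f w • y) - a y| ≤ N * δ := by
  induction w using FreeGroup.induction_on with
  | C1 => exact ⟨0, fun a δ _ y => by simp⟩
  | of i => exact ⟨1, fun a δ h y => by simpa using h i y⟩
  | inv_of i _ =>
    refine ⟨1, fun a δ h y => ?_⟩
    have := h i (f (FreeGroup.of i)⁻¹ • y)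
    rw [map_inv, smul_inv_smul, abs_sub_comm] at this
    simpa using this
  | mul u v hu hv =>
    obtain ⟨N, hN⟩ := hu
    obtain ⟨M, hM⟩ := hv
    refine ⟨N + M, fun a δ h y => ?_⟩
    have h1 := hN a δ h (f v • y)
    have h2 := hM a δ h y
    rw [map_mul, mul_smul]
    push_cast
    have := abs_sub_le (a (f u • f v • y)) (a (f v • y)) (a y)
    linarith

theorem slow [Finite Y] [MulAction.IsPretransitive G Y] (hf : Function.Surjective f) :
    ∃ C : ℕ, ∀ (a : Y → ℝ) (δ : ℝ), 0 ≤ δ →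
    (∀ i y, |a (f (FreeGroup.of i) • y) - a y| ≤ δ) → ∀ y y', |a y - a y'| ≤ C * δ := by
  have : Fintype Y := Fintype.ofFinite Y
  have h1 : ∀ y y' : Y, ∃ N : ℕ, ∀ (a : Y → ℝ) (δ : ℝ),
      (∀ i y, |a (f (FreeGroup.of i) • y) - a y| ≤ δ) → |a y - a y'| ≤ N * δ := by
    intro y y'
    obtain ⟨g, hg⟩ := MulAction.exists_smul_eq G y' y
    obtain ⟨w, rfl⟩ := hf g
    obtain ⟨N, hN⟩ := slow_word (Y := Y) f w
    exact ⟨N, fun a δ h => by rw [← hg]; exact hN a δ h y'⟩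
  choose N hN using h1
  refine ⟨∑ y, ∑ y', N y y', fun a δ hδ h y y' => (hN y y' a δ h).trans ?_⟩
  apply mul_le_mul_of_nonneg_right _ hδ
  norm_cast
  exact (Finset.single_le_sum (fun _ _ => Nat.zero_le _) (Finset.mem_univ y') : N y y' ≤ _).trans
    (Finset.single_le_sum (f := fun y => ∑ y', N y y') (fun _ _ => Nat.zero_le _) (Finset.mem_univ y))

theorem fiber_slow [Finite X] (π : X → Y) (hπ : ∀ (g : G) x, π (g • x) = g • π x)
    (A : Set X) (i : Fin n) (y : Y) :
    |((A ∩ π ⁻¹' {f (FreeGroup.of i) • y}).ncard : ℝ) - (A ∩ π ⁻¹' {y}).ncard| ≤ bd f A := by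
  set s := f (FreeGroup.of i) with hs
  have hsy : (A ∩ π ⁻¹' {s • y}).ncard = {x | s • x ∈ A ∧ π x = y}.ncard := by
    refine Set.ncard_congr (fun x _ => s⁻¹ • x) ?_ ?_ ?_
    · rintro x ⟨h1, h2⟩
      simp only [Set.mem_preimage, Set.mem_singleton_iff] at h2
      simp only [Set.mem_setOf_eq, smul_inv_smul, hπ]
      exact ⟨h1, by rw [h2, inv_smul_smul]⟩
    · intro a b _ _ h
      exact smul_left_cancel _ h
    · rintro x ⟨h1, h2⟩
      exact ⟨s • x, ⟨h1, by simp [hπ, h2]⟩, by simp⟩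
  have hD : {x : X | (s • x ∈ A) ≠ (x ∈ A)}.ncard ≤ bd f A := by
    refine Set.ncard_le_ncard_of_injOn (fun x => (i, x)) ?_ ?_ (Set.toFinite _)
    · intro x hx; exact hx
    · intro a _ b _ h; simpa using h
  have h1 : (A ∩ π ⁻¹' {s • y}).ncard ≤ (A ∩ π ⁻¹' {y}).ncard + bd f A := by
    rw [hsy]
    refine le_trans (Set.ncard_le_ncard (t := (A ∩ π ⁻¹' {y}) ∪ {x : X | (s • x ∈ A) ≠ (x ∈ A)})
      ?_ (Set.toFinite _)) ((Set.ncard_union_le _ _).trans (by omega))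
    rintro x ⟨h1, h2⟩
    by_cases h : x ∈ A
    · left; exact ⟨h, h2⟩
    · right; simp [h1, h]
  have h2 : (A ∩ π ⁻¹' {y}).ncard ≤ (A ∩ π ⁻¹' {s • y}).ncard + bd f A := by
    rw [hsy]
    refine le_trans (Set.ncard_le_ncard (t := {x | s • x ∈ A ∧ π x = y} ∪ {x : X | (s • x ∈ A) ≠ (x ∈ A)})
      ?_ (Set.toFinite _)) ((Set.ncard_union_le _ _).trans (by omega))
    rintro x ⟨h1, h2⟩
    by_cases h : s • x ∈ A
    · left; exact ⟨h, h2⟩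
    · right; simp [h1, h]
  have h1' : ((A ∩ π ⁻¹' {s • y}).ncard : ℝ) ≤ (A ∩ π ⁻¹' {y}).ncard + bd f A := by exact_mod_cast h1
  have h2' : ((A ∩ π ⁻¹' {y}).ncard : ℝ) ≤ (A ∩ π ⁻¹' {s • y}).ncard + bd f A := by exact_mod_cast h2
  rw [abs_le]; constructor <;> linarith

theorem bd_zero [Finite X] [MulAction.IsPretransitive G X] (hf : Function.Surjective f)
    (A : Set X) (hA : A.Nonempty) (h : bd f A = 0) : A = Set.univ := by
  have h0 : bdry f (fun x => x ∈ A) = ∅ := (Set.ncard_eq_zero (Set.toFinite _)).1 h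
  have h1 : ∀ i x, f (FreeGroup.of i) • x ∈ A ↔ x ∈ A := by
    intro i x
    by_contra hne
    have : (i, x) ∈ bdry f (fun x => x ∈ A) := fun h => hne (iff_of_eq h)
    rw [h0] at this
    exact this
  have h2 : ∀ (w : FreeGroup (Fin n)) x, f w • x ∈ A ↔ x ∈ A := by
    intro w
    induction w using FreeGroup.induction_on with
    | C1 => simp
    | of i => exact h1 i
    | inv_of i ih =>
      intro x
      rw [← ih]; simp
    | mul u v hu hv => intro x; rw [map_mul, mul_smul, hu, hv]
  obtain ⟨x, hx⟩ := hA
  ext y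
  simp only [Set.mem_univ, iff_true]
  obtain ⟨g, rfl⟩ := MulAction.exists_smul_eq G x y
  obtain ⟨w, rfl⟩ := hf g
  exact (h2 w x).2 hx

end
end Lack

namespace Lack

section
variable {G : Type*} [Group G]

theorem step_index_p {p : ℕ} [Fact p.Prime] {K L : Subgroup G} (hK : IsSubnormal K)
    (hKL : K ≤ L) (hne : K ≠ L) (k : ℕ) (hfin : K.index = p ^ k) :
    ∃ M : Subgroup G, K ≤ M ∧ M ≤ L ∧ M.relIndex L = p := by
  classical
  obtain ⟨n, c, h0, hn, hc⟩ := hK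
  have hKc : ∀ i ≤ n, K ≤ c i := by
    intro i
    induction i with
    | zero => intro _; rw [h0]
    | succ i ih => intro hi; exact (ih (by omega)).trans (hc i (by omega)).1
  have : ∃ i, L ≤ c i := ⟨n, by rw [hn]; exact le_top⟩
  obtain ⟨i, hi, hmin⟩ : ∃ i, L ≤ c i ∧ ∀ j < i, ¬ L ≤ c j :=
    ⟨Nat.find this, Nat.find_spec this, fun j hj => Nat.find_min this hj⟩
  have hin : i ≤ n := by
    by_contra h
    exact hmin n (by omega) (by rw [hn]; exact le_top)
  cases i with
  | zero => exact absurd (le_antisymm hKL (by rwa [h0] at hi)) hne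
  | succ i =>
    have hLi := hmin i (by omega)
    let N : Subgroup L := (c i).subgroupOf L
    have hN : N.Normal := by
      constructor
      intro x hx g
      rw [Subgroup.mem_subgroupOf] at hx ⊢
      exact (hc i (by omega)).2 g (hi g.2) x hx
    have hNtop : N ≠ ⊤ := by
      intro h
      exact hLi (Subgroup.subgroupOf_eq_top.1 h)
    have hdvd : N.index ∣ p ^ k := by
      have h1 : (c i).relIndex L ∣ K.relIndex L := Subgroup.relIndex_dvd_of_le_left L (hKc i (by omega))
      have h2 : K.relIndex L ∣ K.index := ⟨_, (Subgroup.relIndex_mul_index hKL).symm⟩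
      rw [← hfin]
      exact h1.trans h2
    obtain ⟨m, -, hm⟩ := (Nat.dvd_prime_pow Fact.out).1 hdvd
    have hm0 : m ≠ 0 := by
      rintro rfl
      rw [pow_zero, Subgroup.index_eq_one] at hm
      exact hNtop hm
    obtain ⟨m, rfl⟩ := Nat.exists_eq_succ_of_ne_zero hm0
    have hcard : Nat.card (L ⧸ N) = p ^ (m + 1) := hm
    have : Finite (L ⧸ N) := Nat.finite_of_card_ne_zero (by
      rw [hcard]; exact pow_ne_zero _ (Fact.out : p.Prime).ne_zero)
    obtain ⟨P, hP⟩ := Sylow.exists_subgroup_card_pow_prime (G := L ⧸ N) p (n := m)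
      (by rw [hcard]; exact pow_dvd_pow _ (by omega))
    have hPi : P.index = p := by
      have := P.card_mul_index
      rw [hP, hcard, pow_succ] at this
      exact Nat.eq_of_mul_eq_mul_left (pow_pos (Fact.out : p.Prime).pos _) this
    let M' : Subgroup L := P.comap (QuotientGroup.mk' N)
    have hM' : M'.index = p := by
      rw [← hPi]
      exact Subgroup.index_comap_of_surjective P (QuotientGroup.mk'_surjective N)
    refine ⟨M'.map L.subtype, ?_, ?_, ?_⟩
    · intro x hx
      refine ⟨⟨x, hKL hx⟩, ?_, rfl⟩
      show QuotientGroup.mk' N ⟨x, hKL hx⟩ ∈ P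
      have : QuotientGroup.mk' N ⟨x, hKL hx⟩ = 1 := by
        rw [QuotientGroup.mk'_apply, QuotientGroup.eq_one_iff, Subgroup.mem_subgroupOf]
        exact hKc i (by omega) hx
      rw [this]; exact one_mem _
    · rintro _ ⟨x, _, rfl⟩
      exact x.2
    · rw [Subgroup.relIndex, Subgroup.subgroupOf,
        Subgroup.comap_map_eq_self_of_injective L.subtype_injective, hM']

/-- projection of coset spaces -/
def qmap {K M : Subgroup G} (h : K ≤ M) : G ⧸ K → G ⧸ M := Subgroup.quotientMapOfLE h

theorem qmap_smul {K M : Subgroup G} (h : K ≤ M) (g : G) (x : G ⧸ K) :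
    qmap h (g • x) = g • qmap h x := by
  induction x using QuotientGroup.induction_on with
  | H z => rfl

variable {n : ℕ} (f : FreeGroup (Fin n) →* G)

theorem small_bd (hf : Function.Surjective f) (L : Subgroup G) [L.FiniteIndex] (ε : ℝ) (hε : 0 ≤ ε) (h : ε * L.index < 1)
    (A : Set (G ⧸ L)) (hA : A.Nonempty) (hbd : (bd f A : ℝ) ≤ ε * A.ncard) :
    L.index < 2 * A.ncard := by
  have hle : A.ncard ≤ L.index := by
    have := Set.ncard_le_ncard (Set.subset_univ A) (Set.toFinite _)
    rwa [Set.ncard_univ] at this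
  have h1 : (bd f A : ℝ) < 1 := by
    refine lt_of_le_of_lt (hbd.trans ?_) h
    apply mul_le_mul_of_nonneg_left _ hε
    exact_mod_cast hle
  have h2 : bd f A = 0 := by
    have : bd f A < 1 := by exact_mod_cast h1
    omega
  have h3 := bd_zero f hf A hA h2
  have hpos : 0 < L.index := Nat.pos_of_ne_zero Subgroup.FiniteIndex.index_ne_zero
  rw [h3, Set.ncard_univ]
  show L.index < 2 * L.index
  omega

theorem mid {p : ℕ} [Fact p.Prime] (K : Subgroup G) (hK : IsSubnormal K) (k : ℕ)
    (hfin : K.index = p ^ k) (ε : ℝ)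
    (A : Set (G ⧸ K)) (hA : A.Nonempty) (hA2 : 2 * A.ncard ≤ K.index)
    (hbd : (bd f A : ℝ) ≤ ε * A.ncard) (r : ℕ) : ∀ (L : Subgroup G), K ≤ L → K.relIndex L ≤ r →
    (∀ B : Set (G ⧸ L), B.Nonempty → (bd f B : ℝ) ≤ ε * B.ncard → L.index < 2 * B.ncard) →
    ∃ M : Subgroup G, K ≤ M ∧ ∃ B : Set (G ⧸ M), (bd f B : ℝ) ≤ ε * B.ncard ∧
      2 * B.ncard ≤ M.index ∧ M.index ≤ 2 * p * B.ncard := by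
  have hp : p.Prime := Fact.out
  have hK0 : K.index ≠ 0 := by rw [hfin]; exact pow_ne_zero _ hp.ne_zero
  have hKL0 : ∀ L, K ≤ L → K.relIndex L ≠ 0 ∧ L.index ≠ 0 := by
    intro L h
    rw [← Subgroup.relIndex_mul_index h] at hK0
    exact ⟨left_ne_zero_of_mul hK0, right_ne_zero_of_mul hK0⟩
  induction r with
  | zero =>
    intro L hKL hr
    exact absurd (Nat.le_zero.1 hr) (hKL0 L hKL).1
  | succ r ih =>
    intro L hKL hr hL
    by_cases hne : K = L
    · subst hne
      have := hL A hA hbd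
      omega
    obtain ⟨M, hKM, hML, hM⟩ := step_index_p hK hKL hne k hfin
    have hfM : M.FiniteIndex := ⟨(hKL0 M hKM).2⟩
    have hfL : L.FiniteIndex := ⟨(hKL0 L hKL).2⟩
    by_cases hcase : ∀ B : Set (G ⧸ M), B.Nonempty → (bd f B : ℝ) ≤ ε * B.ncard →
        M.index < 2 * B.ncard
    · refine ih M hKM ?_ hcase
      have h1 := Subgroup.relIndex_mul_relIndex K M L hKM hML
      rw [hM] at h1
      have h2 := (hKL0 M hKM).1
      have h3 := hp.two_le
      have : K.relIndex M * 2 ≤ K.relIndex M * p := Nat.mul_le_mul le_rfl h3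
      omega
    · push Not at hcase
      obtain ⟨B, hB, hBbd, hB2⟩ := hcase
      obtain ⟨B', hB', hB'bd, hBB⟩ := pushdown f (qmap hML) (qmap_smul hML) B hB ε hBbd
      have h1 := hL B' hB' hB'bd
      refine ⟨M, hKM, B, hBbd, hB2, ?_⟩
      rw [← Subgroup.relIndex_mul_index hML, hM]
      have : p * L.index ≤ p * (2 * B.ncard) := Nat.mul_le_mul le_rfl (by omega)
      calc _ ≤ _ := this
        _ = _ := by ring

theorem qmap_fiber {K M : Subgroup G} [K.FiniteIndex] (h : K ≤ M) :
    ∃ d : ℕ, (∀ y, (qmap h ⁻¹' {y}).ncard = d) ∧ K.index = d * M.index := by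
  have hM : M.FiniteIndex := Subgroup.finiteIndex_of_le h
  refine ⟨(qmap h ⁻¹' {((1 : G) : G ⧸ M)}).ncard, fun y => fiber_const (G := G) _ (qmap_smul h) _ _, ?_⟩
  have := ncard_preimage_const (qmap h) _
    (fun y => fiber_const (G := G) _ (qmap_smul h) y ((1 : G) : G ⧸ M)) Set.univ
  rw [Set.preimage_univ, Set.ncard_univ, Set.ncard_univ] at this
  exact this


theorem lemmaB (hf : Function.Surjective f)
    {p : ℕ} [Fact p.Prime] (Hs : ℕ → Subgroup G) (hnest : ∀ i, Hs (i + 1) < Hs i)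
    (hsub : ∀ i, IsSubnormal (Hs i)) (hpow : ∀ i, ∃ k : ℕ, (Hs i).index = p ^ k)
    (htau : ∀ ε : ℝ, 0 < ε → ∃ j, ∃ A : Set (G ⧸ Hs j), A.Nonempty ∧ 2 * A.ncard ≤ (Hs j).index ∧
      (bd f A : ℝ) ≤ ε * A.ncard)
    (i : ℕ) (ε : ℝ) (hε : 0 < ε) : ∃ j, i ≤ j ∧ ∃ B : Set (G ⧸ Hs j),
    2 * B.ncard ≤ (Hs j).index ∧ (Hs j).index ≤ 2 * p * B.ncard ∧
    (bd f B : ℝ) ≤ ε * B.ncard := by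
  have hp : p.Prime := Fact.out
  have hanti : StrictAnti Hs := strictAnti_nat_of_succ_lt hnest
  have hfi : ∀ i, (Hs i).FiniteIndex := by
    intro i
    obtain ⟨k, hk⟩ := hpow i
    exact ⟨by rw [hk]; exact pow_ne_zero _ hp.ne_zero⟩
  have hIpos : 0 < (Hs i).index := Nat.pos_of_ne_zero (hfi i).index_ne_zero
  have hIpos' : (0 : ℝ) < (Hs i).index := by exact_mod_cast hIpos
  set ε' := min ε (1 / (2 * (Hs i).index)) with hε'
  have hε'pos : 0 < ε' := by positivity
  have hsmall : ε' * (Hs i).index < 1 := by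
    have : ε' ≤ 1 / (2 * (Hs i).index) := min_le_right _ _
    calc _ ≤ 1 / (2 * (Hs i).index) * ((Hs i).index : ℝ) := by gcongr
      _ = 1 / 2 := by field_simp
      _ < 1 := by norm_num
  obtain ⟨j, A, hA, hA2, hbd⟩ := htau ε' hε'pos
  have hij : i ≤ j := by
    by_contra hlt
    push Not at hlt
    have hle : (Hs j).index ≤ (Hs i).index := Nat.le_of_dvd hIpos
      (Subgroup.index_dvd_of_le (hanti.antitone hlt.le))
    have := small_bd f hf (Hs j) ε' hε'pos.le (lt_of_le_of_lt (by
      apply mul_le_mul_of_nonneg_left _ hε'pos.le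
      exact_mod_cast hle) hsmall) A hA hbd
    omega
  obtain ⟨k, hk⟩ := hpow j
  obtain ⟨M, hKM, B, hB1, hB2, hB3⟩ := mid f (Hs j) (hsub j) k hk ε' A hA hA2 hbd _ (Hs i)
    (hanti.antitone hij) le_rfl (fun B hB hBb => small_bd f hf (Hs i) ε' hε'pos.le hsmall B hB hBb)
  obtain ⟨d, hd, hdi⟩ := qmap_fiber hKM
  have hM : M.FiniteIndex := Subgroup.finiteIndex_of_le hKM
  refine ⟨j, hij, qmap hKM ⁻¹' B, ?_, ?_, ?_⟩
  · rw [ncard_preimage_const _ d hd, hdi]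
    calc _ = d * (2 * B.ncard) := by ring
      _ ≤ _ := Nat.mul_le_mul le_rfl hB2
  · rw [ncard_preimage_const _ d hd, hdi]
    calc _ ≤ d * (2 * p * B.ncard) := Nat.mul_le_mul le_rfl hB3
      _ = _ := by ring
  · have h1 : bd f (qmap hKM ⁻¹' B) = d * bd f B :=
      bdry_comp_card f (qmap hKM) (qmap_smul hKM) d hd (fun x => x ∈ B)
    rw [h1, ncard_preimage_const _ d hd]
    push_cast
    have h2 : (bd f B : ℝ) ≤ ε * B.ncard := hB1.trans (by
      apply mul_le_mul_of_nonneg_right (min_le_left _ _) (by positivity))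
    calc _ ≤ (d : ℝ) * (ε * B.ncard) := by gcongr
      _ = _ := by ring

end

section
variable {G X Y : Type*} [Group G] [MulAction G X] [MulAction G Y] {n : ℕ}
  (f : FreeGroup (Fin n) →* G)

theorem fiber_dist [Finite X] [Finite Y] (π : X → Y) (hπ : ∀ (g : G) x, π (g • x) = g • π x)
    (C : ℝ) (hC : ∀ (a : Y → ℝ) (δ : ℝ), 0 ≤ δ →
      (∀ i y, |a (f (FreeGroup.of i) • y) - a y| ≤ δ) → ∀ y y', |a y - a y'| ≤ C * δ)
    (A : Set X) (S : Set Y) :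
    ((A ∩ π ⁻¹' S).ncard : ℝ) * Nat.card Y ≤ S.ncard * (A.ncard + Nat.card Y * (C * bd f A)) := by
  classical
  have : Fintype X := Fintype.ofFinite X
  have : Fintype Y := Fintype.ofFinite Y
  let a : Y → ℝ := fun y => (A ∩ π ⁻¹' {y}).ncard
  have hsum : ∀ S : Set Y, ((A ∩ π ⁻¹' S).ncard : ℝ) = ∑ y ∈ S.toFinset, a y := by
    intro S
    simp only [a]
    norm_cast
    rw [Set.ncard_eq_toFinset_card', Finset.card_eq_sum_card_fiberwise (t := S.toFinset) (f := π)]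
    · apply Finset.sum_congr rfl
      intro y hy
      rw [Set.ncard_eq_toFinset_card']
      congr 1
      ext x
      simp only [Finset.mem_filter, Set.mem_toFinset, Set.mem_inter_iff, Set.mem_preimage,
        Set.mem_singleton_iff] at *
      constructor
      · exact fun h => ⟨h.1.1, h.2⟩
      · rintro ⟨h1, rfl⟩
        exact ⟨⟨h1, hy⟩, rfl⟩
    · intro x hx
      simp at hx ⊢
      exact hx.2
  have hdiff := hC a (bd f A) (by positivity) (fun i y => fiber_slow f π hπ A i y)
  have htot : ∑ y, a y = A.ncard := by
    have := hsum Set.univ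
    simpa using this.symm
  have hone : ∀ y, a y * Nat.card Y ≤ A.ncard + Nat.card Y * (C * bd f A) := by
    intro y
    have h1 : ∑ y' : Y, a y ≤ ∑ y' : Y, (a y' + C * bd f A) := by
      apply Finset.sum_le_sum
      intro y' _
      have := (abs_le.1 (hdiff y y')).2
      linarith
    rw [Finset.sum_add_distrib, htot, Finset.sum_const, Finset.sum_const, nsmul_eq_mul,
      nsmul_eq_mul, Finset.card_univ, ← Nat.card_eq_fintype_card] at h1
    linarith
  rw [hsum S, Finset.sum_mul, Set.ncard_eq_toFinset_card', ← nsmul_eq_mul]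
  apply Finset.sum_le_card_nsmul
  intro y _
  exact hone y

theorem bd_compl [Finite X] (A : Set X) : bd f Aᶜ = bd f A := by
  unfold bd
  congr 1
  ext e
  simp [bdry]
  tauto

end

section
variable {G : Type*} [Group G] {n : ℕ} (f : FreeGroup (Fin n) →* G)

theorem lemmaD (hf : Function.Surjective f)
    {p : ℕ} [Fact p.Prime] (Hs : ℕ → Subgroup G) (hnest : ∀ i, Hs (i + 1) < Hs i)
    (hsub : ∀ i, IsSubnormal (Hs i)) (hpow : ∀ i, ∃ k : ℕ, (Hs i).index = p ^ k)
    (htau : ∀ ε : ℝ, 0 < ε → ∃ j, ∃ A : Set (G ⧸ Hs j), A.Nonempty ∧ 2 * A.ncard ≤ (Hs j).index ∧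
      (bd f A : ℝ) ≤ ε * A.ncard)
    (q : ℕ) : ∀ (i : ℕ) (ε : ℝ), 0 < ε → ∃ j, i ≤ j ∧ ∃ κ : G ⧸ Hs j → List Bool,
    (∀ l, ({v | κ v = l}.ncard : ℝ) ≤ (1 - 1 / (4 * p)) ^ q * (Hs j).index) ∧
    ((bdry f κ).ncard : ℝ) ≤ ε * (Hs j).index := by
  classical
  have hp : p.Prime := Fact.out
  have hanti : StrictAnti Hs := strictAnti_nat_of_succ_lt hnest
  have hfi : ∀ i, (Hs i).FiniteIndex := by
    intro i
    obtain ⟨k, hk⟩ := hpow i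
    exact ⟨by rw [hk]; exact pow_ne_zero _ hp.ne_zero⟩
  have hp2 : (2 : ℝ) ≤ p := by exact_mod_cast hp.two_le
  induction q with
  | zero =>
    intro i ε hε
    refine ⟨i, le_rfl, fun _ => [], ?_, ?_⟩
    · intro l
      rw [pow_zero, one_mul]
      norm_cast
      have := Set.ncard_le_ncard (Set.subset_univ {v : G ⧸ Hs i | ([] : List Bool) = l}) (Set.toFinite _)
      rwa [Set.ncard_univ] at this
    · have : bdry f (fun _ : G ⧸ Hs i => ([] : List Bool)) = ∅ := by
        ext e; simp [bdry]
      rw [this]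
      simp only [Set.ncard_empty, Nat.cast_zero]
      positivity
  | succ q ih =>
    intro i ε hε
    obtain ⟨j, hij, κ, hκ, hbκ⟩ := ih i (ε / 2) (by positivity)
    obtain ⟨C, hC⟩ := slow (Y := G ⧸ Hs j) f hf
    have hIpos : 0 < (Hs j).index := Nat.pos_of_ne_zero (hfi j).index_ne_zero
    set I : ℝ := ((Hs j).index : ℝ) with hI
    have hI0 : 0 < I := by rw [hI]; exact_mod_cast hIpos
    set ε' := min (ε / 2) (1 / (4 * p * (C + 1) * I)) with hε'
    have hε'pos : 0 < ε' := by positivity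
    obtain ⟨j', hjj, B, hB1, hB2, hB3⟩ := lemmaB f hf Hs hnest hsub hpow htau j ε' hε'pos
    have hle : Hs j' ≤ Hs j := hanti.antitone hjj
    obtain ⟨d, hd, hdi⟩ := qmap_fiber hle
    set π := qmap hle with hπ
    have hπs := qmap_smul hle
    rw [← hπ] at hπs
    set I' : ℝ := ((Hs j').index : ℝ) with hI'
    have hII : I' = d * I := by rw [hI', hI]; exact_mod_cast hdi
    have hI'0 : 0 ≤ I' := by positivity
    have hB1' : 2 * (B.ncard : ℝ) ≤ I' := by rw [hI']; exact_mod_cast hB1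
    have hB2' : I' ≤ 2 * p * (B.ncard : ℝ) := by rw [hI']; exact_mod_cast hB2
    have hcompl : (Bᶜ.ncard : ℝ) = I' - B.ncard := by
      have := Set.ncard_add_ncard_compl B
      have h2 : (B.ncard : ℝ) + Bᶜ.ncard = I' := by rw [hI']; exact_mod_cast this
      linarith
    refine ⟨j', hij.trans hjj, fun v => decide (v ∈ B) :: κ (π v), ?_, ?_⟩
    · -- class sizes
      have key : ∀ (A : Set (G ⧸ Hs j')) (l : List Bool), (A.ncard : ℝ) ≤ (1 - 1 / (2 * p)) * I' →
          bd f A = bd f B →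
          ((A ∩ π ⁻¹' {y | κ y = l}).ncard : ℝ) ≤ (1 - 1 / (4 * p)) ^ (q + 1) * I' := by
        intro A l hA hAb
        have h1 := fiber_dist f π hπs C hC A {y | κ y = l}
        have hcY : (Nat.card (G ⧸ Hs j) : ℝ) = I := rfl
        rw [hcY, hAb] at h1
        have h2 : I * (C * bd f B) ≤ 1 / (4 * p) * I' := by
          have h3 : (bd f B : ℝ) ≤ 1 / (4 * p * (C + 1) * I) * I' := by
            refine hB3.trans ?_
            apply mul_le_mul (min_le_right _ _) _ (by positivity) (by positivity)
            linarith
          calc I * (C * bd f B) ≤ I * ((C + 1) * (1 / (4 * p * (C + 1) * I) * I')) := by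
                gcongr; linarith
            _ = 1 / (4 * p) * I' := by field_simp
        have h4 : (A.ncard : ℝ) + I * (C * bd f B) ≤ (1 - 1 / (4 * p)) * I' := by
          have : (1 - 1 / (2 * p)) * I' + 1 / (4 * p) * I' = (1 - 1 / (4 * p)) * I' := by
            field_simp; ring
          linarith
        have h5 : ((A ∩ π ⁻¹' {y | κ y = l}).ncard : ℝ) * I ≤
            ((1 - 1 / (4 * p)) ^ (q + 1) * I') * I := by
          calc _ ≤ _ := h1
            _ ≤ ((1 - 1 / (4 * p)) ^ q * I) * ((1 - 1 / (4 * p)) * I') := by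
                apply mul_le_mul (hκ l) h4 (by positivity)
                apply mul_nonneg _ hI0.le
                apply pow_nonneg
                rw [sub_nonneg, div_le_one (by positivity)]
                linarith
            _ = _ := by ring
        exact le_of_mul_le_mul_right h5 hI0
      intro l
      cases l with
      | nil =>
        have : {v : G ⧸ Hs j' | (decide (v ∈ B) :: κ (π v)) = []} = ∅ := by ext; simp
        rw [this, Set.ncard_empty, Nat.cast_zero]
        apply mul_nonneg _ hI'0
        apply pow_nonneg
        rw [sub_nonneg, div_le_one (by positivity)]
        linarith
      | cons b l =>
        cases b
        · have : {v : G ⧸ Hs j' | (decide (v ∈ B) :: κ (π v)) = false :: l} =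
              Bᶜ ∩ π ⁻¹' {y | κ y = l} := by ext; simp
          rw [this]
          apply key _ _ _ (bd_compl f B)
          rw [hcompl]
          have : 1 / (2 * p) * I' ≤ B.ncard := by
            rw [div_mul_eq_mul_div, one_mul, div_le_iff₀ (by positivity)]
            linarith
          linarith
        · have : {v : G ⧸ Hs j' | (decide (v ∈ B) :: κ (π v)) = true :: l} =
              B ∩ π ⁻¹' {y | κ y = l} := by ext; simp
          rw [this]
          apply key _ _ _ rfl
          have : 1 / (2 * (p : ℝ)) ≤ 1 / 2 := by
            apply one_div_le_one_div_of_le <;> linarith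
          nlinarith
    · have hsubs : bdry f (fun v => decide (v ∈ B) :: κ (π v)) ⊆
          bdry f (κ ∘ π) ∪ bdry f (fun v => v ∈ B) := by
        intro e he
        by_contra hne
        apply he
        simp only [Set.mem_union, not_or] at hne
        obtain ⟨h1, h2⟩ := hne
        simp only [bdry, Set.mem_ofPred_eq, not_not, Function.comp] at h1 h2
        simp only [h1, h2]
      have h1 : (bdry f (fun v => decide (v ∈ B) :: κ (π v))).ncard ≤
          d * (bdry f κ).ncard + bd f B := by
        rw [← bdry_comp_card f π hπs d hd]
        exact (Set.ncard_le_ncard hsubs (Set.toFinite _)).trans (Set.ncard_union_le _ _)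
      have h1' : ((bdry f (fun v => decide (v ∈ B) :: κ (π v))).ncard : ℝ) ≤
          d * (bdry f κ).ncard + bd f B := by exact_mod_cast h1
      have h2 : (d : ℝ) * (bdry f κ).ncard ≤ d * (ε / 2 * I) := by gcongr
      have h3 : (bd f B : ℝ) ≤ ε / 2 * I' := by
        refine hB3.trans ?_
        apply mul_le_mul (min_le_left _ _) _ (by positivity) (by positivity)
        linarith
      calc _ ≤ _ := h1'
        _ ≤ d * (ε / 2 * I) + ε / 2 * I' := by linarith
        _ = ε * I' := by rw [hII]; ring

end
end Lack

namespace Lack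

theorem subnormal_step {G : Type*} [Group G] {H K : Subgroup G} (hH : IsSubnormal H) (hK : K ≤ H)
    (hn : ∀ g ∈ H, ∀ x ∈ K, g * x * g⁻¹ ∈ K) : IsSubnormal K := by
  obtain ⟨n, c, h0, h1, h2⟩ := hH
  refine ⟨n + 1, fun i => Nat.casesOn i K c, rfl, h1, ?_⟩
  intro i hi
  cases i with
  | zero =>
    show K ≤ c 0 ∧ ∀ g ∈ c 0, ∀ x ∈ K, g * x * g⁻¹ ∈ K
    rw [h0]
    exact ⟨hK, hn⟩
  | succ i => exact h2 i (by omega)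

section
variable {G : Type*} [Group G] {n : ℕ} (f : FreeGroup (Fin n) →* G)

theorem schreier_finite (S : Finset G) (H : Subgroup G) [H.FiniteIndex] (A : Set (G ⧸ H)) :
    (schreierBoundary G (S : Set G) H A).Finite := by
  have : schreierBoundary G (S : Set G) H A ⊆ (S : Set G) ×ˢ Set.univ := by
    rintro e ⟨h, _⟩
    exact ⟨h, trivial⟩
  exact Set.Finite.subset (S.finite_toSet.prod Set.finite_univ) this

theorem bd_le_schreier (S : Finset G) (hS : ∀ i, f (FreeGroup.of i) ∈ S) (H : Subgroup G)
    [H.FiniteIndex] (A : Set (G ⧸ H)) :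
    bd f A ≤ n * (schreierBoundary G (S : Set G) H A).ncard := by
  have h1 : bd f A ≤ ((Set.univ : Set (Fin n)) ×ˢ (schreierBoundary G (S : Set G) H A)).ncard := by
    refine Set.ncard_le_ncard_of_injOn (fun e => (e.1, (f (FreeGroup.of e.1), e.2))) ?_ ?_
      (Set.finite_univ.prod (schreier_finite S H A))
    · intro e he
      exact ⟨trivial, hS _, fun h => he h.symm⟩
    · rintro ⟨a, b⟩ _ ⟨a', b'⟩ _ h
      simp only [Prod.mk.injEq] at h
      rw [h.1, h.2.2]
  rwa [Set.ncard_prod, Set.ncard_univ, Nat.card_fin] at h1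

theorem cheeger_set_nonempty (S : Set G) (H : Subgroup G) (hH : 2 ≤ H.index) :
    {r : ℝ | ∃ A : Set (G ⧸ H), A.Nonempty ∧
    2 * (Nat.card A : ℝ) ≤ (Nat.card (G ⧸ H) : ℝ) ∧
    r = (Nat.card (schreierBoundary G S H A) : ℝ) / (Nat.card A : ℝ)}.Nonempty := by
  refine ⟨_, {((1 : G) : G ⧸ H)}, ⟨_, rfl⟩, ?_, rfl⟩
  simp only [Nat.card_unique, Nat.cast_one, mul_one]
  show (2 : ℝ) ≤ (H.index : ℝ)
  exact_mod_cast hH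

theorem closure_image (hf : Function.Surjective f) :
    Subgroup.closure (Set.range fun i => f (FreeGroup.of i)) = ⊤ := by
  have : (Set.range fun i => f (FreeGroup.of i)) = f '' Set.range FreeGroup.of := by
    rw [← Set.range_comp]; rfl
  rw [this, ← MonoidHom.map_closure, FreeGroup.closure_range_of, ← MonoidHom.range_eq_map,
    MonoidHom.range_eq_top.2 hf]

theorem tau_neg (hf : Function.Surjective f) (Hs : ℕ → Subgroup G)
    (hfi : ∀ i, (Hs i).FiniteIndex) (h2 : ∀ i, 2 ≤ (Hs i).index)
    (hnt : ¬ PropertyTau G Hs) (ε : ℝ) (hε : 0 < ε) :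
    ∃ j, ∃ A : Set (G ⧸ Hs j), A.Nonempty ∧ 2 * A.ncard ≤ (Hs j).index ∧
      (bd f A : ℝ) ≤ ε * A.ncard := by
  classical
  by_contra hne
  push Not at hne
  apply hnt
  let S : Finset G := Finset.univ.image (fun i => f (FreeGroup.of i))
  refine ⟨S, ?_, ε / (n + 1), by positivity, ?_⟩
  · simp only [S, Finset.coe_image, Finset.coe_univ, Set.image_univ]
    exact closure_image f hf
  · intro j
    apply le_csInf (cheeger_set_nonempty _ _ (h2 j))
    rintro _ ⟨A, hA, hA2, rfl⟩
    have := hfi j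
    rw [Nat.card_coe_set_eq, Nat.card_coe_set_eq] at *
    have h3 := hne j A hA (by
      have : 2 * (A.ncard : ℝ) ≤ ((Hs j).index : ℝ) := hA2
      exact_mod_cast this)
    have h4 := bd_le_schreier f S (fun i => Finset.mem_image_of_mem _ (Finset.mem_univ _)) (Hs j) A
    have h4' : (bd f A : ℝ) ≤ n * (schreierBoundary G (S : Set G) (Hs j) A).ncard := by
      exact_mod_cast h4
    have hApos : (0 : ℝ) < A.ncard := by exact_mod_cast (Set.ncard_pos (Set.toFinite _)).2 hA
    rw [div_le_div_iff₀ (by positivity) hApos]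
    have : (0 : ℝ) ≤ (schreierBoundary G (S : Set G) (Hs j) A).ncard := by positivity
    nlinarith

end

theorem large_of_not_tau {G : Type*} [Group G] {n : ℕ} (f : FreeGroup (Fin n) →* G)
    (hf : Function.Surjective f) (R : Finset (FreeGroup (Fin n)))
    (hker : f.ker = Subgroup.normalClosure (R : Set (FreeGroup (Fin n))))
    (p : ℕ) [Fact p.Prime] (Hs : ℕ → Subgroup G)
    (hnest : ∀ i, Hs (i + 1) < Hs i)
    (hsub : ∀ i, IsSubnormal (Hs i))
    (hpow : ∀ i, ∃ k : ℕ, (Hs i).index = p ^ k)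
    (h2 : ∀ i, 2 ≤ (Hs i).index)
    (hlin : LinearGrowthModP p Hs) (hnt : ¬ PropertyTau G Hs) :
    ∃ N : Subgroup G, IsSubnormal N ∧ (∃ k : ℕ, N.index = p ^ k) ∧
      ∃ θ : N →* FreeGroup (Fin 4), Function.Surjective θ := by
  classical
  have hp : p.Prime := Fact.out
  have hp2 : (2 : ℝ) ≤ p := by exact_mod_cast hp.two_le
  have hanti : StrictAnti Hs := strictAnti_nat_of_succ_lt hnest
  have hfi : ∀ i, (Hs i).FiniteIndex := by
    intro i
    obtain ⟨k, hk⟩ := hpow i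
    exact ⟨by rw [hk]; exact pow_ne_zero _ hp.ne_zero⟩
  have htau := tau_neg f hf Hs hfi h2 hnt
  obtain ⟨c, hc, hlin⟩ := hlin
  let T : Finset (Fin n × FreeGroup (Fin n)) := R.biUnion (fun r => (tmpl r.toWord).toFinset)
  have hT : ∀ r ∈ (R : Set (FreeGroup (Fin n))), ∀ t ∈ tmpl r.toWord, t ∈ T := by
    intro r hr t ht
    exact Finset.mem_biUnion.2 ⟨r, hr, List.mem_toFinset.2 ht⟩
  -- indices grow
  have hgrow : ∀ i, i + 1 ≤ (Hs i).index := by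
    intro i
    induction i with
    | zero => have := h2 0; omega
    | succ i ih =>
      have h3 : (Hs (i + 1)).relIndex (Hs i) * (Hs i).index = (Hs (i + 1)).index :=
        Subgroup.relIndex_mul_index (hnest i).le
      have h4 : (Hs (i + 1)).relIndex (Hs i) ≠ 0 := by
        intro h
        rw [h, zero_mul] at h3
        exact (hfi (i + 1)).index_ne_zero h3.symm
      have h5 : (Hs (i + 1)).relIndex (Hs i) ≠ 1 := by
        intro h
        rw [Subgroup.relIndex_eq_one] at h
        exact absurd h (not_le_of_gt (hnest i))
      have h6 : 2 ≤ (Hs (i + 1)).relIndex (Hs i) := by omega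
      have h7 : 2 * (Hs i).index ≤ (Hs (i + 1)).relIndex (Hs i) * (Hs i).index :=
        Nat.mul_le_mul h6 le_rfl
      omega
  set ρ : ℝ := 1 - 1 / (4 * p) with hρ
  have hρ0 : 0 ≤ ρ := by
    rw [hρ, sub_nonneg, div_le_one (by positivity)]; linarith
  have hρ1 : ρ < 1 := by
    rw [hρ]
    have : 0 < 1 / (4 * (p : ℝ)) := by positivity
    linarith
  obtain ⟨Q, hQ⟩ := exists_pow_lt_of_lt_one (show 0 < c / (20 * (n + 1)) by positivity) hρ1
  obtain ⟨i0, hi0⟩ := exists_nat_gt (8 / c)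
  set Kc : ℝ := 1 + (T.card : ℝ) ^ 2 with hKc
  have hKc0 : 0 < Kc := by positivity
  obtain ⟨j, hij, κ, hκ, hbκ⟩ := lemmaD f hf Hs hnest hsub hpow htau Q i0 (c / (4 * Kc))
    (by positivity)
  set I : ℝ := ((Hs j).index : ℝ) with hI
  have hIpos : 0 < I := by
    rw [hI]
    have := hgrow j
    have h : 0 < (Hs j).index := by omega
    exact_mod_cast h
  have hI8 : 8 ≤ c * I := by
    have h1 : (i0 : ℝ) ≤ I := by
      rw [hI]
      have := hgrow j
      exact_mod_cast (by omega : i0 ≤ (Hs j).index)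
    rw [div_lt_iff₀ hc] at hi0
    nlinarith
  have hdp : c * I ≤ dp p (Hs j) := by
    have := hlin j
    rwa [le_div_iff₀ hIpos] at this
  obtain ⟨Γ, _, ν, σ, θ, hν, hσ, hθ⟩ := exists_free_target p
  obtain ⟨θ1, hθ1⟩ := regions_count f hf (R : Set (FreeGroup (Fin n))) hker (Hs j) p κ T hT
    (bdry f κ).ncard ⌊n * (ρ ^ Q * I)⌋₊ 5 le_rfl (by
      intro k
      apply Nat.le_floor
      push_cast
      have := hκ k
      gcongr) (by
      have h3 : (⌊n * (ρ ^ Q * I)⌋₊ : ℝ) ≤ n * (ρ ^ Q * I) := Nat.floor_le (by positivity)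
      have h4 : n * (ρ ^ Q * I) ≤ c * I / 20 := by
        have : n * (ρ ^ Q * I) ≤ (n + 1) * (c / (20 * (n + 1)) * I) := by
          gcongr
          linarith
        calc _ ≤ _ := this
          _ = _ := by field_simp
      have h5 : Kc * (bdry f κ).ncard ≤ c * I / 4 := by
        calc Kc * (bdry f κ).ncard ≤ Kc * (c / (4 * Kc) * I) := by gcongr
          _ = _ := by field_simp
      have h6 : (2 : ℝ) + (1 + (T.card : ℝ) ^ 2) * (bdry f κ).ncard +
          5 * (⌊n * (ρ ^ Q * I)⌋₊ : ℝ) ≤ dp p (Hs j) := by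
        rw [← hKc]
        linarith
      exact_mod_cast h6) ν hν
  let N0 : Subgroup (Hs j) := σ.ker.comap θ1
  have hN0n : N0.Normal := inferInstance
  have hN0 : N0.index = p := by
    rw [Subgroup.index_comap_of_surjective _ hθ1, Subgroup.index_ker,
      MonoidHom.range_eq_top.2 hσ, Nat.card_congr Subgroup.topEquiv.toEquiv]
    simp
  refine ⟨N0.map (Hs j).subtype, ?_, ?_, ?_⟩
  · refine subnormal_step (hsub j) ?_ ?_
    · rintro _ ⟨x, _, rfl⟩
      exact x.2
    · rintro g hg _ ⟨x, hx, rfl⟩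
      exact ⟨⟨g, hg⟩ * x * ⟨g, hg⟩⁻¹, hN0n.conj_mem x hx ⟨g, hg⟩, rfl⟩
  · obtain ⟨k, hk⟩ := hpow j
    refine ⟨k + 1, ?_⟩
    rw [Subgroup.index_map_subtype, hN0, hk, pow_succ']
  · let e := N0.equivMapOfInjective (Hs j).subtype (Hs j).subtype_injective
    refine ⟨(θ.comp (θ1.subgroupComap σ.ker)).comp e.symm.toMonoidHom, ?_⟩
    have h3 : Function.Surjective (θ1.subgroupComap σ.ker) := by
      rintro ⟨y, hy⟩
      obtain ⟨x, rfl⟩ := hθ1 y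
      exact ⟨⟨x, hy⟩, rfl⟩
    exact (hθ.comp h3).comp e.symm.surjective

end Lack

namespace Lack

section
variable {n : ℕ} [NeZero n]

/-- shear -/
def shear1 (k : ZMod n) : (ZMod n × ZMod n) ≃ (ZMod n × ZMod n) where
  toFun z := (z.1 + k * z.2, z.2)
  invFun z := (z.1 - k * z.2, z.2)
  left_inv z := by ext <;> simp
  right_inv z := by ext <;> simp

/-- shear -/
def shear2 (k : ZMod n) : (ZMod n × ZMod n) ≃ (ZMod n × ZMod n) where
  toFun z := (z.1, z.2 + k * z.1)
  invFun z := (z.1, z.2 - k * z.1)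
  left_inv z := by ext <;> simp
  right_inv z := by ext <;> simp

/-- translation -/
def transl (c : ZMod n × ZMod n) : (ZMod n × ZMod n) ≃ (ZMod n × ZMod n) := Equiv.addRight c

/-- Fourier transform -/
noncomputable def hat (g : ZMod n × ZMod n → ℂ) (ξ : ZMod n × ZMod n) : ℂ :=
  ∑ z, g z * ZMod.stdAddChar (ξ.1 * z.1 + ξ.2 * z.2)

theorem hat_sub (g h : ZMod n × ZMod n → ℂ) (ξ) : hat (fun z => g z - h z) ξ = hat g ξ - hat h ξ := by
  simp only [hat, sub_mul, Finset.sum_sub_distrib]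

theorem hat_shear1 (g : ZMod n × ZMod n → ℂ) (k : ZMod n) (ξ) :
    hat (fun z => g (shear1 k z)) ξ = hat g (shear2 (-k) ξ) := by
  unfold hat
  refine Fintype.sum_equiv (shear1 k) _ _ (fun z => ?_)
  congr 2
  simp only [shear1, shear2, Equiv.coe_fn_mk]
  ring

theorem hat_shear2 (g : ZMod n × ZMod n → ℂ) (k : ZMod n) (ξ) :
    hat (fun z => g (shear2 k z)) ξ = hat g (shear1 (-k) ξ) := by
  unfold hat
  refine Fintype.sum_equiv (shear2 k) _ _ (fun z => ?_)
  congr 2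
  simp only [shear1, shear2, Equiv.coe_fn_mk]
  ring

theorem hat_transl (g : ZMod n × ZMod n → ℂ) (c : ZMod n × ZMod n) (ξ) :
    hat (fun z => g (transl c z)) ξ = ZMod.stdAddChar (-(ξ.1 * c.1 + ξ.2 * c.2)) * hat g ξ := by
  unfold hat
  rw [Finset.mul_sum]
  refine Fintype.sum_equiv (transl c) _ _ (fun z => ?_)
  have : ξ.1 * z.1 + ξ.2 * z.2 = -(ξ.1 * c.1 + ξ.2 * c.2) +
      (ξ.1 * (transl c z).1 + ξ.2 * (transl c z).2) := by
    simp only [transl, Equiv.coe_addRight, Prod.fst_add, Prod.snd_add]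
    ring
  rw [this, AddChar.map_add_eq_mul]
  ring

theorem char_orth (u : ZMod n × ZMod n) :
    ∑ ξ : ZMod n × ZMod n, (ZMod.stdAddChar (ξ.1 * u.1 + ξ.2 * u.2) : ℂ) =
      if u = 0 then (n : ℂ) ^ 2 else 0 := by
  simp_rw [AddChar.map_add_eq_mul]
  rw [Fintype.sum_prod_type]
  simp only
  rw [← Finset.sum_mul_sum]
  rw [AddChar.sum_mulShift _ (ZMod.isPrimitive_stdAddChar n),
    AddChar.sum_mulShift _ (ZMod.isPrimitive_stdAddChar n), ZMod.card]
  by_cases h1 : u.1 = 0 <;> by_cases h2 : u.2 = 0 <;> simp [h1, h2, Prod.ext_iff, sq]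

theorem parseval (g : ZMod n × ZMod n → ℂ) :
    ∑ ξ, ‖hat g ξ‖ ^ 2 = (n : ℝ) ^ 2 * ∑ z, ‖g z‖ ^ 2 := by
  have key : ∑ ξ, hat g ξ * (starRingEnd ℂ) (hat g ξ) =
      (n : ℂ) ^ 2 * ∑ z, g z * (starRingEnd ℂ) (g z) := by
    have h1 : ∀ ξ, hat g ξ * (starRingEnd ℂ) (hat g ξ) = ∑ z, ∑ w,
        g z * (starRingEnd ℂ) (g w) * ZMod.stdAddChar (ξ.1 * (z - w).1 + ξ.2 * (z - w).2) := by
      intro ξ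
      unfold hat
      rw [map_sum, Finset.sum_mul_sum]
      apply Finset.sum_congr rfl; intro z _
      apply Finset.sum_congr rfl; intro w _
      rw [map_mul, ← AddChar.map_neg_eq_conj]
      have : ξ.1 * (z - w).1 + ξ.2 * (z - w).2 = (ξ.1 * z.1 + ξ.2 * z.2) + -(ξ.1 * w.1 + ξ.2 * w.2) := by
        simp only [Prod.fst_sub, Prod.snd_sub]; ring
      rw [this, AddChar.map_add_eq_mul _ (ξ.1 * z.1 + ξ.2 * z.2)]
      ring
    simp_rw [h1]
    rw [Finset.sum_comm, Finset.mul_sum]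
    apply Finset.sum_congr rfl; intro z _
    rw [Finset.sum_comm]
    simp_rw [← Finset.mul_sum, char_orth, sub_eq_zero]
    simp
    ring
  simp_rw [Complex.mul_conj] at key
  simp_rw [Complex.normSq_eq_norm_sq] at key
  exact_mod_cast key

theorem char_far (a : ZMod n) : 4 * |(a.valMinAbs : ℝ)| / n ≤ ‖(ZMod.stdAddChar (-a) : ℂ) - 1‖ := by
  have hn : (0 : ℝ) < n := by exact_mod_cast Nat.pos_of_ne_zero (NeZero.ne n)
  have h0 : ‖(ZMod.stdAddChar (-a) : ℂ) - 1‖ = ‖(ZMod.stdAddChar a : ℂ) - 1‖ := by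
    rw [AddChar.map_neg_eq_conj, ← RCLike.norm_conj]
    simp
  rw [h0]
  have h1 : (ZMod.stdAddChar a : ℂ) = Complex.exp (Complex.I * ((2 * Real.pi * a.valMinAbs / n : ℝ) : ℂ)) := by
    conv_lhs => rw [← ZMod.coe_valMinAbs a]
    rw [ZMod.stdAddChar_coe]
    congr 1
    push_cast
    ring
  rw [h1, Complex.norm_exp_I_mul_ofReal_sub_one, Real.norm_eq_abs, abs_mul]
  have h2 : |Real.sin (2 * Real.pi * a.valMinAbs / n / 2)| =
      Real.sin (Real.pi * |(a.valMinAbs : ℝ)| / n) := by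
    have hle : |(a.valMinAbs : ℝ)| ≤ n / 2 := by
      have := ZMod.valMinAbs_mem_Ioc a
      rw [Set.mem_Ioc] at this
      have h3 : -(n : ℝ) < a.valMinAbs * 2 := by exact_mod_cast this.1
      have h4 : (a.valMinAbs : ℝ) * 2 ≤ n := by exact_mod_cast this.2
      rw [abs_le]; constructor <;> linarith
    have : Real.pi * |(a.valMinAbs : ℝ)| / n = |2 * Real.pi * a.valMinAbs / n / 2| := by
      rw [abs_div, abs_div, abs_mul, abs_mul, abs_of_pos Real.pi_pos, abs_of_pos hn]
      simp
      ring
    rw [this]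
    rcases abs_cases (2 * Real.pi * (a.valMinAbs : ℝ) / n / 2) with h | h
    · rw [h.1, abs_of_nonneg]
      apply Real.sin_nonneg_of_nonneg_of_le_pi h.2
      rw [← h.1, ← this, div_le_iff₀ hn]
      nlinarith [Real.pi_pos]
    · rw [h.1, Real.sin_neg, abs_of_nonpos]
      rw [← neg_nonneg, ← Real.sin_neg]
      apply Real.sin_nonneg_of_nonneg_of_le_pi (by linarith)
      rw [← h.1, ← this, div_le_iff₀ hn]
      nlinarith [Real.pi_pos]
  rw [h2]
  have hle : |(a.valMinAbs : ℝ)| ≤ n / 2 := by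
    have := ZMod.valMinAbs_mem_Ioc a
    rw [Set.mem_Ioc] at this
    have h3 : -(n : ℝ) < a.valMinAbs * 2 := by exact_mod_cast this.1
    have h4 : (a.valMinAbs : ℝ) * 2 ≤ n := by exact_mod_cast this.2
    rw [abs_le]; constructor <;> linarith
  have h5 := Real.mul_le_sin (x := Real.pi * |(a.valMinAbs : ℝ)| / n) (by positivity) (by
    rw [div_le_div_iff₀ hn (by norm_num)]
    nlinarith [Real.pi_pos])
  have h6 : 2 / Real.pi * (Real.pi * |(a.valMinAbs : ℝ)| / n) = 2 * |(a.valMinAbs : ℝ)| / n := by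
    have := Real.pi_ne_zero
    field_simp
  rw [h6] at h5
  rw [abs_of_pos (by norm_num : (0 : ℝ) < 2)]
  calc 4 * |(a.valMinAbs : ℝ)| / n = 2 * (2 * |(a.valMinAbs : ℝ)| / n) := by ring
    _ ≤ _ := by gcongr

end
end Lack

namespace Lack

section
variable {n : ℕ} [NeZero n]

open Classical in
/-- mass -/
noncomputable def mass (F : ZMod n × ZMod n → ℂ) (X : ZMod n × ZMod n → Prop) : ℝ :=
  ∑ ξ, if X ξ then ‖F ξ‖ ^ 2 else 0

theorem piece (F : ZMod n × ZMod n → ℂ) (T : (ZMod n × ZMod n) ≃ (ZMod n × ZMod n))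
    (X Q : ZMod n × ZMod n → Prop) (hXQ : ∀ ξ, X ξ → Q (T ξ)) (K : ℝ)
    (hD : ∑ ξ, ‖F (T ξ) - F ξ‖ ^ 2 ≤ K) :
    4 / 5 * mass F X - 4 * K ≤ mass F Q := by
  classical
  have h1 : mass F Q = ∑ ξ, if Q (T ξ) then ‖F (T ξ)‖ ^ 2 else 0 :=
    (Equiv.sum_comp T (fun ξ => if Q ξ then ‖F ξ‖ ^ 2 else 0)).symm
  have h2 : 4 / 5 * mass F X - 4 * (∑ ξ, ‖F (T ξ) - F ξ‖ ^ 2) ≤ mass F Q := by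
    rw [h1, mass, Finset.mul_sum, Finset.mul_sum, ← Finset.sum_sub_distrib]
    apply Finset.sum_le_sum
    intro ξ _
    by_cases hX : X ξ
    · rw [if_pos hX, if_pos (hXQ ξ hX)]
      have h3 : ‖F ξ‖ ≤ ‖F (T ξ)‖ + ‖F (T ξ) - F ξ‖ := by
        have := norm_sub_le (F (T ξ)) (F (T ξ) - F ξ)
        rwa [sub_sub_cancel] at this
      have h4 : ‖F ξ‖ ^ 2 ≤ (‖F (T ξ)‖ + ‖F (T ξ) - F ξ‖) ^ 2 := by gcongr
      nlinarith [sq_nonneg (‖F (T ξ)‖ / 2 - 2 * ‖F (T ξ) - F ξ‖)]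
    · rw [if_neg hX]
      have : 0 ≤ if Q (T ξ) then ‖F (T ξ)‖ ^ 2 else 0 := by split_ifs <;> positivity
      have : 0 ≤ ‖F (T ξ) - F ξ‖ ^ 2 := by positivity
      linarith
  linarith

/-- window -/
def win (m : ℕ) (ξ : ZMod n × ZMod n) : Prop :=
  2 * (m + 1) * |ξ.1.valMinAbs| < n ∧ 2 * (m + 1) * |ξ.2.valMinAbs| < n

theorem vma (m : ℕ) (a b : ZMod n) (ha : 2 * (m + 1) * |a.valMinAbs| < n)
    (hb : 2 * (m + 1) * |b.valMinAbs| < n) (c : ℤ) (hc : |c| ≤ m) :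
    (b + (c : ZMod n) * a).valMinAbs = b.valMinAbs + c * a.valMinAbs := by
  rw [ZMod.valMinAbs_spec]
  constructor
  · simp
  · have h1 : |b.valMinAbs + c * a.valMinAbs| ≤ |b.valMinAbs| + m * |a.valMinAbs| := by
      refine (abs_add_le _ _).trans ?_
      rw [abs_mul]
      gcongr
    have h2 : (m + 1) * (2 * (|b.valMinAbs| + m * |a.valMinAbs|)) < (m + 1) * (n : ℤ) := by
      nlinarith
    have h3 : 2 * (|b.valMinAbs| + m * |a.valMinAbs|) < (n : ℤ) := by
      apply lt_of_mul_lt_mul_left h2 (by positivity)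
    have h4 := abs_le.1 h1
    rw [Set.mem_Ioc]
    constructor <;> linarith [h4.1, h4.2]

theorem shear_inv1 (k : ZMod n) : (shear1 k).symm = shear1 (-k) := by
  ext z <;> simp [shear1, sub_eq_add_neg]

theorem shear_inv2 (k : ZMod n) : (shear2 k).symm = shear2 (-k) := by
  ext z <;> simp [shear2, sub_eq_add_neg]

theorem sum_inv_diff (F : ZMod n × ZMod n → ℂ) (T : (ZMod n × ZMod n) ≃ (ZMod n × ZMod n)) :
    ∑ ξ, ‖F (T.symm ξ) - F ξ‖ ^ 2 = ∑ ξ, ‖F (T ξ) - F ξ‖ ^ 2 := by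
  refine Fintype.sum_equiv T.symm _ _ (fun z => ?_)
  rw [Equiv.apply_symm_apply, norm_sub_rev]

theorem pp (a b : ℤ) (m : ℕ) (hm : 4 ≤ m) (h : b ^ 2 ≤ a ^ 2) (ha : a ≠ 0) :
    a ^ 2 < (b + m * a) ^ 2 ∧ 0 < a * (b + m * a) := by
  have hm' : (4 : ℤ) ≤ m := by exact_mod_cast hm
  have ha2 : 0 < a ^ 2 := by positivity
  have hab : -(a ^ 2) ≤ a * b := by nlinarith [sq_nonneg (a + b)]
  have h1 : (m - 1 : ℤ) * a ^ 2 ≤ a * (b + m * a) := by nlinarith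
  have h2 : 3 * a ^ 2 ≤ a * (b + m * a) := by nlinarith
  refine ⟨?_, by linarith⟩
  by_contra hle
  push Not at hle
  nlinarith [sq_nonneg (a - (b + m * a))]

theorem pp' (a b : ℤ) (m : ℕ) (hm : 4 ≤ m) (h : b ^ 2 ≤ a ^ 2) (ha : a ≠ 0) :
    a ^ 2 < (b + (-m) * a) ^ 2 ∧ a * (b + (-m) * a) < 0 := by
  have := pp a (-b) m hm (by simpa using h) ha
  constructor
  · have e : (b + (-m) * a) ^ 2 = (-b + m * a) ^ 2 := by ring
    rw [e]; exact this.1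
  · nlinarith [this.2]

theorem core (m : ℕ) (hm : 4 ≤ m) (F : ZMod n × ZMod n → ℂ) (h0 : F 0 = 0) (M K : ℝ)
    (hM : ∑ ξ, ‖F ξ‖ ^ 2 = M)
    (h1 : ∑ ξ, ‖F (shear2 (-(m : ZMod n)) ξ) - F ξ‖ ^ 2 ≤ K)
    (h2 : ∑ ξ, ‖F (shear1 (-(m : ZMod n)) ξ) - F ξ‖ ^ 2 ≤ K)
    (h3 : ∑ ξ, ‖(ZMod.stdAddChar (-ξ.1) : ℂ) - 1‖ ^ 2 * ‖F ξ‖ ^ 2 ≤ K)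
    (h4 : ∑ ξ, ‖(ZMod.stdAddChar (-ξ.2) : ℂ) - 1‖ ^ 2 * ‖F ξ‖ ^ 2 ≤ K) :
    M ≤ 100 * (m + 1) ^ 2 * K := by
  classical
  have hn : (0 : ℝ) < n := by exact_mod_cast Nat.pos_of_ne_zero (NeZero.ne n)
  let X : ZMod n × ZMod n → Prop := fun ξ => win m ξ ∧ ξ.2.valMinAbs ^ 2 ≤ ξ.1.valMinAbs ^ 2 ∧
    ξ.1.valMinAbs ≠ 0
  let Y : ZMod n × ZMod n → Prop := fun ξ => win m ξ ∧ ξ.1.valMinAbs ^ 2 ≤ ξ.2.valMinAbs ^ 2 ∧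
    ξ.2.valMinAbs ≠ 0
  let Q1 : ZMod n × ZMod n → Prop := fun ξ => ξ.1.valMinAbs ^ 2 < ξ.2.valMinAbs ^ 2 ∧
    0 < ξ.1.valMinAbs * ξ.2.valMinAbs
  let Q2 : ZMod n × ZMod n → Prop := fun ξ => ξ.1.valMinAbs ^ 2 < ξ.2.valMinAbs ^ 2 ∧
    ξ.1.valMinAbs * ξ.2.valMinAbs < 0
  let Q3 : ZMod n × ZMod n → Prop := fun ξ => ξ.2.valMinAbs ^ 2 < ξ.1.valMinAbs ^ 2 ∧
    0 < ξ.2.valMinAbs * ξ.1.valMinAbs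
  let Q4 : ZMod n × ZMod n → Prop := fun ξ => ξ.2.valMinAbs ^ 2 < ξ.1.valMinAbs ^ 2 ∧
    ξ.2.valMinAbs * ξ.1.valMinAbs < 0
  have p1 := piece F (shear2 (m : ZMod n)) X Q1 (by
    rintro ⟨a, b⟩ ⟨hw, hX, ha⟩
    have hv := vma m a b hw.1 hw.2 m (by simp)
    show a.valMinAbs ^ 2 < (b + (m : ZMod n) * a).valMinAbs ^ 2 ∧
      0 < a.valMinAbs * (b + (m : ZMod n) * a).valMinAbs
    push_cast at hv
    rw [hv]
    exact pp _ _ m hm hX ha) K (by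
    rw [← sum_inv_diff, shear_inv2]; exact h1)
  have p2 := piece F (shear2 (-(m : ZMod n))) X Q2 (by
    rintro ⟨a, b⟩ ⟨hw, hX, ha⟩
    have hv := vma m a b hw.1 hw.2 (-m) (by simp)
    show a.valMinAbs ^ 2 < (b + (-(m : ZMod n)) * a).valMinAbs ^ 2 ∧
      a.valMinAbs * (b + (-(m : ZMod n)) * a).valMinAbs < 0
    push_cast at hv
    rw [hv]
    exact pp' _ _ m hm hX ha) K h1
  have p3 := piece F (shear1 (m : ZMod n)) Y Q3 (by
    rintro ⟨b, a⟩ ⟨hw, hX, ha⟩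
    have hv := vma m a b hw.2 hw.1 m (by simp)
    show a.valMinAbs ^ 2 < (b + (m : ZMod n) * a).valMinAbs ^ 2 ∧
      0 < a.valMinAbs * (b + (m : ZMod n) * a).valMinAbs
    push_cast at hv
    rw [hv]
    exact pp _ _ m hm hX ha) K (by
    rw [← sum_inv_diff, shear_inv1]; exact h2)
  have p4 := piece F (shear1 (-(m : ZMod n))) Y Q4 (by
    rintro ⟨b, a⟩ ⟨hw, hX, ha⟩
    have hv := vma m a b hw.2 hw.1 (-m) (by simp)
    show a.valMinAbs ^ 2 < (b + (-(m : ZMod n)) * a).valMinAbs ^ 2 ∧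
      a.valMinAbs * (b + (-(m : ZMod n)) * a).valMinAbs < 0
    push_cast at hv
    rw [hv]
    exact pp' _ _ m hm hX ha) K h2
  have hQ : mass F Q1 + mass F Q2 + mass F Q3 + mass F Q4 ≤ M := by
    rw [← hM]
    simp only [mass]
    rw [← Finset.sum_add_distrib, ← Finset.sum_add_distrib, ← Finset.sum_add_distrib]
    apply Finset.sum_le_sum
    intro ξ _
    have hp : 0 ≤ ‖F ξ‖ ^ 2 := by positivity
    by_cases q1 : Q1 ξ
    · have q2 : ¬ Q2 ξ := fun q => absurd q.2 (by have := q1.2; omega)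
      have q3 : ¬ Q3 ξ := fun q => absurd q.1 (by have := q1.1; omega)
      have q4 : ¬ Q4 ξ := fun q => absurd q.1 (by have := q1.1; omega)
      simp [q1, q2, q3, q4]
    · by_cases q2 : Q2 ξ
      · have q3 : ¬ Q3 ξ := fun q => absurd q.1 (by have := q2.1; omega)
        have q4 : ¬ Q4 ξ := fun q => absurd q.1 (by have := q2.1; omega)
        simp [q1, q2, q3, q4]
      · by_cases q3 : Q3 ξ
        · have q4 : ¬ Q4 ξ := fun q => absurd q.2 (by have := q3.2; omega)
          simp [q1, q2, q3, q4]
        · by_cases q4 : Q4 ξ <;> simp [q1, q2, q3, q4]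
  have hXY : M ≤ mass F X + mass F Y + ((m + 1) ^ 2 / 4) * (K + K) := by
    have hstep : M ≤ mass F X + mass F Y + ((m + 1 : ℝ) ^ 2 / 4) *
        (∑ ξ, ‖(ZMod.stdAddChar (-ξ.1) : ℂ) - 1‖ ^ 2 * ‖F ξ‖ ^ 2 +
          ∑ ξ, ‖(ZMod.stdAddChar (-ξ.2) : ℂ) - 1‖ ^ 2 * ‖F ξ‖ ^ 2) := by
      rw [← hM]
      simp only [mass]
      rw [← Finset.sum_add_distrib, ← Finset.sum_add_distrib, Finset.mul_sum,
        ← Finset.sum_add_distrib]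
      apply Finset.sum_le_sum
      intro ξ _
      have hp : 0 ≤ ‖F ξ‖ ^ 2 := by positivity
      have hp1 : 0 ≤ ‖(ZMod.stdAddChar (-ξ.1) : ℂ) - 1‖ ^ 2 * ‖F ξ‖ ^ 2 := by positivity
      have hp2 : 0 ≤ ‖(ZMod.stdAddChar (-ξ.2) : ℂ) - 1‖ ^ 2 * ‖F ξ‖ ^ 2 := by positivity
      have hpp : 0 ≤ ((m + 1 : ℝ) ^ 2 / 4) * (‖(ZMod.stdAddChar (-ξ.1) : ℂ) - 1‖ ^ 2 * ‖F ξ‖ ^ 2 +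
        ‖(ZMod.stdAddChar (-ξ.2) : ℂ) - 1‖ ^ 2 * ‖F ξ‖ ^ 2) := by positivity
      have far : ∀ a : ZMod n, ¬ (2 * (m + 1) * |a.valMinAbs| < (n : ℤ)) →
          1 ≤ ((m + 1 : ℝ) ^ 2 / 4) * ‖(ZMod.stdAddChar (-a) : ℂ) - 1‖ ^ 2 := by
        intro a ha
        push Not at ha
        have ha' : (n : ℝ) ≤ 2 * (m + 1) * |(a.valMinAbs : ℝ)| := by exact_mod_cast ha
        have h5 := char_far a
        have h6 : 2 / (m + 1 : ℝ) ≤ ‖(ZMod.stdAddChar (-a) : ℂ) - 1‖ := by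
          refine le_trans ?_ h5
          rw [div_le_div_iff₀ (by positivity) hn]
          linarith
        calc (1 : ℝ) = ((m + 1 : ℝ) ^ 2 / 4) * (2 / (m + 1)) ^ 2 := by field_simp; norm_num
          _ ≤ _ := by gcongr
      by_cases hX : X ξ
      · by_cases hY : Y ξ
        · simp only [hX, hY, if_true]; linarith
        · simp only [hX, hY, if_true, if_false]; linarith
      by_cases hY : Y ξ
      · simp only [hX, hY, if_true, if_false]; linarith
      simp only [hX, hY, if_false]
      by_cases hw : win m ξ
      · by_cases hz : ξ = 0
        · have : ‖F ξ‖ ^ 2 = 0 := by rw [hz, h0]; simp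
          linarith
        · exfalso
          · have hY2 : Y ξ := by
              refine ⟨hw, ?_, ?_⟩
              · by_contra hc
                push Not at hc
                apply hX
                refine ⟨hw, hc.le, ?_⟩
                intro h
                rw [h] at hc
                nlinarith [sq_nonneg ξ.2.valMinAbs]
              · intro h
                by_cases ha : ξ.1.valMinAbs = 0
                · apply hz
                  rw [ZMod.valMinAbs_eq_zero] at h ha
                  exact Prod.ext ha h
                · apply hX
                  refine ⟨hw, ?_, ha⟩
                  rw [h]; positivity
            exact hY hY2
      · have : ¬ (2 * (m + 1) * |ξ.1.valMinAbs| < (n : ℤ)) ∨ ¬ (2 * (m + 1) * |ξ.2.valMinAbs| < (n : ℤ)) := by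
          by_contra hc
          push Not at hc
          exact hw hc
        rcases this with h | h
        · have := mul_le_mul_of_nonneg_right (far _ h) hp
          nlinarith [mul_nonneg (by positivity : (0 : ℝ) ≤ (m + 1 : ℝ) ^ 2 / 4) hp2]
        · have := mul_le_mul_of_nonneg_right (far _ h) hp
          nlinarith [mul_nonneg (by positivity : (0 : ℝ) ≤ (m + 1 : ℝ) ^ 2 / 4) hp1]
    refine hstep.trans ?_
    gcongr
  have hK : 0 ≤ K := le_trans (by positivity) h1
  have hm1 : (1 : ℝ) ≤ (m + 1 : ℝ) ^ 2 := by
    have : (0 : ℝ) ≤ m := by positivity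
    nlinarith
  nlinarith

theorem expander (m : ℕ) (hm : 4 ≤ m) (A : Set (ZMod n × ZMod n)) (hA : 2 * A.ncard ≤ n ^ 2)
    (B : ℕ) (h1 : {z | (shear1 (m : ZMod n) z ∈ A) ≠ (z ∈ A)}.ncard ≤ B)
    (h2 : {z | (shear2 (m : ZMod n) z ∈ A) ≠ (z ∈ A)}.ncard ≤ B)
    (h3 : {z | (transl ((1, 0) : ZMod n × ZMod n) z ∈ A) ≠ (z ∈ A)}.ncard ≤ B)
    (h4 : {z | (transl ((0, 1) : ZMod n × ZMod n) z ∈ A) ≠ (z ∈ A)}.ncard ≤ B) :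
    (A.ncard : ℝ) ≤ 200 * (m + 1) ^ 2 * B := by
  classical
  have hn : (0 : ℝ) < n := by exact_mod_cast Nat.pos_of_ne_zero (NeZero.ne n)
  let μ : ℝ := A.ncard / n ^ 2
  let g : ZMod n × ZMod n → ℂ := fun z => (((if z ∈ A then 1 else 0) - μ : ℝ) : ℂ)
  have hsumA : ∑ z : ZMod n × ZMod n, (if z ∈ A then (1 : ℝ) else 0) = A.ncard := by
    rw [Finset.sum_boole, Set.ncard_eq_toFinset_card']
    congr 2
    ext z; simp
  have hcard : Fintype.card (ZMod n × ZMod n) = n ^ 2 := by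
    rw [Fintype.card_prod, ZMod.card, sq]
  have hμ : (n : ℝ) ^ 2 * μ = A.ncard := by
    simp only [μ]; field_simp
  have hμ2 : μ ≤ 1 / 2 := by
    have : 2 * (A.ncard : ℝ) ≤ n ^ 2 := by exact_mod_cast hA
    simp only [μ]
    rw [div_le_div_iff₀ (by positivity) (by norm_num)]
    linarith
  have hF0 : hat g 0 = 0 := by
    unfold hat
    simp only [Prod.fst_zero, Prod.snd_zero, zero_mul, add_zero, AddChar.map_zero_eq_one, mul_one, g]
    rw [← Complex.ofReal_sum, Complex.ofReal_eq_zero]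
    rw [Finset.sum_sub_distrib, hsumA, Finset.sum_const, Finset.card_univ, hcard, nsmul_eq_mul]
    push_cast
    linarith
  have hnorm : ∑ z, ‖g z‖ ^ 2 = A.ncard - A.ncard * μ := by
    have : ∀ z, ‖g z‖ ^ 2 = (1 - 2 * μ) * (if z ∈ A then (1 : ℝ) else 0) + μ ^ 2 := by
      intro z
      simp only [g]
      rw [Complex.norm_real, Real.norm_eq_abs, sq_abs]
      split_ifs <;> ring
    simp_rw [this]
    rw [Finset.sum_add_distrib, ← Finset.mul_sum, hsumA, Finset.sum_const, Finset.card_univ, hcard,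
      nsmul_eq_mul]
    push_cast
    have : (n : ℝ) ^ 2 * μ ^ 2 = A.ncard * μ := by rw [← hμ]; ring
    rw [this]; ring
  have hdiff : ∀ T : (ZMod n × ZMod n) ≃ (ZMod n × ZMod n),
      {z | (T z ∈ A) ≠ (z ∈ A)}.ncard ≤ B → ∑ ξ, ‖hat (fun z => g (T z) - g z) ξ‖ ^ 2 ≤ n ^ 2 * B := by
    intro T hT
    rw [parseval]
    have : ∑ z, ‖g (T z) - g z‖ ^ 2 = {z | (T z ∈ A) ≠ (z ∈ A)}.ncard := by
      have h5 : ∀ z, ‖g (T z) - g z‖ ^ 2 = if (T z ∈ A) ≠ (z ∈ A) then (1 : ℝ) else 0 := by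
        intro z
        simp only [g]
        rw [← Complex.ofReal_sub, Complex.norm_real, Real.norm_eq_abs, sq_abs, sub_sub_sub_cancel_right]
        by_cases h6 : T z ∈ A <;> by_cases h7 : z ∈ A <;> simp [h6, h7]
      simp_rw [h5]
      rw [Finset.sum_boole, Set.ncard_eq_toFinset_card']
      congr 2
      ext z; rw [Set.mem_toFinset, Finset.mem_filter]
      exact ⟨fun h => h.2, fun h => ⟨Finset.mem_univ _, h⟩⟩
    rw [this]
    gcongr
  have hc := core m hm (hat g) hF0 (n ^ 2 * ∑ z, ‖g z‖ ^ 2) (n ^ 2 * B) (parseval g)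
    (by
      have := hdiff _ h1
      simp_rw [hat_sub, hat_shear1] at this
      exact this)
    (by
      have := hdiff _ h2
      simp_rw [hat_sub, hat_shear2] at this
      exact this)
    (by
      have := hdiff _ h3
      simp_rw [hat_sub, hat_transl] at this
      refine le_trans (le_of_eq ?_) this
      apply Finset.sum_congr rfl
      intro ξ _
      rw [← mul_pow, ← norm_mul, sub_mul, one_mul, mul_one, mul_zero, add_zero])
    (by
      have := hdiff _ h4
      simp_rw [hat_sub, hat_transl] at this
      refine le_trans (le_of_eq ?_) this
      apply Finset.sum_congr rfl
      intro ξ _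
      rw [← mul_pow, ← norm_mul, sub_mul, one_mul, mul_one, mul_zero, zero_add])
  rw [hnorm] at hc
  have hc2 : (A.ncard : ℝ) - A.ncard * μ ≤ 100 * (m + 1) ^ 2 * B := by
    have hn2 : (0 : ℝ) < n ^ 2 := by positivity
    apply le_of_mul_le_mul_left _ hn2
    linarith
  have : (A.ncard : ℝ) * μ ≤ A.ncard * (1 / 2) := by gcongr
  linarith

end
end Lack

namespace Lack

section
variable (N m : ℕ)

/-- affine action of the free group of rank four -/
noncomputable def aff : FreeGroup (Fin 4) →* Equiv.Perm (ZMod N × ZMod N) :=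
  FreeGroup.lift ![shear1 (m : ZMod N), shear2 (m : ZMod N), transl (1, 0), transl (0, 1)]

theorem aff0 : aff N m (FreeGroup.of 0) = shear1 (m : ZMod N) := by simp [aff]
theorem aff1 : aff N m (FreeGroup.of 1) = shear2 (m : ZMod N) := by simp [aff]
theorem aff2 : aff N m (FreeGroup.of 2) = transl (1, 0) := by simp [aff]
theorem aff3 : aff N m (FreeGroup.of 3) = transl (0, 1) := by simp [aff]

theorem aff_trans [NeZero N] (z : ZMod N × ZMod N) : ∃ w, aff N m w 0 = z := by
  have h2 : ∀ (a : ℕ) (z : ZMod N × ZMod N), (aff N m (FreeGroup.of 2 ^ a)) z = z + ((a : ZMod N), 0) := by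
    intro a
    induction a with
    | zero => intro z; simp
    | succ a ih =>
      intro z
      rw [pow_succ, map_mul, Equiv.Perm.mul_apply, ih, aff2]
      ext <;> simp [transl]
      ring
  have h3 : ∀ (a : ℕ) (z : ZMod N × ZMod N), (aff N m (FreeGroup.of 3 ^ a)) z = z + (0, (a : ZMod N)) := by
    intro a
    induction a with
    | zero => intro z; simp
    | succ a ih =>
      intro z
      rw [pow_succ, map_mul, Equiv.Perm.mul_apply, ih, aff3]
      ext <;> simp [transl]
      ring
  refine ⟨FreeGroup.of 2 ^ z.1.val * FreeGroup.of 3 ^ z.2.val, ?_⟩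
  rw [map_mul, Equiv.Perm.mul_apply, h3, h2]
  ext <;> simp

theorem aff_add (c : ZMod N × ZMod N) (h1 : (m : ZMod N) * c.1 = 0) (h2 : (m : ZMod N) * c.2 = 0)
    (w : FreeGroup (Fin 4)) : ∀ z, aff N m w (z + c) = aff N m w z + c := by
  induction w using FreeGroup.induction_on with
  | C1 => intro z; simp
  | of j =>
    intro z
    fin_cases j
    · show aff N m (FreeGroup.of 0) _ = aff N m (FreeGroup.of 0) _ + _
      rw [aff0]; ext <;> simp [shear1]
      linear_combination h2
    · show aff N m (FreeGroup.of 1) _ = aff N m (FreeGroup.of 1) _ + _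
      rw [aff1]; ext <;> simp [shear2]
      linear_combination h1
    · show aff N m (FreeGroup.of 2) _ = aff N m (FreeGroup.of 2) _ + _
      rw [aff2]; simp only [transl, Equiv.coe_addRight]; abel
    · show aff N m (FreeGroup.of 3) _ = aff N m (FreeGroup.of 3) _ + _
      rw [aff3]; simp only [transl, Equiv.coe_addRight]; abel
  | inv_of j ih =>
    intro z
    have := ih ((aff N m (FreeGroup.of j))⁻¹ z)
    rw [map_inv, Equiv.Perm.inv_eq_iff_eq, this, ← Equiv.Perm.mul_apply, mul_inv_cancel, Equiv.Perm.one_apply]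
  | mul x y hx hy =>
    intro z
    simp only [map_mul, Equiv.Perm.mul_apply, hx, hy]

theorem aff_red (N' : ℕ) (hd : N' ∣ N) (w : FreeGroup (Fin 4)) : ∀ z : ZMod N × ZMod N,
    aff N' m w (Prod.map (ZMod.castHom hd (ZMod N')) (ZMod.castHom hd (ZMod N')) z) =
      Prod.map (ZMod.castHom hd (ZMod N')) (ZMod.castHom hd (ZMod N')) (aff N m w z) := by
  induction w using FreeGroup.induction_on with
  | C1 => intro z; simp
  | of j =>
    intro z
    fin_cases j
    · show aff N' m (FreeGroup.of 0) _ = Prod.map _ _ (aff N m (FreeGroup.of 0) _)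
      rw [aff0, aff0]; ext <;> simp [shear1, -ZMod.castHom_apply]
    · show aff N' m (FreeGroup.of 1) _ = Prod.map _ _ (aff N m (FreeGroup.of 1) _)
      rw [aff1, aff1]; ext <;> simp [shear2, -ZMod.castHom_apply]
    · show aff N' m (FreeGroup.of 2) _ = Prod.map _ _ (aff N m (FreeGroup.of 2) _)
      rw [aff2, aff2]; ext <;> simp [transl, -ZMod.castHom_apply]
    · show aff N' m (FreeGroup.of 3) _ = Prod.map _ _ (aff N m (FreeGroup.of 3) _)
      rw [aff3, aff3]; ext <;> simp [transl, -ZMod.castHom_apply]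
  | inv_of j ih =>
    intro z
    have := ih ((aff N m (FreeGroup.of j))⁻¹ z)
    rw [map_inv, map_inv, Equiv.Perm.inv_eq_iff_eq, this, ← Equiv.Perm.mul_apply, mul_inv_cancel, Equiv.Perm.one_apply]
  | mul x y hx hy =>
    intro z
    simp only [map_mul, Equiv.Perm.mul_apply, hx, hy]

/-- stabilizer of the origin -/
noncomputable def U : Subgroup (FreeGroup (Fin 4)) :=
  (MulAction.stabilizer (Equiv.Perm (ZMod N × ZMod N)) (0 : ZMod N × ZMod N)).comap (aff N m)

theorem mem_U (w : FreeGroup (Fin 4)) : w ∈ U N m ↔ aff N m w 0 = 0 := Iff.rfl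

theorem U_one : U 1 m = ⊤ := by
  ext w
  simp only [mem_U, Subgroup.mem_top, iff_true]
  exact Subsingleton.elim _ _

end

theorem red_zero (N N' : ℕ) (hd : N' ∣ N) :
    Prod.map (ZMod.castHom hd (ZMod N')) (ZMod.castHom hd (ZMod N')) 0 = 0 :=
  Prod.ext (map_zero _) (map_zero _)

theorem U_le (p k m : ℕ) : U (p ^ (k + 1)) m ≤ U (p ^ k) m := by
  intro w hw
  rw [mem_U] at *
  have := aff_red (p ^ (k + 1)) m (p ^ k) (pow_dvd_pow _ (Nat.le_succ k)) w 0
  rwa [hw, red_zero] at this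

theorem U_normal (p k : ℕ) (hp : p ≠ 0) (g : FreeGroup (Fin 4)) (hg : g ∈ U (p ^ k) (4 * p))
    (x : FreeGroup (Fin 4)) (hx : x ∈ U (p ^ (k + 1)) (4 * p)) :
    g * x * g⁻¹ ∈ U (p ^ (k + 1)) (4 * p) := by
  have hd := pow_dvd_pow p (Nat.le_succ k)
  have : NeZero (p ^ (k + 1)) := ⟨pow_ne_zero _ hp⟩
  have hg' := (U (p ^ k) (4 * p)).inv_mem hg
  rw [mem_U] at hg' hx ⊢
  set c := aff (p ^ (k + 1)) (4 * p) g⁻¹ 0 with hc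
  have h1 := aff_red (p ^ (k + 1)) (4 * p) (p ^ k) hd g⁻¹ 0
  have hk : ∀ a : ZMod (p ^ (k + 1)), ZMod.castHom hd (ZMod (p ^ k)) a = 0 →
      ((4 * p : ℕ) : ZMod (p ^ (k + 1))) * a = 0 := by
    intro a ha
    rw [← ZMod.natCast_zmod_val a, map_natCast, ZMod.natCast_eq_zero_iff] at ha
    obtain ⟨j, hj⟩ := ha
    rw [← ZMod.natCast_zmod_val a, hj, ← Nat.cast_mul, ZMod.natCast_eq_zero_iff]
    exact ⟨4 * j, by ring⟩
  have h0 : Prod.map (ZMod.castHom hd (ZMod (p ^ k))) (ZMod.castHom hd (ZMod (p ^ k))) 0 = 0 :=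
    red_zero _ _ hd
  rw [h0, hg', ← hc] at h1
  have h2 := aff_add (p ^ (k + 1)) (4 * p) c (hk _ (congrArg Prod.fst h1).symm)
    (hk _ (congrArg Prod.snd h1).symm) x 0
  rw [hx, zero_add] at h2
  rw [map_mul, map_mul, Equiv.Perm.mul_apply, Equiv.Perm.mul_apply, ← hc, h2, hc,
    ← Equiv.Perm.mul_apply, ← map_mul, mul_inv_cancel, map_one]
  rfl

theorem index_stab {H Ω : Type*} [Group H] (φ : H →* Equiv.Perm Ω) (ω : Ω)
    (ht : ∀ z, ∃ x, φ x ω = z) (L : Subgroup H) (hL : ∀ x, x ∈ L ↔ φ x ω = ω) :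
    L.index = Nat.card Ω := by
  let _ : MulAction H Ω := MulAction.compHom Ω φ
  have e : L = MulAction.stabilizer H ω := by
    ext x; rw [hL]; exact Iff.rfl
  rw [e, MulAction.index_stabilizer]
  have : MulAction.orbit H ω = Set.univ := Set.eq_univ_of_forall ht
  rw [this, Set.ncard_univ]

end Lack

namespace Lack

section
variable {G : Type*} [Group G] (N : Subgroup G) (θ : N →* FreeGroup (Fin 4))

/-- pulled back stabilizers -/
noncomputable def KK (L m : ℕ) : Subgroup G := ((U L m).comap θ).map N.subtype

variable {N}

theorem KK_le (L m : ℕ) : KK N θ L m ≤ N := Subgroup.map_subtype_le _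

theorem mem_KK (L m : ℕ) (x : N) : (x : G) ∈ KK N θ L m ↔ aff L m (θ x) 0 = 0 := by
  rw [KK, Subgroup.mem_map]
  constructor
  · rintro ⟨y, hy, hyx⟩
    have : y = x := Subtype.ext hyx
    rw [← this]; exact hy
  · intro h
    exact ⟨x, h, rfl⟩

theorem KK_one (m : ℕ) : KK N θ 1 m = N := by
  rw [KK, U_one, Subgroup.comap_top, ← MonoidHom.range_eq_map, Subgroup.range_subtype]

theorem KK_succ_le (p k m : ℕ) : KK N θ (p ^ (k + 1)) m ≤ KK N θ (p ^ k) m :=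
  Subgroup.map_mono (Subgroup.comap_mono (U_le p k m))

theorem KK_sub (hN : IsSubnormal N) (p k : ℕ) (hp : p ≠ 0) : IsSubnormal (KK N θ (p ^ k) (4 * p)) := by
  induction k with
  | zero => rw [pow_zero, KK_one]; exact hN
  | succ k ih =>
    refine subnormal_step ih (KK_succ_le θ p k _) ?_
    intro g hg x hx
    have hgN := KK_le θ _ _ hg
    have hxN := KK_le θ _ _ hx
    lift g to N using hgN
    lift x to N using hxN
    rw [mem_KK] at hg hx
    have := (mem_KK θ (p ^ (k + 1)) (4 * p) (g * x * g⁻¹)).2 (by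
      have := U_normal p k hp (θ g) hg (θ x) hx
      rw [mem_U] at this
      simpa only [map_mul, map_inv] using this)
    exact this

theorem KK_trans (hθ : Function.Surjective θ) (L m : ℕ) [NeZero L] (z : ZMod L × ZMod L) :
    ∃ x : N, aff L m (θ x) 0 = z := by
  obtain ⟨w, hw⟩ := aff_trans L m z
  obtain ⟨x, rfl⟩ := hθ w
  exact ⟨x, hw⟩

theorem KK_index (hθ : Function.Surjective θ) (L m : ℕ) [NeZero L] :
    (KK N θ L m).index = L ^ 2 * N.index := by
  rw [KK, Subgroup.index_map_subtype,
    index_stab ((aff L m).comp θ) 0 (KK_trans θ hθ L m) _ (fun x => Iff.rfl), Nat.card_prod,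
    Nat.card_zmod, sq]

theorem KK_dp (hθ : Function.Surjective θ) (p : ℕ) [Fact p.Prime] (L m : ℕ) [NeZero L]
    [Group.FG G] [N.FiniteIndex] : 3 * L ^ 2 ≤ dp p (KK N θ L m) := by
  have : (KK N θ L m).FiniteIndex := ⟨by
    rw [KK_index θ hθ]
    exact mul_ne_zero (pow_ne_zero _ (NeZero.ne L)) Subgroup.FiniteIndex.index_ne_zero⟩
  have h := dp_lower (K := KK N θ L m) p (aff L m) (0 : ZMod L × ZMod L)
    (fun z => aff_trans L m z)
    (θ.comp (Subgroup.inclusion (KK_le θ L m))) (by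
      intro w
      constructor
      · intro h
        obtain ⟨x, rfl⟩ := hθ w
        exact ⟨⟨x, (mem_KK θ L m x).2 h⟩, rfl⟩
      · rintro ⟨x, rfl⟩
        exact (mem_KK θ L m (Subgroup.inclusion (KK_le θ L m) x)).1 x.2)
  rw [Fintype.card_prod, ZMod.card, ← sq] at h
  omega

theorem fiber_sum {X Y : Type*} [Finite X] [Fintype Y] (π : X → Y) (A : Set X) :
    A.ncard = ∑ y, (A ∩ π ⁻¹' {y}).ncard := by
  classical
  have : Fintype X := Fintype.ofFinite X
  rw [Set.ncard_eq_toFinset_card', Finset.card_eq_sum_card_fiberwise (t := Finset.univ) (f := π)]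
  · apply Finset.sum_congr rfl
    intro y _
    rw [Set.ncard_eq_toFinset_card']
    congr 1
    ext x; simp
  · intro x _; simp

theorem combi {Y : Type*} [Fintype Y] (a : Y → ℝ) (D E B : ℝ) (hB : 0 ≤ B)
    (ha : ∀ y, a y ≤ D) (h1 : ∀ y, 2 * a y ≤ D → a y ≤ E * B)
    (h2 : ∀ y, D ≤ 2 * a y → D - a y ≤ E * B) (C : ℝ) (hC : 0 ≤ C) (hE : 0 ≤ E)
    (h3 : ∀ y y', a y - a y' ≤ C * B)
    (hs : 2 * ∑ y, a y ≤ Fintype.card Y * D) :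
    ∑ y, a y ≤ Fintype.card Y * (2 * E + C) * B := by
  by_cases h : ∀ y, 2 * a y ≤ D
  · calc ∑ y, a y ≤ ∑ y : Y, (2 * E + C) * B := by
          apply Finset.sum_le_sum
          intro y _
          have := h1 y (h y)
          nlinarith [mul_nonneg hC hB, mul_nonneg hE hB]
      _ = _ := by rw [Finset.sum_const, Finset.card_univ, nsmul_eq_mul]; ring
  · push Not at h
    obtain ⟨y, hy⟩ := h
    have : ∃ y', 2 * a y' ≤ D := by
      by_contra hne
      push Not at hne
      have : ∑ y : Y, D < ∑ y, 2 * a y :=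
        Finset.sum_lt_sum_of_nonempty ⟨y, Finset.mem_univ _⟩ (fun i _ => hne i)
      rw [← Finset.mul_sum, Finset.sum_const, Finset.card_univ, nsmul_eq_mul] at this
      linarith
    obtain ⟨y', hy'⟩ := this
    have hD : D ≤ (2 * E + C) * B := by
      have := h2 y hy.le
      have := h1 y' hy'
      have := h3 y y'
      linarith
    calc ∑ y, a y ≤ ∑ y : Y, (2 * E + C) * B := by
          apply Finset.sum_le_sum
          intro y _
          linarith [ha y]
      _ = _ := by rw [Finset.sum_const, Finset.card_univ, nsmul_eq_mul]; ring

/-- one fibre -/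
theorem fiber_exp (hθ : Function.Surjective θ) (L m : ℕ) [NeZero L] (hm : 4 ≤ m)
    [N.FiniteIndex] (S : Finset G) (g : G) (u : Fin 4 → N) (hu : ∀ j, θ (u j) = FreeGroup.of j)
    (hS : ∀ j, g * u j * g⁻¹ ∈ S) (A : Set (G ⧸ KK N θ L m)) (a : ℕ)
    (ha : (A ∩ qmap (KK_le θ L m) ⁻¹' {(g : G ⧸ N)}).ncard = a) :
    a ≤ L ^ 2 ∧
    (2 * a ≤ L ^ 2 → (a : ℝ) ≤ 200 * (m + 1) ^ 2 *
      (schreierBoundary G (S : Set G) (KK N θ L m) A).ncard) ∧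
    (L ^ 2 ≤ 2 * a → (L : ℝ) ^ 2 - a ≤ 200 * (m + 1) ^ 2 *
      (schreierBoundary G (S : Set G) (KK N θ L m) A).ncard) := by
  classical
  have hfin : (KK N θ L m).FiniteIndex := ⟨by
    rw [KK_index θ hθ]
    exact mul_ne_zero (pow_ne_zero _ (NeZero.ne L)) Subgroup.FiniteIndex.index_ne_zero⟩
  choose x hx using KK_trans θ hθ L m
  let ι : ZMod L × ZMod L → G ⧸ KK N θ L m := fun z => ((g * x z : G) : G ⧸ KK N θ L m)
  have key : ∀ y y' : N, ((g * y : G) : G ⧸ KK N θ L m) = ((g * y' : G) : G ⧸ KK N θ L m) ↔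
      aff L m (θ y) 0 = aff L m (θ y') 0 := by
    intro y y'
    rw [QuotientGroup.eq]
    have e : (g * (y : G))⁻¹ * (g * y') = ((y⁻¹ * y' : N) : G) := by
      simp [mul_assoc]
    rw [e, mem_KK, map_mul, map_mul, Equiv.Perm.mul_apply, map_inv, map_inv,
      Equiv.Perm.inv_eq_iff_eq]
    exact eq_comm
  have hinj : Function.Injective ι := by
    intro z z' h
    have := (key _ _).1 h
    rwa [hx, hx] at this
  have hmove : ∀ j z, (g * u j * g⁻¹) • ι z = ι (aff L m (FreeGroup.of j) z) := by
    intro j z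
    have e : (g * u j * g⁻¹) • ι z = ((g * (u j * x z : N) : G) : G ⧸ KK N θ L m) := by
      show ((g * u j * g⁻¹ * (g * x z) : G) : G ⧸ KK N θ L m) = _
      congr 1
      simp [mul_assoc]
    rw [e]
    refine (key _ _).2 ?_
    rw [hx, map_mul, map_mul, Equiv.Perm.mul_apply, hx, hu]
  have hrange : ι '' (ι ⁻¹' A) = A ∩ qmap (KK_le θ L m) ⁻¹' {(g : G ⧸ N)} := by
    rw [Set.image_preimage_eq_inter_range]
    congr 1
    ext y
    constructor
    · rintro ⟨z, rfl⟩
      show ((g * x z : G) : G ⧸ N) = (g : G ⧸ N)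
      rw [QuotientGroup.mk_mul_of_mem _ (x z).2]
    · intro hy
      induction y using QuotientGroup.induction_on with
      | H h =>
        have h1 : (h : G ⧸ N) = (g : G ⧸ N) := hy
        have h2 := QuotientGroup.eq.1 h1.symm
        refine ⟨aff L m (θ ⟨_, h2⟩) 0, ?_⟩
        have := (key (x (aff L m (θ ⟨_, h2⟩) 0)) ⟨_, h2⟩).2 (hx _)
        show ((g * x (aff L m (θ ⟨_, h2⟩) 0) : G) : G ⧸ KK N θ L m) = _
        rw [this]
        congr 1
        simp
  set A' : Set (ZMod L × ZMod L) := ι ⁻¹' A with hA'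
  have hcard : A'.ncard = a := by
    rw [← ha, ← hrange, Set.ncard_image_of_injective _ hinj]
  have hb : ∀ j, {z | (aff L m (FreeGroup.of j) z ∈ A') ≠ (z ∈ A')}.ncard ≤
      (schreierBoundary G (S : Set G) (KK N θ L m) A).ncard := by
    intro j
    refine Set.ncard_le_ncard_of_injOn (fun z => (g * u j * g⁻¹, ι z)) ?_ ?_ (schreier_finite S _ A)
    · intro z hz
      refine ⟨hS j, ?_⟩
      show (ι z ∈ A) ≠ ((g * u j * g⁻¹) • ι z ∈ A)
      rw [hmove]
      exact fun h => hz h.symm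
    · intro z _ z' _ h
      exact hinj (Prod.ext_iff.1 h).2
  have hN : Nat.card (ZMod L × ZMod L) = L ^ 2 := by rw [Nat.card_prod, Nat.card_zmod, sq]
  have hcompl : A'ᶜ.ncard = L ^ 2 - a := by
    have := Set.ncard_add_ncard_compl A'
    rw [hN, hcard] at this
    omega
  have hle : a ≤ L ^ 2 := by
    have := Set.ncard_add_ncard_compl A'
    rw [hN, hcard] at this
    omega
  have b0 := hb 0
  have b1 := hb 1
  have b2 := hb 2
  have b3 := hb 3
  rw [aff0] at b0
  rw [aff1] at b1
  rw [aff2] at b2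
  rw [aff3] at b3
  refine ⟨hle, ?_, ?_⟩
  · intro h
    rw [← hcard]
    exact expander m hm A' (by rw [hcard]; exact h) _ b0 b1 b2 b3
  · intro h
    have hc : ∀ T : Equiv.Perm (ZMod L × ZMod L), {z | (T z ∈ A'ᶜ) ≠ (z ∈ A'ᶜ)} =
        {z | (T z ∈ A') ≠ (z ∈ A')} := by
      intro T
      ext z
      simp only [Set.mem_setOf_eq, Set.mem_compl_iff, ne_eq, eq_iff_iff, not_iff_not]
    have := expander m hm A'ᶜ (by rw [hcompl]; omega)
      (schreierBoundary G (S : Set G) (KK N θ L m) A).ncard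
      (by rw [hc]; exact b0) (by rw [hc]; exact b1) (by rw [hc]; exact b2) (by rw [hc]; exact b3)
    rw [hcompl, Nat.cast_sub hle] at this
    exact_mod_cast this

theorem KK_tau {n : ℕ} (f : FreeGroup (Fin n) →* G) (hf : Function.Surjective f)
    (hθ : Function.Surjective θ) [N.FiniteIndex] (m : ℕ) (hm : 4 ≤ m) (Ls : ℕ → ℕ)
    (hL : ∀ i, 2 ≤ Ls i) : PropertyTau G (fun i => KK N θ (Ls i) m) := by
  classical
  have hY : Fintype (G ⧸ N) := Fintype.ofFinite _
  choose u hu using fun j : Fin 4 => hθ (FreeGroup.of j)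
  let S : Finset G := Finset.univ.image (fun i => f (FreeGroup.of i)) ∪
    Finset.univ.image (fun e : (G ⧸ N) × Fin 4 => e.1.out * u e.2 * e.1.out⁻¹)
  obtain ⟨C, hC⟩ := slow (Y := G ⧸ N) f hf
  have hcY : (0 : ℝ) < Fintype.card (G ⧸ N) := by exact_mod_cast Fintype.card_pos
  set E : ℝ := 200 * (m + 1) ^ 2 with hE
  have hE0 : 0 < E := by positivity
  set W : ℝ := Fintype.card (G ⧸ N) * (2 * E + C * n) with hW
  have hW0 : 0 < W := by positivity
  refine ⟨S, ?_, 1 / W, by positivity, ?_⟩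
  · rw [eq_top_iff, ← closure_image f hf]
    apply Subgroup.closure_mono
    rintro _ ⟨i, rfl⟩
    simp [S]
  · intro i
    have : NeZero (Ls i) := ⟨by have := hL i; omega⟩
    have hidx := KK_index θ hθ (Ls i) m
    have hfin : (KK N θ (Ls i) m).FiniteIndex := ⟨by
      rw [hidx]
      exact mul_ne_zero (pow_ne_zero _ (NeZero.ne _)) Subgroup.FiniteIndex.index_ne_zero⟩
    apply le_csInf (cheeger_set_nonempty _ _ (by
      rw [hidx]
      have h1 : 0 < N.index := Nat.pos_of_ne_zero Subgroup.FiniteIndex.index_ne_zero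
      have h2 := hL i
      nlinarith))
    rintro _ ⟨A, hA, hA2, rfl⟩
    have hA2' : 2 * (A.ncard : ℝ) ≤ ((KK N θ (Ls i) m).index : ℝ) := by
      rw [Nat.card_coe_set_eq] at hA2; exact hA2
    rw [Nat.card_coe_set_eq, Nat.card_coe_set_eq]
    have hApos : (0 : ℝ) < A.ncard := by exact_mod_cast (Set.ncard_pos (Set.toFinite _)).2 hA
    set B : ℕ := (schreierBoundary G (S : Set G) (KK N θ (Ls i) m) A).ncard with hB
    have hbd : (bd f A : ℝ) ≤ n * B := by
      have := bd_le_schreier f S (fun i => by simp [S]) (KK N θ (Ls i) m) A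
      exact_mod_cast this
    let a : G ⧸ N → ℕ := fun y => (A ∩ qmap (KK_le θ (Ls i) m) ⁻¹' {y}).ncard
    have hfib := fun y : G ⧸ N => fiber_exp θ hθ (Ls i) m hm S y.out u hu (by
      intro j
      refine Finset.mem_union_right _ (Finset.mem_image.2 ⟨(y, j), Finset.mem_univ _, rfl⟩)) A (a y) (by
      rw [QuotientGroup.out_eq'])
    have hsl := hC (fun y => (a y : ℝ)) (bd f A) (by positivity)
      (fun j y => fiber_slow f _ (qmap_smul (KK_le θ (Ls i) m)) A j y)
    have hsum : (A.ncard : ℝ) = ∑ y, (a y : ℝ) := by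
      exact_mod_cast fiber_sum (qmap (KK_le θ (Ls i) m)) A
    have := combi (fun y => (a y : ℝ)) ((Ls i : ℝ) ^ 2) E B (by positivity)
      (fun y => by exact_mod_cast (hfib y).1)
      (fun y h => (hfib y).2.1 (by exact_mod_cast h))
      (fun y h => (hfib y).2.2 (by exact_mod_cast h)) (C * n) (by positivity) hE0.le
      (fun y y' => by
        have h1 := (abs_le.1 (hsl y y')).2
        refine h1.trans ?_
        rw [mul_assoc]
        gcongr)
      (by
        rw [← hsum]
        refine hA2'.trans (le_of_eq ?_)
        rw [hidx]
        have : N.index = Fintype.card (G ⧸ N) := by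
          rw [Subgroup.index, Nat.card_eq_fintype_card]
        rw [this]; push_cast; ring)
    rw [← hsum, ← hW] at this
    rw [div_le_div_iff₀ hW0 hApos]
    linarith

end

theorem of_large {G : Type*} [Group G] {n : ℕ} (f : FreeGroup (Fin n) →* G)
    (hf : Function.Surjective f) (p : ℕ) [Fact p.Prime] (N : Subgroup G) (hN : IsSubnormal N)
    (hpow : ∃ k : ℕ, N.index = p ^ k) (θ : N →* FreeGroup (Fin 4)) (hθ : Function.Surjective θ) :
    ∃ Ks : ℕ → Subgroup G,
      (∀ i, Ks (i + 1) < Ks i) ∧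
      (∀ i, IsSubnormal (Ks i)) ∧
      (∀ i, ∃ k : ℕ, (Ks i).index = p ^ k) ∧
      LinearGrowthModP p Ks ∧
      PropertyTau G Ks := by
  have hp : p.Prime := Fact.out
  obtain ⟨k, hk⟩ := hpow
  have hNf : N.FiniteIndex := ⟨by rw [hk]; exact pow_ne_zero _ hp.ne_zero⟩
  have hNpos : 0 < N.index := Nat.pos_of_ne_zero hNf.index_ne_zero
  have hFG : Group.FG G := Group.fg_of_surjective hf
  have hnz : ∀ i, NeZero (p ^ i) := fun i => ⟨pow_ne_zero _ hp.ne_zero⟩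
  have hidx : ∀ i, (KK N θ (p ^ i) (4 * p)).index = (p ^ i) ^ 2 * N.index :=
    fun i => KK_index θ hθ _ _
  refine ⟨fun i => KK N θ (p ^ (i + 1)) (4 * p), ?_, ?_, ?_, ?_, ?_⟩
  · intro i
    refine lt_of_le_of_ne (KK_succ_le θ p (i + 1) _) ?_
    intro h
    have h1 := congrArg Subgroup.index h
    simp only [hidx] at h1
    have h2 := Nat.eq_of_mul_eq_mul_right hNpos h1
    rw [← pow_mul, ← pow_mul] at h2
    have := Nat.pow_right_injective hp.two_le h2
    omega
  · intro i
    exact KK_sub θ hN p _ hp.ne_zero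
  · intro i
    refine ⟨(i + 1) * 2 + k, ?_⟩
    simp only [hidx]
    rw [hk, ← pow_mul, ← pow_add]
  · refine ⟨3 / N.index, by positivity, fun i => ?_⟩
    have h := KK_dp θ hθ p (p ^ (i + 1)) (4 * p)
    simp only [hidx]
    have h' : (3 : ℝ) * ((p ^ (i + 1) : ℕ) : ℝ) ^ 2 ≤ dp p (KK N θ (p ^ (i + 1)) (4 * p)) := by
      exact_mod_cast h
    have hpos : (0 : ℝ) < ((p ^ (i + 1) : ℕ) : ℝ) := by
      exact_mod_cast pow_pos hp.pos _
    have hNpos' : (0 : ℝ) < N.index := by exact_mod_cast hNpos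
    rw [Nat.cast_mul, Nat.cast_pow, div_le_div_iff₀ hNpos' (by positivity)]
    nlinarith
  · exact KK_tau θ f hf hθ (4 * p) (by have := hp.pos; omega) (fun i => p ^ (i + 1))
      (fun i => hp.two_le.trans (Nat.le_self_pow (Nat.succ_ne_zero i) p))

end Lack

/-- **Theorem 1.3**: a finitely presented group with a strictly nested sequence of subnormal
subgroups of p-power index with linear growth of mod p homology has such a sequence with
Property (τ). -/
theorem statement2 {G : Type*} [Group G] (hG : IsFinitelyPresented G) (p : ℕ) (hp : p.Prime)
    (Hs : ℕ → Subgroup G)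
    (hnest : ∀ i, Hs (i + 1) < Hs i)
    (hsub : ∀ i, IsSubnormal (Hs i))
    (hpow : ∀ i, ∃ k : ℕ, (Hs i).index = p ^ k)
    (hlin : LinearGrowthModP p Hs) :
    ∃ Ks : ℕ → Subgroup G,
      (∀ i, Ks (i + 1) < Ks i) ∧
      (∀ i, IsSubnormal (Ks i)) ∧
      (∀ i, ∃ k : ℕ, (Ks i).index = p ^ k) ∧
      LinearGrowthModP p Ks ∧
      PropertyTau G Ks := by
  obtain ⟨n, R, f, hf, hker⟩ := hG
  have hpf : Fact p.Prime := ⟨hp⟩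
  have hlin' : LinearGrowthModP p (fun i => Hs (i + 1)) := by
    obtain ⟨c, hc, h⟩ := hlin
    exact ⟨c, hc, fun i => h (i + 1)⟩
  by_cases ht : PropertyTau G (fun i => Hs (i + 1))
  · exact ⟨fun i => Hs (i + 1), fun i => hnest _, fun i => hsub _, fun i => hpow _, hlin', ht⟩
  · obtain ⟨N, hN, hNp, θ, hθ⟩ := Lack.large_of_not_tau f hf R hker p (fun i => Hs (i + 1))
      (fun i => hnest _) (fun i => hsub _) (fun i => hpow _) (fun i => by
        obtain ⟨k, hk⟩ := hpow (i + 1)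
        have h0 : (Hs (i + 1)).index ≠ 0 := by rw [hk]; exact pow_ne_zero _ hp.ne_zero
        have h1 : (Hs (i + 1)).index ≠ 1 := by
          rw [ne_eq, Subgroup.index_eq_one]
          exact (lt_of_lt_of_le (hnest i) le_top).ne
        show 2 ≤ (Hs (i + 1)).index
        omega) hlin' ht
    exact Lack.of_large f hf p N hN hNp θ hθ
end

section
/- Let G be a finite group with generating set S, and let X be the Cayley graph of G with respect to S. Let D be a non-empty subset of G such that |∂D|/|D| = h(X) and |D| ≤ |G|/2. Then |D| > |G|/4. Furthermore, the subgraphs of X induced by D and by its complement G∖D are both connected. -/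
/-- The edge boundary of a subset `A` of the Cayley graph of `G` with respect to `S`:
edges are pairs `(s, x)` with `s ∈ S`, joining `x` and `s * x`. -/
def cayleyBoundary (G : Type*) [Group G] (S : Set G) (A : Set G) : Set (G × G) :=
  {e | e.1 ∈ S ∧ ((e.2 ∈ A) ≠ (e.1 * e.2 ∈ A))}

/-- The Cheeger constant of the Cayley graph of `G` with respect to `S`. -/
noncomputable def cayleyCheeger (G : Type*) [Group G] (S : Set G) : ℝ :=
  sInf {r : ℝ | ∃ A : Set G, A.Nonempty ∧
    2 * (Nat.card A : ℝ) ≤ (Nat.card G : ℝ) ∧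
    r = (Nat.card (cayleyBoundary G S A) : ℝ) / (Nat.card A : ℝ)}

/-- The subgraph of the Cayley graph of `G` (w.r.t. `S`) induced by `D` is connected:
any two vertices of `D` are joined by a path within `D`, where `x` and `y` are
adjacent iff `y = s * x` or `x = s * y` for some `s ∈ S`. -/
def InducedConnected (G : Type*) [Group G] (S : Set G) (D : Set G) : Prop :=
  ∀ x ∈ D, ∀ y ∈ D,
    Relation.ReflTransGen (fun a b => a ∈ D ∧ b ∈ D ∧ ∃ s ∈ S, b = s * a ∨ a = s * b) x y

open Set in
theorem aux_strict {G : Type*} [Group G] [Finite G] (S A B : Set G) (e : G × G)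
    (heA : e ∈ cayleyBoundary G S A) (heB : e ∈ cayleyBoundary G S B)
    (hU : e ∉ cayleyBoundary G S (A ∪ B)) :
    (cayleyBoundary G S (A ∪ B)).ncard + (cayleyBoundary G S (A ∩ B)).ncard <
      (cayleyBoundary G S A).ncard + (cayleyBoundary G S B).ncard := by
  rw [← ncard_union_add_ncard_inter, ← ncard_union_add_ncard_inter (cayleyBoundary G S A)]
  apply add_lt_add_of_le_of_lt
  · apply ncard_le_ncard _ (Set.toFinite _)
    rintro ⟨s, x⟩ h
    simp only [cayleyBoundary, mem_union, mem_inter_iff, mem_ofPred_eq, ne_eq, eq_iff_iff] at *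
    tauto
  · apply ncard_lt_ncard _ (Set.toFinite _)
    refine ⟨?_, fun h => hU (h ⟨heA, heB⟩).1⟩
    rintro ⟨s, x⟩ h
    simp only [cayleyBoundary, mem_union, mem_inter_iff, mem_ofPred_eq, ne_eq, eq_iff_iff] at *
    clear heA heB hU
    by_cases h1 : x ∈ A <;> by_cases h2 : x ∈ B <;> by_cases h3 : s * x ∈ A <;>
      by_cases h4 : s * x ∈ B <;> simp_all

theorem aux_translate {G : Type*} [Group G] (S A : Set G) (g : G) :
    (cayleyBoundary G S {x | x * g ∈ A}).ncard = (cayleyBoundary G S A).ncard := by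
  have : cayleyBoundary G S A = (fun e : G × G => (e.1, e.2 * g)) ''
      (cayleyBoundary G S {x | x * g ∈ A}) := by
    ext ⟨s, x⟩
    constructor
    · rintro ⟨h1, h2⟩
      refine ⟨(s, x * g⁻¹), ⟨h1, ?_⟩, by simp⟩
      simpa [mul_assoc] using h2
    · rintro ⟨⟨t, y⟩, ⟨h1, h2⟩, h3⟩
      simp only [Prod.mk.injEq] at h3
      obtain ⟨rfl, rfl⟩ := h3
      refine ⟨h1, ?_⟩
      simpa [mul_assoc] using h2
  rw [this, Set.ncard_image_of_injective]
  rintro ⟨a, b⟩ ⟨c, d⟩ h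
  simpa using h

theorem aux_translate_card {G : Type*} [Group G] (A : Set G) (g : G) :
    ({x | x * g ∈ A} : Set G).ncard = A.ncard := by
  have : A = (fun x => x * g) '' {x | x * g ∈ A} := by
    ext x
    constructor
    · intro h
      exact ⟨x * g⁻¹, by simpa using h, by simp⟩
    · rintro ⟨y, h, rfl⟩
      exact h
  conv_rhs => rw [this]
  rw [Set.ncard_image_of_injective _ (mul_left_injective g)]

theorem aux_nonempty {G : Type*} [Group G] (S D : Set G) (hS : Subgroup.closure S = ⊤)
    (hD : D.Nonempty) (hD' : D ≠ Set.univ) : (cayleyBoundary G S D).Nonempty := by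
  by_contra hne
  rw [Set.not_nonempty_iff_eq_empty] at hne
  have h1 : ∀ s ∈ S, ∀ x, x ∈ D ↔ s * x ∈ D := by
    intro s hs x
    by_contra hc
    have : (s, x) ∈ cayleyBoundary G S D := ⟨hs, by simpa using hc⟩
    rw [hne] at this
    exact this
  have h2 : ∀ g ∈ Subgroup.closure S, ∀ x, x ∈ D ↔ g * x ∈ D := by
    intro g hg
    induction hg using Subgroup.closure_induction with
    | mem s hs => exact h1 s hs
    | one => simp
    | mul a b _ _ ha hb => intro x; rw [hb, ha, mul_assoc]
    | inv a _ ha => intro x; rw [ha (a⁻¹ * x)]; simp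
  apply hD'
  obtain ⟨d, hd⟩ := hD
  ext x
  have := (h2 (x * d⁻¹) (by rw [hS]; trivial) d).1 hd
  simpa using this

/-- Minimisers of the Cheeger ratio, in natural-number form. -/
def AuxMin {G : Type*} [Group G] (S D : Set G) : Prop :=
  D.Nonempty ∧ 2 * D.ncard ≤ Nat.card G ∧ ∀ A : Set G, 2 * A.ncard ≤ Nat.card G →
    (cayleyBoundary G S D).ncard * A.ncard ≤ (cayleyBoundary G S A).ncard * D.ncard

theorem AuxMin.pos {G : Type*} [Group G] [Finite G] {S D : Set G}
    (hS : Subgroup.closure S = ⊤) (h : AuxMin S D) :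
    0 < D.ncard ∧ (cayleyBoundary G S D).Nonempty := by
  have hp : 0 < D.ncard := (Set.ncard_pos (Set.toFinite _)).2 h.1
  refine ⟨hp, aux_nonempty S D hS h.1 ?_⟩
  rintro rfl
  have := h.2.1
  rw [Set.ncard_univ] at this hp
  omega

theorem AuxMin.quarter {G : Type*} [Group G] [Finite G] {S D : Set G}
    (hS : Subgroup.closure S = ⊤) (h : AuxMin S D) : Nat.card G < 4 * D.ncard := by
  by_contra hc
  push Not at hc
  obtain ⟨hp, ⟨⟨s, x⟩, he⟩⟩ := h.pos hS
  have key : ∀ g : G, ∀ e : G × G, e ∈ cayleyBoundary G S D →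
      e ∈ cayleyBoundary G S {x | x * g ∈ D} →
      e ∈ cayleyBoundary G S (D ∪ {x | x * g ∈ D}) := by
    intro g e h1 h2
    by_contra h3
    have h4 := aux_strict S D _ e h1 h2 h3
    have h5 := Set.ncard_union_add_ncard_inter D {x | x * g ∈ D}
    rw [aux_translate] at h4
    rw [aux_translate_card] at h5
    have h6 := h.2.2 (D ∪ {x | x * g ∈ D}) (by omega)
    have h7 := h.2.2 (D ∩ {x | x * g ∈ D}) (by
      have := Set.ncard_le_ncard (Set.inter_subset_left (s := D) (t := {x | x * g ∈ D}))
        (Set.toFinite _)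
      omega)
    nlinarith
  obtain ⟨hs, hx⟩ := he
  simp only [ne_eq, eq_iff_iff] at hs hx
  have hb : (s, x) ∈ cayleyBoundary G S D := ⟨hs, by simpa using hx⟩
  have fin : ∀ t : G, (∀ y ∈ D, t * y ∈ D) → ∀ y, t * y ∈ D → y ∈ D := by
    intro t ht y hy
    have himg : (fun y => t * y) '' D = D := by
      apply Set.eq_of_subset_of_ncard_le
      · rintro _ ⟨z, hz, rfl⟩
        exact ht z hz
      · rw [Set.ncard_image_of_injective _ (mul_right_injective t)]
      · exact Set.toFinite _
    rw [← himg] at hy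
    obtain ⟨z, hz, hzy⟩ := hy
    rwa [← mul_left_cancel hzy]
  by_cases hxD : x ∈ D
  · have hsx : s * x ∉ D := by tauto
    have := fin s⁻¹ (by
      intro y hy
      by_contra hc
      have := key (x⁻¹ * s⁻¹ * y) (s, x) hb
      simp [cayleyBoundary, hs, hxD, hsx, hy, hc, mul_assoc] at this) (s * x) (by simpa using hxD)
    exact hsx this
  · have hsx : s * x ∈ D := by tauto
    have := fin s (by
      intro y hy
      by_contra hc
      have := key (x⁻¹ * y) (s, x) hb
      simp [cayleyBoundary, hs, hxD, hsx, hy, hc, mul_assoc] at this) x hsx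
    exact hxD this

theorem aux_split {G : Type*} [Group G] [Finite G] (S D : Set G) (h : ¬ InducedConnected G S D) :
    ∃ A B : Set G, A.Nonempty ∧ B.Nonempty ∧ A ∪ B = D ∧ Disjoint A B ∧
      (cayleyBoundary G S A).ncard + (cayleyBoundary G S B).ncard ≤
        (cayleyBoundary G S D).ncard := by
  unfold InducedConnected at h
  push Not at h
  obtain ⟨x, hx, y, hy, hxy⟩ := h
  set R := (fun a b => a ∈ D ∧ b ∈ D ∧ ∃ s ∈ S, b = s * a ∨ a = s * b) with hR
  have h1 : ∀ a b, a ∈ D → b ∈ D → Relation.ReflTransGen R x a → (∃ s ∈ S, b = s * a ∨ a = s * b) →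
      Relation.ReflTransGen R x b := fun a b ha hb hxa hs => hxa.tail ⟨ha, hb, hs⟩
  have h0 : Relation.ReflTransGen R x x := Relation.ReflTransGen.refl
  generalize Relation.ReflTransGen R x = P at *
  have e1 : ∀ s ∈ S, ∀ z, z ∈ D → s * z ∈ D → (P z ↔ P (s * z)) := fun s hs z hz hsz =>
    ⟨fun hp => h1 _ _ hz hsz hp ⟨s, hs, Or.inl rfl⟩,
      fun hp => h1 _ _ hsz hz hp ⟨s, hs, Or.inr rfl⟩⟩
  refine ⟨{z | z ∈ D ∧ P z}, {z | z ∈ D ∧ ¬ P z}, ⟨x, hx, h0⟩, ⟨y, hy, hxy⟩, ?_, ?_, ?_⟩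
  · ext z
    simp only [Set.mem_union, Set.mem_ofPred_eq]
    tauto
  · rw [Set.disjoint_left]
    rintro z ⟨_, h2⟩ ⟨_, h3⟩
    exact h3 h2
  · rw [← Set.ncard_union_eq]
    · apply Set.ncard_le_ncard _ (Set.toFinite _)
      rintro ⟨s, z⟩ hz
      simp only [cayleyBoundary, Set.mem_union, Set.mem_ofPred_eq, ne_eq, eq_iff_iff] at *
      have := e1 s
      have := fun hs => e1 s hs z
      tauto
    · rw [Set.disjoint_left]
      rintro ⟨s, z⟩ hz hz'
      simp only [cayleyBoundary, Set.mem_ofPred_eq, ne_eq, eq_iff_iff] at *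
      have := fun hs => e1 s hs z
      tauto

theorem aux_compl {G : Type*} [Group G] (S D : Set G) :
    cayleyBoundary G S Dᶜ = cayleyBoundary G S D := by
  ext ⟨s, x⟩
  simp only [cayleyBoundary, Set.mem_compl_iff, Set.mem_ofPred_eq, ne_eq, eq_iff_iff]
  tauto

theorem AuxMin.of_split {G : Type*} [Group G] {S D A B : Set G}
    (h : AuxMin S D) (hA : A.Nonempty) (hA2 : 2 * A.ncard ≤ Nat.card G)
    (hB2 : 2 * B.ncard ≤ Nat.card G) (hc : A.ncard + B.ncard = D.ncard)
    (hp : 0 < D.ncard)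
    (hb : (cayleyBoundary G S A).ncard + (cayleyBoundary G S B).ncard ≤
        (cayleyBoundary G S D).ncard) : AuxMin S A := by
  refine ⟨hA, hA2, fun C hC => ?_⟩
  have h1 := h.2.2 A hA2
  have h2 := h.2.2 B hB2
  have h3 := h.2.2 C hC
  have h4 : (cayleyBoundary G S A).ncard * D.ncard =
      (cayleyBoundary G S D).ncard * A.ncard := by nlinarith
  have : D.ncard * ((cayleyBoundary G S A).ncard * C.ncard) ≤
      D.ncard * ((cayleyBoundary G S C).ncard * A.ncard) := by
    calc _ = ((cayleyBoundary G S A).ncard * D.ncard) * C.ncard := by ring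
      _ = ((cayleyBoundary G S D).ncard * C.ncard) * A.ncard := by rw [h4]; ring
      _ ≤ ((cayleyBoundary G S C).ncard * D.ncard) * A.ncard := Nat.mul_le_mul_right _ h3
      _ = _ := by ring
  exact Nat.le_of_mul_le_mul_left this hp

theorem AuxMin.conn {G : Type*} [Group G] [Finite G] {S D : Set G}
    (hS : Subgroup.closure S = ⊤) (h : AuxMin S D) : InducedConnected G S D := by
  by_contra hc
  obtain ⟨A, B, hA, hB, hU, hd, hb⟩ := aux_split S D hc
  have hn := Set.ncard_union_eq hd (Set.toFinite _) (Set.toFinite _)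
  rw [hU] at hn
  have := h.2.1
  have hp := (h.pos hS).1
  have q1 := (h.of_split (B := B) hA (by omega) (by omega) hn.symm hp hb).quarter hS
  have q2 := (h.of_split (B := A) hB (by omega) (by omega) (by omega) hp (by omega)).quarter hS
  omega

theorem AuxMin.large {G : Type*} [Group G] [Finite G] {S D A : Set G}
    (hS : Subgroup.closure S = ⊤) (h : AuxMin S D) (hA : Nat.card G < 2 * A.ncard)
    (hAD : A.ncard + D.ncard < Nat.card G)
    (hb : (cayleyBoundary G S A).ncard ≤ (cayleyBoundary G S D).ncard) : False := by
  obtain ⟨hp, hne⟩ := h.pos hS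
  have hbp := (Set.ncard_pos (Set.toFinite _)).2 hne
  have hc := Set.ncard_add_ncard_compl A
  have := h.2.2 Aᶜ (by omega)
  rw [aux_compl] at this
  have h1 : D.ncard < Aᶜ.ncard := by omega
  nlinarith

theorem AuxMin.conn_compl {G : Type*} [Group G] [Finite G] {S D : Set G}
    (hS : Subgroup.closure S = ⊤) (h : AuxMin S D) : InducedConnected G S Dᶜ := by
  by_contra hc
  obtain ⟨A, B, hA, hB, hU, hd, hb⟩ := aux_split S Dᶜ hc
  have hn := Set.ncard_union_eq hd (Set.toFinite _) (Set.toFinite _)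
  rw [hU] at hn
  rw [aux_compl] at hb
  have hcc := Set.ncard_add_ncard_compl D
  have h2 := h.2.1
  obtain ⟨hp, hne⟩ := h.pos hS
  have hbp := (Set.ncard_pos (Set.toFinite _)).2 hne
  have hAp := (Set.ncard_pos (Set.toFinite _)).2 hA
  have hBp := (Set.ncard_pos (Set.toFinite _)).2 hB
  have hA2 : 2 * A.ncard ≤ Nat.card G := by
    by_contra hx
    exact h.large hS (A := A) (by omega) (by omega) (by omega)
  have hB2 : 2 * B.ncard ≤ Nat.card G := by
    by_contra hx
    exact h.large hS (A := B) (by omega) (by omega) (by omega)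
  have hle : A.ncard + B.ncard ≤ D.ncard := by
    have h1 := h.2.2 A hA2
    have h3 := h.2.2 B hB2
    by_contra hx
    push Not at hx
    nlinarith
  have hn' : A.ncard + B.ncard = D.ncard := by omega
  have q1 := (h.of_split (B := B) hA hA2 hB2 hn' hp hb).quarter hS
  have q2 := (h.of_split (B := A) hB hB2 hA2 (by omega) hp (by omega)).quarter hS
  omega


/-- **Lemma 4.1**: in a Cayley graph of a finite group, a minimising subset for the Cheeger
constant of size at most half the group has size more than a quarter of the group, and both
it and its complement induce connected subgraphs. -/
theorem statement5 {G : Type*} [Group G] [Finite G] (S : Set G)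
    (hS : Subgroup.closure S = ⊤) (D : Set G) (hD : D.Nonempty)
    (hmin : (Nat.card (cayleyBoundary G S D) : ℝ) / (Nat.card D : ℝ) = cayleyCheeger G S)
    (hhalf : 2 * (Nat.card D : ℝ) ≤ (Nat.card G : ℝ)) :
    (Nat.card G : ℝ) < 4 * (Nat.card D : ℝ) ∧
    InducedConnected G S D ∧ InducedConnected G S Dᶜ := by
  have hm : AuxMin S D := by
    simp only [Nat.card_coe_set_eq] at hmin hhalf
    have hp : 0 < D.ncard := (Set.ncard_pos (Set.toFinite _)).2 hD
    refine ⟨hD, by exact_mod_cast hhalf, fun A hA => ?_⟩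
    rcases A.eq_empty_or_nonempty with rfl | hne
    · simp
    have hpA : 0 < A.ncard := (Set.ncard_pos (Set.toFinite _)).2 hne
    have hle : cayleyCheeger G S ≤ ((cayleyBoundary G S A).ncard : ℝ) / (A.ncard : ℝ) := by
      apply csInf_le
      · refine ⟨0, ?_⟩
        rintro r ⟨C, _, _, rfl⟩
        positivity
      · exact ⟨A, hne, by simp only [Nat.card_coe_set_eq]; exact_mod_cast hA,
          by simp only [Nat.card_coe_set_eq]⟩
    rw [← hmin, div_le_div_iff₀ (by exact_mod_cast hp) (by exact_mod_cast hpA)] at hle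
    exact_mod_cast hle
  refine ⟨?_, hm.conn hS, hm.conn_compl hS⟩
  have := hm.quarter hS
  rw [Nat.card_coe_set_eq]
  exact_mod_cast this
end

section
/- Let G be a finitely generated group, let p be a prime, and let H be a subnormal subgroup of G whose index [G:H] is a (finite) power of p. Then d_p(H) − 1 ≤ [G:H]·(d_p(G) − 1), i.e. d_p(H) + [G:H] ≤ [G:H]·d_p(G) + 1. -/
open scoped TensorProduct

section Helpers

variable {G : Type*} [Group G]

/-- one-cocycles -/
def Z1 {k V : Type*} [Field k] [AddCommGroup V] [Module k V] (ρ : G →* Module.End k V) :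
    Submodule k (G → V) where
  carrier := {c | ∀ g h, c (g * h) = c g + ρ g (c h)}
  add_mem' := by
    intro a b ha hb g h
    simp only [Pi.add_apply, ha g h, hb g h, map_add]
    abel
  zero_mem' := by intro g h; simp
  smul_mem' := by
    intro r a ha g h
    simp [ha g h]

lemma mem_Z1 {k V : Type*} [Field k] [AddCommGroup V] [Module k V] (ρ : G →* Module.End k V)
    (c : G → V) : c ∈ Z1 ρ ↔ ∀ g h, c (g * h) = c g + ρ g (c h) := Iff.rfl

lemma Z1_finite {k V : Type*} [Field k] [AddCommGroup V] [Module k V] [Module.Finite k V]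
    (hG : Group.FG G) (ρ : G →* Module.End k V) : Module.Finite k (Z1 ρ) := by
  obtain ⟨S, hS⟩ := hG.out
  let f : Z1 ρ →ₗ[k] (S → V) :=
    { toFun := fun c s => c.1 s.1
      map_add' := fun _ _ => rfl
      map_smul' := fun _ _ => rfl }
  refine Module.Finite.of_injective f ?_
  rw [← LinearMap.ker_eq_bot, LinearMap.ker_eq_bot']
  rintro ⟨c, hc⟩ h
  have hc' : ∀ g h, c (g * h) = c g + ρ g (c h) := hc
  have h1 : c 1 = 0 := by simpa using hc' 1 1
  have key : ∀ g : G, c g = 0 := by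
    intro g
    have hg : g ∈ Subgroup.closure (S : Set G) := by rw [hS]; trivial
    induction hg using Subgroup.closure_induction with
    | mem x hx => exact congrFun h ⟨x, hx⟩
    | one => exact h1
    | mul x y _ _ hx hy => rw [hc', hx, hy]; simp
    | inv x _ hx =>
      have := hc' x⁻¹ x
      rw [hx, inv_mul_cancel, h1] at this
      simpa using this.symm
  ext g
  exact key g

lemma fixed_vec {p : ℕ} [Fact p.Prime] {V : Type*} [AddCommGroup V] [Module (ZMod p) V]
    [Module.Finite (ZMod p) V] [Nontrivial V] (ρ : G →* Module.End (ZMod p) V)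
    (hρ : ∀ g, ∃ k : ℕ, ρ (g ^ p ^ k) = 1) : ∃ v : V, v ≠ 0 ∧ ∀ g, ρ g v = v := by
  have : Finite V := Module.finite_of_finite (ZMod p)
  have hP : IsPGroup p ρ.toHomUnits.range := by
    rintro ⟨_, g, rfl⟩
    obtain ⟨k, hk⟩ := hρ g
    refine ⟨k, ?_⟩
    apply Subtype.ext
    apply Units.ext
    simpa using hk
  have hdvd : p ∣ Nat.card V := by
    rw [Module.natCard_eq_pow_finrank (K := ZMod p), Nat.card_zmod]
    exact dvd_pow_self _ (Module.finrank_pos).ne'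
  obtain ⟨b, hb, hb0⟩ := hP.exists_fixed_point_of_prime_dvd_card_of_fixed_point V hdvd
    (a := 0) (by intro g; exact smul_zero _)
  refine ⟨b, hb0.symm, fun g => ?_⟩
  exact hb ⟨ρ.toHomUnits g, g, rfl⟩

lemma Z1_bound {p : ℕ} [Fact p.Prime] (hG : Group.FG G) (n : ℕ) :
    ∀ {V : Type*} [AddCommGroup V] [Module (ZMod p) V]
    [Module.Finite (ZMod p) V] (ρ : G →* Module.End (ZMod p) V)
    (_ : ∀ g, ∃ k : ℕ, ρ (g ^ p ^ k) = 1) (_ : Module.finrank (ZMod p) V = n),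
    Module.finrank (ZMod p) (Z1 ρ) ≤
      n * Module.finrank (ZMod p) (Z1 (1 : G →* Module.End (ZMod p) (ZMod p))) := by
  induction n with
  | zero =>
    intro V _ _ _ ρ hρ hV
    have : Subsingleton V := Module.finrank_zero_iff.1 hV
    simp [Module.finrank_zero_of_subsingleton]
  | succ n ih =>
    intro V _ _ _ ρ hρ hV
    have : Nontrivial V := Module.nontrivial_of_finrank_pos (R := ZMod p) (by omega)
    obtain ⟨v, hv0, hv⟩ := fixed_vec ρ hρ
    let L : Submodule (ZMod p) V := Submodule.span (ZMod p) {v}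
    have hL : ∀ g, L ≤ L.comap (ρ g) := by
      intro g
      rw [Submodule.span_singleton_le_iff_mem, Submodule.mem_comap, hv]
      exact Submodule.mem_span_singleton_self v
    let ρ' : G →* Module.End (ZMod p) (V ⧸ L) :=
      { toFun := fun g => L.mapQ L (ρ g) (hL g)
        map_one' := by
          ext x; simp
        map_mul' := by
          intro g h
          ext x; simp }
    have hρ'a : ∀ g x, ρ' g (L.mkQ x) = L.mkQ (ρ g x) := fun g x => rfl
    have hρ' : ∀ g, ∃ k : ℕ, ρ' (g ^ p ^ k) = 1 := by
      intro g
      obtain ⟨k, hk⟩ := hρ g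
      refine ⟨k, ?_⟩
      ext x
      change ρ' _ (L.mkQ x) = L.mkQ x
      rw [hρ'a, hk]; rfl
    have hdim : Module.finrank (ZMod p) (V ⧸ L) = n := by
      have h1 := L.finrank_quotient_add_finrank
      have h2 : Module.finrank (ZMod p) L = 1 := finrank_span_singleton hv0
      omega
    have IH := ih ρ' hρ' hdim
    have f1 := Z1_finite hG ρ
    have f2 := Z1_finite hG ρ'
    have f3 := Z1_finite hG (1 : G →* Module.End (ZMod p) (ZMod p))
    let Φ : Z1 ρ →ₗ[ZMod p] Z1 ρ' :=
      { toFun := fun c => ⟨fun g => L.mkQ (c.1 g), by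
          intro g h
          change L.mkQ (c.1 (g * h)) = _
          rw [hρ'a, ← map_add, c.2 g h]⟩
        map_add' := fun a b => by ext g; simp
        map_smul' := fun r a => by ext g; simp }
    let Ψ : Z1 (1 : G →* Module.End (ZMod p) (ZMod p)) →ₗ[ZMod p] Z1 ρ :=
      { toFun := fun c => ⟨fun g => c.1 g • v, by
          intro g h
          simp only [c.2 g h, map_smul, hv, ← add_smul]
          rfl⟩
        map_add' := fun a b => by ext g; simp [add_smul]
        map_smul' := fun r a => by ext g; simp [mul_smul] }
    have hk : LinearMap.ker Φ ≤ LinearMap.range Ψ := by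
      rintro ⟨c, hc⟩ hcΦ
      have hcL : ∀ g, c g ∈ L := by
        intro g
        have h0 : Φ ⟨c, hc⟩ = 0 := hcΦ
        have := congrFun (congrArg Subtype.val h0) g
        exact (Submodule.Quotient.mk_eq_zero L).1 this
      choose f hf using fun g => Submodule.mem_span_singleton.1 (hcL g)
      refine ⟨⟨f, ?_⟩, ?_⟩
      · intro g h
        apply smul_left_injective (ZMod p) hv0
        have := (mem_Z1 ρ c).1 hc g h
        rw [← hf, ← hf g, ← hf h, map_smul, hv, ← add_smul] at this
        exact this
      · ext g
        exact hf g
    have e1 := Φ.finrank_range_add_finrank_ker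
    have e2 := Submodule.finrank_le (LinearMap.range Φ)
    have e3 := Submodule.finrank_mono hk
    have e4 := LinearMap.finrank_range_le Ψ
    rw [add_mul, one_mul]
    omega

lemma dp_eq (p : ℕ) [Fact p.Prime] :
    dp p G = Module.finrank (ZMod p) (Z1 (1 : G →* Module.End (ZMod p) (ZMod p))) := by
  unfold dp
  rw [← Subspace.dual_finrank_eq]
  let f : Module.Dual (ZMod p) (ZMod p ⊗[ℤ] Additive (Abelianization G)) →ₗ[ZMod p]
      Z1 (1 : G →* Module.End (ZMod p) (ZMod p)) :=
    { toFun := fun φ => ⟨fun g => φ (1 ⊗ₜ Additive.ofMul (Abelianization.of g)), by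
        intro g h
        simp [TensorProduct.tmul_add]⟩
      map_add' := fun a b => by ext g; simp
      map_smul' := fun r a => by ext g; simp }
  refine (LinearEquiv.ofBijective f ⟨?_, ?_⟩).finrank_eq
  · rw [← LinearMap.ker_eq_bot, LinearMap.ker_eq_bot']
    intro φ hφ
    have h1 : ∀ g : G, φ (1 ⊗ₜ Additive.ofMul (Abelianization.of g)) = 0 :=
      fun g => congrFun (congrArg Subtype.val hφ) g
    apply LinearMap.ext
    intro x
    induction x using TensorProduct.induction_on with
    | zero => simp
    | add x y hx hy => rw [map_add, hx, hy]; simp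
    | tmul r a =>
      obtain ⟨g, hg⟩ := QuotientGroup.mk_surjective (Additive.toMul a)
      have : r ⊗ₜ[ℤ] a = r • ((1 : ZMod p) ⊗ₜ[ℤ] Additive.ofMul (Abelianization.of g)) := by
        rw [TensorProduct.smul_tmul', smul_eq_mul, mul_one]
        congr 1
        exact congrArg Additive.ofMul hg.symm
      rw [this, map_smul, h1]; simp
  · rintro ⟨c, hc⟩
    let ch : G →* Multiplicative (ZMod p) :=
      MonoidHom.mk' (fun g => Multiplicative.ofAdd (c g)) (fun g h => by
        have := (mem_Z1 _ c).1 hc g h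
        rw [this]; rfl)
    let ca : Additive (Abelianization G) →+ ZMod p := 
      MonoidHom.toAdditiveLeft (Abelianization.lift ch)
    refine ⟨TensorProduct.AlgebraTensorModule.lift
      (LinearMap.toSpanSingleton (ZMod p) _ ca.toIntLinearMap), ?_⟩
    ext g
    simp [f, ca, ch]

/-- The permutation representation on functions on cosets. -/
def permRep (k : Type*) [Field k] (H : Subgroup G) : G →* Module.End k (G ⧸ H → k) where
  toFun g :=
    { toFun := fun f x => f (g⁻¹ • x)
      map_add' := fun _ _ => rfl
      map_smul' := fun _ _ => rfl }
  map_one' := by ext; simp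
  map_mul' := by
    intro g h
    apply LinearMap.ext
    intro f
    funext x
    simp [mul_smul]

lemma permRep_apply (k : Type*) [Field k] (H : Subgroup G) (g : G) (f : G ⧸ H → k) (x : G ⧸ H) :
    permRep k H g f x = f (g⁻¹ • x) := rfl

lemma normal_step (p : ℕ) [Fact p.Prime] (hG : Group.FG G) (H : Subgroup G) [H.Normal]
    (hpow : ∃ k : ℕ, H.index = p ^ k) :
    dp p ↥H + H.index ≤ H.index * dp p G + 1 := by
  obtain ⟨k, hk⟩ := hpow
  have hp0 : p ≠ 0 := (Fact.out : p.Prime).ne_zero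
  have hidx : H.index ≠ 0 := by rw [hk]; exact pow_ne_zero _ hp0
  have : H.FiniteIndex := ⟨hidx⟩
  have : Fintype (G ⧸ H) := Fintype.ofFinite _
  have hdim : Module.finrank (ZMod p) (G ⧸ H → ZMod p) = H.index := by
    rw [Module.finrank_fintype_fun_eq_card, ← Nat.card_eq_fintype_card]; rfl
  have hunip : ∀ g, ∃ k : ℕ, permRep (ZMod p) H (g ^ p ^ k) = 1 := by
    intro g
    refine ⟨k, ?_⟩
    have hm : g ^ p ^ k ∈ H := by rw [← hk]; exact H.pow_index_mem g
    apply LinearMap.ext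
    intro f
    funext x
    rw [permRep_apply]
    obtain ⟨y, rfl⟩ := QuotientGroup.mk_surjective x
    change f _ = f _
    congr 1
    change ((((g ^ p ^ k)⁻¹ * y : G)) : G ⧸ H) = y
    rw [QuotientGroup.eq]
    have := ‹H.Normal›.conj_mem _ hm y⁻¹
    simpa [mul_assoc] using this
  have hb := Z1_bound (p := p) hG _ (permRep (ZMod p) H) hunip hdim
  rw [dp_eq, dp_eq]
  set M := (G ⧸ H → ZMod p)
  have f1 := Z1_finite hG (permRep (ZMod p) H)
  -- restriction to H
  let Φ : Z1 (permRep (ZMod p) H) →ₗ[ZMod p] Z1 (1 : H →* Module.End (ZMod p) (ZMod p)) :=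
    { toFun := fun c => ⟨fun h => c.1 h ((1 : G) : G ⧸ H), by
        intro g h
        change c.1 ((g : G) * h) _ = c.1 g _ + c.1 h _
        rw [c.2, Pi.add_apply, permRep_apply]
        congr 1
        refine congrArg (c.1 (h : G)) ?_
        change (((g : G)⁻¹ * 1 : G) : G ⧸ H) = _
        rw [QuotientGroup.eq]
        simp⟩
      map_add' := fun a b => rfl
      map_smul' := fun r a => rfl }
  -- coboundaries
  let B : M →ₗ[ZMod p] Z1 (permRep (ZMod p) H) :=
    { toFun := fun f => ⟨fun g => permRep (ZMod p) H g f - f, by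
        intro g h
        simp only [map_mul, map_sub, Module.End.mul_apply]
        abel⟩
      map_add' := fun a b => by
        apply Subtype.ext; funext g
        simp only [map_add, Submodule.coe_add, Pi.add_apply]; abel
      map_smul' := fun r a => by
        apply Subtype.ext; funext g
        simp [smul_sub] }
  have hBΦ : LinearMap.range B ≤ LinearMap.ker Φ := by
    rintro _ ⟨f, rfl⟩
    rw [LinearMap.mem_ker]
    apply Subtype.ext; funext h
    change f ((h : G)⁻¹ • ((1 : G) : G ⧸ H)) - f ((1 : G) : G ⧸ H) = 0
    rw [sub_eq_zero]
    congr 1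
    change (((h : G)⁻¹ * 1 : G) : G ⧸ H) = _
    rw [QuotientGroup.eq]
    simp
  have hkB : Module.finrank (ZMod p) (LinearMap.ker B) ≤ 1 := by
    have hle : LinearMap.ker B ≤ Submodule.span (ZMod p) {(fun _ => 1 : M)} := by
      intro f hf
      rw [LinearMap.mem_ker] at hf
      rw [Submodule.mem_span_singleton]
      refine ⟨f ((1 : G) : G ⧸ H), ?_⟩
      funext x
      obtain ⟨y, rfl⟩ := QuotientGroup.mk_surjective x
      have h1 : f (y⁻¹ • (y : G ⧸ H)) - f (y : G ⧸ H) = 0 :=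
        congrFun (congrFun (congrArg Subtype.val hf) y) (y : G ⧸ H)
      have h2 : y⁻¹ • (y : G ⧸ H) = ((1 : G) : G ⧸ H) := by
        change ((y⁻¹ * y : G) : G ⧸ H) = _
        simp
      rw [h2, sub_eq_zero] at h1
      change f ((1 : G) : G ⧸ H) * 1 = f (y : G ⧸ H)
      rw [mul_one, h1]
    refine (Submodule.finrank_mono hle).trans ?_
    exact (finrank_span_le_card _).trans (by simp)
  have hsurj : Function.Surjective Φ := by
    rintro ⟨φ, hφ⟩
    have hφ' : ∀ a b : H, φ (a * b) = φ a + φ b := hφ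
    have hφ1 : φ 1 = 0 := by simpa using hφ' 1 1
    have hs : ∀ (g : G) (x : G ⧸ H), x.out⁻¹ * g * (g⁻¹ • x).out ∈ H := by
      intro g x
      rw [mul_assoc, ← QuotientGroup.eq]
      rw [QuotientGroup.out_eq']
      change x = g • (((g⁻¹ • x).out : G) : G ⧸ H)
      rw [QuotientGroup.out_eq', smul_inv_smul]
    refine ⟨⟨fun g x => φ ⟨_, hs g x⟩, ?_⟩, ?_⟩
    · intro g h
      funext x
      rw [Pi.add_apply, permRep_apply, ← hφ']
      refine congrArg φ ?_
      apply Subtype.ext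
      simp [mul_smul, mul_assoc]
    · apply Subtype.ext
      funext h
      change φ ⟨_, hs h ((1 : G) : G ⧸ H)⟩ = φ h
      have hq : (h : G)⁻¹ • ((1 : G) : G ⧸ H) = ((1 : G) : G ⧸ H) := by
        change (((h : G)⁻¹ * 1 : G) : G ⧸ H) = _
        rw [QuotientGroup.eq]
        simp
      have ht : (((1 : G) : G ⧸ H).out : G) ∈ H := by
        rw [← QuotientGroup.eq_one_iff, QuotientGroup.out_eq']; rfl
      let t : H := ⟨_, ht⟩
      have he : (⟨_, hs h ((1 : G) : G ⧸ H)⟩ : H) = t⁻¹ * h * t := by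
        apply Subtype.ext
        simp only [hq]
        rfl
      rw [he, hφ', hφ']
      have := hφ' t⁻¹ t
      rw [inv_mul_cancel, hφ1] at this
      linear_combination -this
  have e1 := Φ.finrank_range_add_finrank_ker
  rw [LinearMap.range_eq_top.2 hsurj, finrank_top] at e1
  have e2 := B.finrank_range_add_finrank_ker
  have e3 := Submodule.finrank_mono hBΦ
  rw [hdim] at e2
  omega

lemma dp_congr (p : ℕ) {A B : Type*} [Group A] [Group B] (e : A ≃* B) : dp p A = dp p B :=
  (TensorProduct.AlgebraTensorModule.congr (LinearEquiv.refl (ZMod p) (ZMod p))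
    (MulEquiv.toAdditive e.abelianizationCongr).toIntLinearEquiv).finrank_eq

lemma chain_step (p : ℕ) [Fact p.Prime] (H K : Subgroup G) (hK : Group.FG K) (hle : H ≤ K)
    (hn : ∀ g ∈ K, ∀ x ∈ H, g * x * g⁻¹ ∈ H) (hpow : ∃ k : ℕ, H.relIndex K = p ^ k) :
    dp p H + H.relIndex K ≤ H.relIndex K * dp p K + 1 := by
  have : (H.subgroupOf K).Normal := ⟨fun x hx g => hn g g.2 x hx⟩
  have := normal_step p hK (H.subgroupOf K) hpow
  rwa [dp_congr p (Subgroup.subgroupOfEquivOfLe hle)] at this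

end Helpers

/-- **Proposition 5.1**: for a subnormal subgroup `H` of `p`-power index in a finitely
generated group `G`, `d_p(H) - 1 ≤ [G:H] (d_p(G) - 1)`. -/
theorem statement7 {G : Type*} [Group G] (hG : Group.FG G) (p : ℕ) (hp : p.Prime)
    (H : Subgroup G) (hsub : IsSubnormal H) (hpow : ∃ k : ℕ, H.index = p ^ k) :
    dp p ↥H + H.index ≤ H.index * dp p G + 1 := by
  obtain ⟨n, c, h0, hn, hc⟩ := hsub
  obtain ⟨k, hk⟩ := hpow
  have : Fact p.Prime := ⟨hp⟩
  have hle : ∀ i ≤ n, c 0 ≤ c i := by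
    intro i
    induction i with
    | zero => intro _; exact le_rfl
    | succ i ih => intro hi; exact (ih (by omega)).trans (hc i (by omega)).1
  have hidx : H.index ≠ 0 := by rw [hk]; exact pow_ne_zero _ hp.ne_zero
  have hfg : ∀ i ≤ n, Group.FG (c i) := by
    intro i hi
    have hd : (c i).index ∣ H.index := h0 ▸ Subgroup.index_dvd_of_le (hle i hi)
    have : (c i).FiniteIndex := ⟨fun h => hidx (by rw [h] at hd; exact zero_dvd_iff.1 hd)⟩
    infer_instance
  have key : ∀ i ≤ n, dp p (c 0) + (c 0).relIndex (c i) ≤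
      (c 0).relIndex (c i) * dp p (c i) + 1 := by
    intro i
    induction i with
    | zero => intro _; simp
    | succ i ih =>
      intro hi
      have ih' := ih (by omega)
      have hm := Subgroup.relIndex_mul_relIndex _ _ _ (hle i (by omega)) (hc i (by omega)).1
      have hd : (c i).relIndex (c (i + 1)) ∣ p ^ k := by
        rw [← hk, ← h0, ← Subgroup.relIndex_mul_index (hle (i + 1) hi), ← hm]
        exact Dvd.dvd.mul_right (Dvd.intro_left _ rfl) _
      obtain ⟨m, _, hm'⟩ := (Nat.dvd_prime_pow hp).1 hd
      have hs := chain_step p (c i) (c (i + 1)) (hfg _ hi) (hc i (by omega)).1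
        (hc i (by omega)).2 ⟨m, hm'⟩
      rw [← hm]
      have h3 := Nat.mul_le_mul_left ((c 0).relIndex (c i)) hs
      nlinarith
  have hf := key n le_rfl
  rw [hn, Subgroup.relIndex_top_right, dp_congr p (Subgroup.topEquiv (G := G)), h0] at hf
  exact hf
end

section
/- Let L be a path-connected topological space and let Γ be a path-connected subset of L such that, for a basepoint b ∈ Γ, the homomorphism π₁(Γ, b) → π₁(L, b) induced by the inclusion is surjective. Let q : L̃ → L be a covering map with L̃ path-connected, and let Γ̃ = q⁻¹(Γ). Then Γ̃ is path-connected and, for any basepoint b̃ ∈ Γ̃, the homomorphism π₁(Γ̃, b̃) → π₁(L̃, b̃) induced by the inclusion is surjective. -/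
theorem aux_base {L : Type*} [TopologicalSpace L]
    (Γ : Set L) (hΓ : IsPathConnected Γ) (b : L) (hb : b ∈ Γ)
    (hsurj : ∀ γ : Path b b, ∃ γ' : Path b b, (∀ t, γ' t ∈ Γ) ∧ γ.Homotopic γ')
    (x y : L) (hx : x ∈ Γ) (hy : y ∈ Γ) (γ : Path x y) :
    ∃ γ' : Path x y, (∀ t, γ' t ∈ Γ) ∧ γ.Homotopic γ' := by
  obtain ⟨α, hα⟩ := hΓ.joinedIn b hb x hx
  obtain ⟨β, hβ⟩ := hΓ.joinedIn b hb y hy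
  obtain ⟨δ, hδ, h⟩ := hsurj ((α.trans γ).trans β.symm)
  refine ⟨(α.symm.trans δ).trans β, ?_, ?_⟩
  · intro t
    have : ((α.symm.trans δ).trans β) t ∈ Set.range ((α.symm.trans δ).trans β) := ⟨t, rfl⟩
    rw [Path.trans_range, Path.trans_range, Path.symm_range] at this
    rcases this with (⟨s, hs⟩ | ⟨s, hs⟩) | ⟨s, hs⟩
    · exact hs ▸ hα s
    · exact hs ▸ hδ s
    · exact hs ▸ hβ s
  · rw [← Path.Homotopic.Quotient.eq] at h ⊢
    simp only [Path.Homotopic.Quotient.mk_trans, Path.Homotopic.Quotient.mk_symm] at h ⊢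
    rw [← h]
    simp [← Path.Homotopic.Quotient.trans_assoc]
    simp [Path.Homotopic.Quotient.trans_assoc]

theorem aux_lift {L : Type*} [TopologicalSpace L] {L' : Type*} [TopologicalSpace L']
    (q : L' → L) (hq : IsCoveringMap q) (Γ : Set L) (x y : L') (γ : Path x y)
    (δ : Path (q x) (q y)) (hδ : ∀ t, δ t ∈ Γ) (h : (γ.map hq.continuous).Homotopic δ) :
    ∃ γ' : Path x y, (∀ t, γ' t ∈ q ⁻¹' Γ) ∧ γ.Homotopic γ' := by
  have e0 : γ.toContinuousMap = hq.liftPath (γ.map hq.continuous).toContinuousMap x (by simp) :=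
    (hq.eq_liftPath_iff' _).mpr ⟨rfl, γ.source⟩
  have hl := hq.homotopicRel_liftPath h x (by simp) (by simp)
  have h1 := hq.liftPath_apply_one_eq_of_homotopicRel h x (by simp) (by simp)
  rw [← e0] at hl h1
  refine ⟨⟨hq.liftPath δ.toContinuousMap x (by simp), hq.liftPath_zero .., h1.symm.trans γ.target⟩, ?_, hl⟩
  intro t
  have := congr_fun (hq.liftPath_lifts δ.toContinuousMap x (by simp)) t
  have h2 := hδ t
  change q (hq.liftPath δ.toContinuousMap x (by simp) t) ∈ Γ
  change q (hq.liftPath δ.toContinuousMap x (by simp) t) = δ t at this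
  rw [this]
  exact h2


/-- **Lemma 5.3**: if `Γ ⊆ L` is path-connected and π₁-surjective (every loop in `L` based
at a point of `Γ` is homotopic rel endpoints to a loop lying in `Γ`), and `q : L' → L` is a
covering map with `L'` path-connected, then the preimage of `Γ` is path-connected and
π₁-surjective in `L'`. -/
theorem statement8 {L : Type*} [TopologicalSpace L] [PathConnectedSpace L]
    (Γ : Set L) (hΓ : IsPathConnected Γ) (b : L) (hb : b ∈ Γ)
    (hsurj : ∀ γ : Path b b, ∃ γ' : Path b b, (∀ t, γ' t ∈ Γ) ∧ γ.Homotopic γ')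
    {L' : Type*} [TopologicalSpace L'] [PathConnectedSpace L']
    (q : L' → L) (hq : IsCoveringMap q) (hqsurj : Function.Surjective q) :
    IsPathConnected (q ⁻¹' Γ) ∧
    ∀ b' : L', b' ∈ q ⁻¹' Γ →
      ∀ γ : Path b' b', ∃ γ' : Path b' b',
        (∀ t, γ' t ∈ q ⁻¹' Γ) ∧ γ.Homotopic γ' := by
  
  have key : ∀ x y : L', x ∈ q ⁻¹' Γ → y ∈ q ⁻¹' Γ → ∀ γ : Path x y,
      ∃ γ' : Path x y, (∀ t, γ' t ∈ q ⁻¹' Γ) ∧ γ.Homotopic γ' := by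
    intro x y hx hy γ
    obtain ⟨δ, hδ, h⟩ := aux_base Γ hΓ b hb hsurj _ _ hx hy (γ.map hq.continuous)
    exact aux_lift q hq Γ x y γ δ hδ h
  refine ⟨?_, fun b' hb' γ => key b' b' hb' hb' γ⟩
  obtain ⟨b', rfl⟩ := hqsurj b
  refine ⟨b', hb, fun {y} hy => ?_⟩
  obtain ⟨γ', h, -⟩ := key b' y hb hy (PathConnectedSpace.somePath b' y)
  exact ⟨γ', h⟩
end
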